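/- arXiv:1710.07089 — 8 statements merged into one kernel-verified Lean document; each statement's English description precedes it below -/
import Mathlib

section
/- Let G=(V,E) be a finite simple graph, S ⊆ V, and f : S → ℤ with f(v) ≥ 2 for all v ∈ S. If for every nonempty subset X ⊆ S the closed neighborhood satisfies |Γ*_G(X)| > Σ_{x∈X} f(x), then G contains a forest subgraph F such that d_F(v) ≥ f(v) for every v ∈ S. -/
/-- The closed neighborhood of a finite vertex set `X` in `G`. -/
def closedNbhd {V : Type*} (G : SimpleGraph V) (X : Finset V) : Set V :=
  {v : V | v ∈ X ∨ ∃ x ∈ X, G.Adj x v}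

/-- One step of shrinking a family of sets satisfying a strong Hall condition: of two distinct
elements whose removal from `e a` leaves something behind, one can be removed. -/
theorem exists_erase_of_strongHall {ι V : Type*} [DecidableEq ι] [DecidableEq V]
    {e : ι → Finset V}
    (he : ∀ A : Finset ι, A.Nonempty → A.card < (A.biUnion e).card)
    {a : ι} {u v : V} (huv : u ≠ v) (hne : (((e a).erase u).erase v).Nonempty) :
    (∀ A : Finset ι, A.Nonempty →
        A.card < (A.biUnion (Function.update e a ((e a).erase u))).card) ∨
      (∀ A : Finset ι, A.Nonempty →
        A.card < (A.biUnion (Function.update e a ((e a).erase v))).card) := by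
  by_contra! ⟨⟨A, hA, hAc⟩, ⟨B, hB, hBc⟩⟩
  have mem_of_card_le : ∀ (w : V) (C : Finset ι), C.Nonempty →
      (C.biUnion (Function.update e a ((e a).erase w))).card ≤ C.card → a ∈ C := by
    intro w C hC hCc
    by_contra haC
    have hcongr : C.biUnion (Function.update e a ((e a).erase w)) = C.biUnion e :=
      Finset.biUnion_congr rfl fun i hi =>
        Function.update_of_ne (ne_of_mem_of_not_mem hi haC) _ _
    have := he C hC
    rw [hcongr] at hCc
    omega
  have haA := mem_of_card_le u A hA hAc
  have haB := mem_of_card_le v B hB hBc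
  set P := A.biUnion (Function.update e a ((e a).erase u)) with hP
  set Q := B.biUnion (Function.update e a ((e a).erase v)) with hQ
  have mem_P : ∀ x, x ∈ P ↔ (∃ i ∈ A, i ≠ a ∧ x ∈ e i) ∨ (x ≠ u ∧ x ∈ e a) := by
    intro x
    simp only [hP, Finset.mem_biUnion, Function.update_apply]
    constructor
    · rintro ⟨i, hi, hx⟩
      split_ifs at hx with h
      · exact Or.inr (by simpa using hx)
      · exact Or.inl ⟨i, hi, h, hx⟩
    · rintro (⟨i, hi, h, hx⟩ | hx)
      · exact ⟨i, hi, by simpa [h] using hx⟩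
      · exact ⟨a, haA, by simpa using hx⟩
  have mem_Q : ∀ x, x ∈ Q ↔ (∃ i ∈ B, i ≠ a ∧ x ∈ e i) ∨ (x ≠ v ∧ x ∈ e a) := by
    intro x
    simp only [hQ, Finset.mem_biUnion, Function.update_apply]
    constructor
    · rintro ⟨i, hi, hx⟩
      split_ifs at hx with h
      · exact Or.inr (by simpa using hx)
      · exact Or.inl ⟨i, hi, h, hx⟩
    · rintro (⟨i, hi, h, hx⟩ | hx)
      · exact ⟨i, hi, by simpa [h] using hx⟩
      · exact ⟨a, haB, by simpa using hx⟩
  have union_sub : (A ∪ B).biUnion e ⊆ P ∪ Q := by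
    intro x hx
    simp only [Finset.mem_biUnion, Finset.mem_union] at hx ⊢
    rw [mem_P, mem_Q]
    obtain ⟨i, hi, hx⟩ := hx
    grind
  have inter_sub : ((A ∩ B).erase a).biUnion e ∪ ((e a).erase u).erase v ⊆ P ∩ Q := by
    intro x hx
    simp only [Finset.mem_biUnion, Finset.mem_union, Finset.mem_inter, Finset.mem_erase] at hx ⊢
    rw [mem_P, mem_Q]
    grind
  have inter_card : (A ∩ B).card ≤ (P ∩ Q).card := by
    have haAB : a ∈ A ∩ B := Finset.mem_inter.2 ⟨haA, haB⟩
    have hcard := Finset.card_erase_add_one haAB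
    rcases ((A ∩ B).erase a).eq_empty_or_nonempty with h | h
    · rw [h, Finset.card_empty] at hcard
      have := Finset.card_le_card (Finset.subset_union_right.trans inter_sub)
      have := hne.card_pos
      omega
    · have := Finset.card_le_card (Finset.subset_union_left.trans inter_sub)
      have := he _ h
      omega
  have := Finset.card_le_card union_sub
  have := he (A ∪ B) (hA.mono Finset.subset_union_left)
  have := Finset.card_union_add_card_inter A B
  have := Finset.card_union_add_card_inter P Q
  omega

/-- A family of pointed sets satisfying the strong Hall condition can be shrunk to a family of
pairs, each containing its base point, that still satisfies it. -/
theorem exists_pairs_of_strongHall {ι V : Type*} [Fintype ι] [DecidableEq ι] [DecidableEq V]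
    (c : ι → V) (e : ι → Finset V) (hc : ∀ i, c i ∈ e i)
    (he : ∀ A : Finset ι, A.Nonempty → A.card < (A.biUnion e).card) :
    ∃ w : ι → V, (∀ i, w i ∈ e i) ∧
      ∀ A : Finset ι, A.Nonempty → A.card < (A.biUnion fun i => {c i, w i}).card := by
  induction hn : ∑ i, (e i).card using Nat.strong_induction_on generalizing e with
  | _ n ih =>
  by_cases hbig : ∃ a, 2 < (e a).card
  · obtain ⟨a, ha⟩ := hbig
    have step : ∀ u ∈ e a, u ≠ c a →
        (∀ A : Finset ι, A.Nonempty →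
          A.card < (A.biUnion (Function.update e a ((e a).erase u))).card) →
        ∃ w : ι → V, (∀ i, w i ∈ e i) ∧
          ∀ A : Finset ι, A.Nonempty → A.card < (A.biUnion fun i => {c i, w i}).card := by
      intro u hu huc hH
      have hsub : ∀ i, Function.update e a ((e a).erase u) i ⊆ e i := by
        intro i
        rcases eq_or_ne i a with rfl | h
        · simpa using Finset.erase_subset _ _
        · simp [h]
      have hlt : ∑ i, (Function.update e a ((e a).erase u) i).card < n := by
        rw [← hn]
        refine Finset.sum_lt_sum (fun i _ => Finset.card_le_card (hsub i))
          ⟨a, Finset.mem_univ a, ?_⟩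
        simpa using Finset.card_erase_lt_of_mem hu
      obtain ⟨w, hw, hwH⟩ := ih _ hlt (Function.update e a ((e a).erase u)) (fun i => by
        rcases eq_or_ne i a with rfl | h
        · simp [hc i, huc.symm]
        · simp [h, hc i]) hH rfl
      exact ⟨w, fun i => hsub i (hw i), hwH⟩
    have hcard := Finset.card_erase_of_mem (hc a)
    obtain ⟨u, hu, v, hv, huv⟩ := Finset.one_lt_card.1 (show 1 < ((e a).erase (c a)).card by omega)
    rw [Finset.mem_erase] at hu hv
    have hne : (((e a).erase u).erase v).Nonempty :=
      ⟨c a, by simp [hc a, hu.1.symm, hv.1.symm]⟩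
    rcases exists_erase_of_strongHall he huv hne with h | h
    · exact step u hu.2 hu.1 h
    · exact step v hv.2 hv.1 h
  · push Not at hbig
    have hpair : ∀ i, ∃ w, e i = {c i, w} := by
      intro i
      have h2 := he {i} (Finset.singleton_nonempty i)
      simp only [Finset.card_singleton, Finset.singleton_biUnion] at h2
      obtain ⟨x, y, -, hxy⟩ := Finset.card_eq_two.1 (le_antisymm (hbig i) h2)
      have hci := hc i
      rw [hxy, Finset.mem_insert, Finset.mem_singleton] at hci
      rcases hci with h | h
      · exact ⟨y, by rw [hxy, h]⟩
      · exact ⟨x, by rw [hxy, h, Finset.pair_comm]⟩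
    choose w hw using hpair
    refine ⟨w, fun i => by simp [hw i], fun A hA => ?_⟩
    rw [← Finset.biUnion_congr rfl fun i _ => hw i]
    exact he A hA

/-- A family of pairs satisfying the strong Hall condition forms the edge set of a forest. -/
theorem isAcyclic_fromEdgeSet_of_strongHall {ι V : Type*} [DecidableEq ι] [DecidableEq V]
    {c w : ι → V}
    (h : ∀ A : Finset ι, A.Nonempty → A.card < (A.biUnion fun i => {c i, w i}).card) :
    (SimpleGraph.fromEdgeSet (Set.range fun i => s(c i, w i))).IsAcyclic := by
  intro r p hp
  have hex : ∀ x : {x // x ∈ p.edges.toFinset}, ∃ i, s(c i, w i) = x.1 := by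
    rintro ⟨x, hx⟩
    have := p.edges_subset_edgeSet (List.mem_toFinset.1 hx)
    rw [SimpleGraph.edgeSet_fromEdgeSet] at this
    exact this.1
  choose g hg using hex
  have hinj : Function.Injective g := fun x y hxy =>
    Subtype.ext (by rw [← hg x, ← hg y, hxy])
  have hcard : (Finset.univ.image g).card = p.length := by
    rw [Finset.card_image_of_injective _ hinj, Finset.card_univ, Fintype.card_coe,
      List.toFinset_card_of_nodup hp.edges_nodup, p.length_edges]
  have hsub : ((Finset.univ.image g).biUnion fun i => {c i, w i}) ⊆ p.support.tail.toFinset := by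
    intro x hx
    simp only [Finset.mem_biUnion, Finset.mem_image, Finset.mem_univ, true_and] at hx
    obtain ⟨_, ⟨y, rfl⟩, hx⟩ := hx
    have hy : s(c (g y), w (g y)) ∈ p.edges := hg y ▸ List.mem_toFinset.1 y.2
    have hxs : x ∈ p.support := by
      rw [Finset.mem_insert, Finset.mem_singleton] at hx
      rcases hx with rfl | rfl
      · exact p.fst_mem_support_of_mem_edges hy
      · exact p.snd_mem_support_of_mem_edges hy
    rw [List.mem_toFinset]
    rcases p.mem_support_iff.1 hxs with rfl | hxt
    · exact p.end_mem_tail_support hp.not_nil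
    · exact hxt
  have hle := (Finset.card_le_card hsub).trans (List.toFinset_card_le _)
  rw [List.length_tail, p.length_support] at hle
  have hlen := hp.three_le_length
  have := h (Finset.univ.image g) (Finset.card_pos.1 (by omega))
  omega

/-- Egawa–Ozeki: a sufficient condition for a forest subgraph with degree
lower bounds `f` on `S`. -/
theorem forest_with_degree_lower_bounds
    {V : Type*} [Fintype V] (G : SimpleGraph V) (S : Finset V) (f : V → ℤ)
    (hf : ∀ v ∈ S, 2 ≤ f v)
    (hcond : ∀ X : Finset V, X ⊆ S → X.Nonempty →
      (∑ x ∈ X, f x) < (Nat.card (closedNbhd G X) : ℤ)) :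
    ∃ F : SimpleGraph V, F ≤ G ∧ F.IsAcyclic ∧
      ∀ v ∈ S, f v ≤ (Nat.card (F.neighborSet v) : ℤ) := by
  classical
  let ι := Σ x : S, Fin (f x).toNat
  let c : ι → V := fun i => i.1
  let e : ι → Finset V := fun i => (closedNbhd G {c i}).toFinset
  have mem_e : ∀ i x, x ∈ e i ↔ x = c i ∨ G.Adj (c i) x := by
    intro i x
    rw [Set.mem_toFinset]
    simp [closedNbhd]
  have he : ∀ A : Finset ι, A.Nonempty → A.card < (A.biUnion e).card := by
    intro A hA
    have hXS : A.image c ⊆ S := by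
      intro x hx
      obtain ⟨i, -, rfl⟩ := Finset.mem_image.1 hx
      exact i.1.2
    have hlt := hcond (A.image c) hXS (hA.image c)
    have hN : Nat.card (closedNbhd G (A.image c)) = (A.biUnion e).card := by
      rw [← Nat.card_eq_finsetCard]
      refine congrArg (fun s : Set V => Nat.card s) (Set.ext fun x => ?_)
      simp only [closedNbhd, Set.mem_ofPred_eq, Finset.mem_coe, Finset.mem_biUnion, mem_e,
        Finset.mem_image]
      grind
    have hle : (A.card : ℤ) ≤ ∑ x ∈ A.image c, f x := by
      rw [Finset.card_eq_sum_card_image c A, Nat.cast_sum]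
      refine Finset.sum_le_sum fun x hx => ?_
      have hxS := hXS hx
      have hfib : (A.filter fun i => c i = x) ⊆
          Finset.univ.image fun j : Fin (f x).toNat => (⟨⟨x, hxS⟩, j⟩ : ι) := by
        rintro ⟨⟨y, hy⟩, j⟩ hi
        obtain rfl : y = x := (Finset.mem_filter.1 hi).2
        exact Finset.mem_image.2 ⟨j, Finset.mem_univ _, rfl⟩
      have h1 := (Finset.card_le_card hfib).trans Finset.card_image_le
      rw [Finset.card_univ, Fintype.card_fin] at h1
      have := hf x hxS
      omega
    omega
  obtain ⟨w, hw, hH⟩ := exists_pairs_of_strongHall c e (fun i => (mem_e i _).2 (Or.inl rfl)) he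
  have hcw : ∀ i, c i ≠ w i := by
    intro i h
    have := hH {i} (Finset.singleton_nonempty i)
    simp [h] at this
  refine ⟨SimpleGraph.fromEdgeSet (Set.range fun i => s(c i, w i)), ?_,
    isAcyclic_fromEdgeSet_of_strongHall hH, fun v hv => ?_⟩
  · rw [← SimpleGraph.fromEdgeSet_edgeSet G]
    refine SimpleGraph.fromEdgeSet_mono ?_
    rintro _ ⟨i, rfl⟩
    exact ((mem_e i _).1 (hw i)).resolve_left (hcw i).symm
  · let φ : Fin (f v).toNat →
        (SimpleGraph.fromEdgeSet (Set.range fun i => s(c i, w i))).neighborSet v := fun j =>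
      ⟨w ⟨⟨v, hv⟩, j⟩, (SimpleGraph.fromEdgeSet_adj _).2 ⟨⟨⟨⟨v, hv⟩, j⟩, rfl⟩, hcw ⟨⟨v, hv⟩, j⟩⟩⟩
    have hφ : Function.Injective φ := by
      intro j k hjk
      by_contra hne
      have hwjk : w ⟨⟨v, hv⟩, j⟩ = w ⟨⟨v, hv⟩, k⟩ := congrArg Subtype.val hjk
      have hcard : ({⟨⟨v, hv⟩, j⟩, ⟨⟨v, hv⟩, k⟩} : Finset ι).card = 2 :=
        Finset.card_pair fun h => hne (eq_of_heq (Sigma.mk.inj h).2)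
      have hlt := hH {⟨⟨v, hv⟩, j⟩, ⟨⟨v, hv⟩, k⟩} (Finset.insert_nonempty _ _)
      rw [hcard, Finset.biUnion_insert, Finset.singleton_biUnion, ← hwjk, Finset.union_self] at hlt
      exact absurd hlt (not_lt.2 Finset.card_le_two)
    have := Nat.card_le_card_of_injective φ hφ
    rw [Nat.card_fin] at this
    omega
end

section
/- Let G=(V,E) be a finite simple connected graph, S ⊆ V, and f : S → ℤ with f(v) ≥ 2 for all v ∈ S. If for every nonempty subset X ⊆ S we have |Γ*_G(X)| > Σ_{x∈X} f(x), then G has a spanning tree T such that d_T(v) ≥ f(v) for every v ∈ S. -/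
open Finset Module in
/-- **Rado's theorem** for vector spaces: a finite family of finite sets of vectors has a linearly
independent transversal if the union of any subfamily spans a subspace whose dimension is at least
the number of members. -/
theorem exists_linearIndependent_transversal {K M ι : Type*} [Field K] [AddCommGroup M] [Module K M]
    [FiniteDimensional K M] [Fintype ι] (A : ι → Finset M)
    (hA : ∀ J : Finset ι, #J ≤ finrank K ↥(J.sup fun i => Submodule.span K (A i : Set M))) :
    ∃ a : ι → M, (∀ i, a i ∈ A i) ∧ LinearIndependent K a := by
  classical
  induction hn : ∑ i, #(A i) using Nat.strong_induction_on generalizing A with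
  | _ n ih =>
  by_cases hsmall : ∀ i, #(A i) ≤ 1
  · have hne : ∀ i, ∃ a, a ∈ A i := by
      intro i
      by_contra! h
      have h1 := hA {i}
      simp [Finset.eq_empty_of_forall_notMem h] at h1
    choose a ha using hne
    refine ⟨a, ha, linearIndependent_iff_card_le_finrank_span.2 ?_⟩
    refine (hA univ).trans (Submodule.finrank_mono (Finset.sup_le fun i _ => ?_))
    refine Submodule.span_le.2 fun v hv => ?_
    rw [Finset.card_le_one.1 (hsmall i) v hv (a i) (ha i)]
    exact Submodule.subset_span ⟨i, rfl⟩
  · push Not at hsmall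
    obtain ⟨i, hi⟩ := hsmall
    obtain ⟨a, ha, b, hb, hab⟩ := Finset.one_lt_card.1 hi
    have key : ∀ c ∈ A i,
        (∃ a : ι → M, (∀ i, a i ∈ A i) ∧ LinearIndependent K a) ∨
        ∃ J : Finset ι, i ∈ J ∧ finrank K ↥((J.erase i).sup (fun k => Submodule.span K (A k : Set M))
          ⊔ Submodule.span K (((A i).erase c : Finset M) : Set M)) < #J := by
      intro c hc
      have hsub : ∀ k, Function.update A i ((A i).erase c) k ⊆ A k := by
        intro k
        by_cases hk : k = i
        · subst hk; simpa using Finset.erase_subset _ _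
        · simp [hk]
      by_cases h : ∀ J : Finset ι, #J ≤ finrank K
          ↥(J.sup fun k => Submodule.span K (Function.update A i ((A i).erase c) k : Set M))
      · left
        obtain ⟨v, hv, hli⟩ := ih _ (by
          rw [← hn]
          refine Finset.sum_lt_sum (fun k _ => Finset.card_le_card (hsub k)) ⟨i, mem_univ _, ?_⟩
          simpa using Finset.card_erase_lt_of_mem hc) _ h rfl
        exact ⟨v, fun k => hsub k (hv k), hli⟩
      · right
        push Not at h
        obtain ⟨J, hJ⟩ := h
        have hcongr : (J.erase i).sup
            (fun k => Submodule.span K (Function.update A i ((A i).erase c) k : Set M)) =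
            (J.erase i).sup (fun k => Submodule.span K (A k : Set M)) :=
          Finset.sup_congr rfl fun k hk => by
            rw [Function.update_of_ne (Finset.ne_of_mem_erase hk)]
        have hiJ : i ∈ J := by
          by_contra hiJ
          rw [Finset.erase_eq_of_notMem hiJ] at hcongr
          rw [hcongr] at hJ
          exact absurd (hA J) (by omega)
        refine ⟨J, hiJ, ?_⟩
        rw [← Finset.insert_erase hiJ, Finset.sup_insert, hcongr, Function.update_self, sup_comm,
          Finset.insert_erase hiJ] at hJ
        exact hJ
    rcases key a ha with h | ⟨J₁, hi₁, h₁⟩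
    · exact h
    rcases key b hb with h | ⟨J₂, hi₂, h₂⟩
    · exact h
    exfalso
    let P : Finset ι → Submodule K M := fun J => J.sup fun k => Submodule.span K (A k : Set M)
    change finrank K ↥(P (J₁.erase i) ⊔ _) < _ at h₁
    change finrank K ↥(P (J₂.erase i) ⊔ _) < _ at h₂
    have hsup : P (J₁ ∪ J₂) ≤
        (P (J₁.erase i) ⊔ Submodule.span K (((A i).erase a : Finset M) : Set M)) ⊔
        (P (J₂.erase i) ⊔ Submodule.span K (((A i).erase b : Finset M) : Set M)) := by
      refine Finset.sup_le fun k hk => ?_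
      by_cases hki : k = i
      · subst hki
        refine Submodule.span_le.2 fun v hv => ?_
        by_cases hva : v = a
        · exact Submodule.mem_sup_right (Submodule.mem_sup_right
            (Submodule.subset_span (hva ▸ Finset.mem_coe.2 (Finset.mem_erase.2 ⟨hab, ha⟩))))
        · exact Submodule.mem_sup_left (Submodule.mem_sup_right
            (Submodule.subset_span (Finset.mem_coe.2 (Finset.mem_erase.2 ⟨hva, hv⟩))))
      · rcases Finset.mem_union.1 hk with hk | hk
        · exact (Finset.le_sup (f := fun k => Submodule.span K (A k : Set M))
            (Finset.mem_erase.2 ⟨hki, hk⟩)).trans (le_sup_left.trans le_sup_left)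
        · exact (Finset.le_sup (f := fun k => Submodule.span K (A k : Set M))
            (Finset.mem_erase.2 ⟨hki, hk⟩)).trans (le_sup_left.trans le_sup_right)
    have hinf : P ((J₁ ∩ J₂).erase i) ≤
        (P (J₁.erase i) ⊔ Submodule.span K (((A i).erase a : Finset M) : Set M)) ⊓
        (P (J₂.erase i) ⊔ Submodule.span K (((A i).erase b : Finset M) : Set M)) :=
      le_inf
        (le_sup_of_le_left (Finset.sup_mono (Finset.erase_subset_erase _ Finset.inter_subset_left)))
        (le_sup_of_le_left (Finset.sup_mono (Finset.erase_subset_erase _ Finset.inter_subset_right)))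
    have e₁ := (hA (J₁ ∪ J₂)).trans (Submodule.finrank_mono hsup)
    have e₂ := (hA ((J₁ ∩ J₂).erase i)).trans (Submodule.finrank_mono hinf)
    have e₃ := Submodule.finrank_sup_add_finrank_inf_eq
      (P (J₁.erase i) ⊔ Submodule.span K (((A i).erase a : Finset M) : Set M))
      (P (J₂.erase i) ⊔ Submodule.span K (((A i).erase b : Finset M) : Set M))
    have e₄ := Finset.card_union_add_card_inter J₁ J₂
    have e₅ := Finset.card_erase_add_one (Finset.mem_inter.2 ⟨hi₁, hi₂⟩)
    omega

namespace SimpleGraph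

variable {V : Type*}

open scoped Classical in
/-- The vector of an edge directed from `v` to `u`: a column of the oriented incidence matrix. -/
noncomputable def edgeVector (u v : V) : V → ℚ := Pi.single u 1 - Pi.single v 1

lemma edgeVector_swap (u v : V) : edgeVector v u = -edgeVector u v := by
  simp [edgeVector]

lemma Reachable.edgeVector_mem {G : SimpleGraph V} {W : Submodule ℚ (V → ℚ)}
    (hW : ∀ u v, G.Adj u v → edgeVector u v ∈ W) {u v : V} (h : G.Reachable u v) :
    edgeVector u v ∈ W := by
  obtain ⟨p⟩ := h
  induction p with
  | nil => simp [edgeVector]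
  | @cons a b c hab _ ih =>
    have : edgeVector a c = edgeVector a b + edgeVector b c := by simp [edgeVector]
    exact this ▸ W.add_mem (hW _ _ hab) ih

/-- A subspace containing the vectors of all edges of `G` has dimension at least the
number of vertices minus the number of connected components of `G`. -/
lemma card_le_finrank_add_card_connectedComponent [Fintype V] {G : SimpleGraph V}
    {W : Submodule ℚ (V → ℚ)} (hW : ∀ u v, G.Adj u v → edgeVector u v ∈ W) :
    Nat.card V ≤ Module.finrank ℚ W + Nat.card G.ConnectedComponent := by
  classical
  have : Fintype G.ConnectedComponent := Fintype.ofFinite _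
  let r : G.ConnectedComponent → V → ℚ := fun c => Pi.single c.out 1
  have htop : (⊤ : Submodule ℚ (V → ℚ)) ≤ W ⊔ Submodule.span ℚ (Set.range r) := by
    rw [← (Pi.basisFun ℚ V).span_eq, Submodule.span_le]
    rintro _ ⟨v, rfl⟩
    have hv : Pi.basisFun ℚ V v = edgeVector v (G.connectedComponentMk v).out +
        r (G.connectedComponentMk v) := by simp [edgeVector, r]
    rw [hv]
    refine Submodule.add_mem_sup (Reachable.edgeVector_mem hW ?_) (Submodule.subset_span ⟨_, rfl⟩)
    exact ConnectedComponent.exact (Quot.out_eq _).symm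
  have h₁ := Submodule.finrank_mono htop
  rw [finrank_top, Module.finrank_fintype_fun_eq_card] at h₁
  have h₂ := Submodule.finrank_add_le_finrank_add_finrank W (Submodule.span ℚ (Set.range r))
  have h₃ := finrank_range_le_card (R := ℚ) r
  rw [Set.finrank] at h₃
  rw [Nat.card_eq_fintype_card, Nat.card_eq_fintype_card]
  omega

/-- Edges with linearly independent vectors form a forest. -/
lemma isAcyclic_of_linearIndependent_edgeVector {ι : Type*} {s t : ι → V}
    (h : LinearIndependent ℚ fun i => edgeVector (s i) (t i)) :
    (fromEdgeSet (Set.range fun i => s(s i, t i))).IsAcyclic := by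
  rw [isAcyclic_iff_forall_isBridge]
  intro e he
  obtain ⟨⟨i, rfl⟩, -⟩ := (edgeSet_fromEdgeSet _ ▸ he :)
  rw [isBridge_iff]
  intro hreach
  refine h.notMem_span_image (s := {i}ᶜ) (x := i) (by simp) (hreach.edgeVector_mem ?_)
  intro u v huv
  obtain ⟨huv, hne⟩ := (deleteEdges_adj ..).1 huv
  obtain ⟨⟨j, hj⟩, -⟩ := (fromEdgeSet_adj _).1 huv
  have hji : j ∈ ({i}ᶜ : Set ι) := by
    rintro rfl
    exact hne hj.symm
  have hmem := Submodule.subset_span (R := ℚ)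
    (Set.mem_image_of_mem (fun i => edgeVector (s i) (t i)) hji)
  rcases Sym2.eq_iff.1 hj with ⟨rfl, rfl⟩ | ⟨rfl, rfl⟩
  · exact hmem
  · rw [edgeVector_swap]
    exact Submodule.neg_mem _ hmem

/-- The dimension of the span of the stars of the vertices in `X` is at least the demand on `X`. -/
lemma sum_le_finrank_of_edgeVector_mem [Fintype V] {G : SimpleGraph V} {g : V → ℕ} {X : Finset V}
    (hg : ∀ Y ⊆ X, Y.Nonempty → ∑ x ∈ Y, g x < Nat.card (closedNbhd G Y))
    {W : Submodule ℚ (V → ℚ)} (hW : ∀ x ∈ X, ∀ u, G.Adj x u → edgeVector x u ∈ W) :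
    ∑ x ∈ X, g x ≤ Module.finrank ℚ W := by
  classical
  let H : SimpleGraph V :=
    { Adj := fun u v => G.Adj u v ∧ (u ∈ X ∨ v ∈ X)
      symm := ⟨fun u v h => ⟨h.1.symm, h.2.symm⟩⟩
      loopless := ⟨fun u h => G.loopless.irrefl u h.1⟩ }
  have hH : ∀ u v, H.Adj u v → edgeVector u v ∈ W := by
    rintro u v ⟨huv, hu | hv⟩
    · exact hW u hu v huv
    · rw [edgeVector_swap]
      exact W.neg_mem (hW v hv u huv.symm)
  have hrank := card_le_finrank_add_card_connectedComponent hH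
  have : Fintype H.ConnectedComponent := Fintype.ofFinite _
  have : DecidableEq H.ConnectedComponent := Classical.decEq _
  have hcomp : ∀ c : H.ConnectedComponent,
      ∑ x ∈ X with H.connectedComponentMk x = c, g x + 1 ≤
        ({v : V | H.connectedComponentMk v = c} : Finset V).card := by
    intro c
    rcases (X.filter fun x => H.connectedComponentMk x = c).eq_empty_or_nonempty with h | h
    · rw [h, Finset.sum_empty, zero_add, Nat.one_le_iff_ne_zero, ← Nat.pos_iff_ne_zero,
        Finset.card_pos]
      exact ⟨c.out, Finset.mem_filter.2 ⟨Finset.mem_univ _, Quot.out_eq c⟩⟩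
    · refine (hg _ (Finset.filter_subset _ _) h).trans_le ?_
      rw [Nat.card_coe_set_eq, ← Set.ncard_coe_finset]
      refine Set.ncard_le_ncard ?_ (Set.toFinite _)
      rintro v (hv | ⟨x, hx, hxv⟩)
      · simpa using (Finset.mem_filter.1 hv).2
      · obtain ⟨hxX, rfl⟩ := Finset.mem_filter.1 hx
        have : H.Adj v x := ⟨hxv.symm, Or.inr hxX⟩
        simpa using this.reachable
  have hsum := Finset.sum_le_sum fun c (_ : c ∈ Finset.univ) => hcomp c
  rw [Finset.sum_add_distrib, Finset.sum_fiberwise, ← Finset.card_eq_sum_card_fiberwise (by simp)]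
    at hsum
  rw [Nat.card_eq_fintype_card, Nat.card_eq_fintype_card] at hrank
  simp at hsum
  omega

/-- A forest in which every vertex has at least a prescribed degree. -/
theorem exists_isAcyclic_le_card_neighborSet [Fintype V] (G : SimpleGraph V) (g : V → ℕ)
    (hg : ∀ X : Finset V, (∀ x ∈ X, g x ≠ 0) → X.Nonempty →
      ∑ x ∈ X, g x < Nat.card (closedNbhd G X)) :
    ∃ F ≤ G, F.IsAcyclic ∧ ∀ v, g v ≤ Nat.card (F.neighborSet v) := by
  classical
  obtain ⟨a, ha, hli⟩ := exists_linearIndependent_transversal (K := ℚ)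
    (fun p : Σ v : V, Fin (g v) => ({u : V | G.Adj p.1 u} : Finset V).image (edgeVector p.1)) (by
      intro J
      have hJ : J ⊆ (J.image Sigma.fst).sigma fun _ => Finset.univ := fun p hp => by
        simpa using ⟨p.2, hp⟩
      refine (Finset.card_le_card hJ).trans ?_
      rw [Finset.card_sigma]
      simp only [Finset.card_univ, Fintype.card_fin]
      refine sum_le_finrank_of_edgeVector_mem (G := G) (fun Y hY => hg Y fun x hx => ?_) ?_
      · obtain ⟨p, -, rfl⟩ := Finset.mem_image.1 (hY hx)
        exact (Fin.pos p.2).ne'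
      · intro x hx u hxu
        obtain ⟨p, hp, rfl⟩ := Finset.mem_image.1 hx
        refine (Finset.le_sup (f := fun p : Σ v : V, Fin (g v) => Submodule.span ℚ
          (({u : V | G.Adj p.1 u} : Finset V).image (edgeVector p.1) : Set (V → ℚ))) hp)
          (Submodule.subset_span ?_)
        simpa using ⟨u, hxu, rfl⟩)
  simp only [Finset.mem_image, Finset.mem_filter, Finset.mem_univ, true_and] at ha
  choose t hadj ht using ha
  obtain rfl : (fun p => edgeVector p.1 (t p)) = a := funext ht
  refine ⟨_, ?_, isAcyclic_of_linearIndependent_edgeVector hli, fun v => ?_⟩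
  · intro u v huv
    obtain ⟨⟨p, hp⟩, -⟩ := (fromEdgeSet_adj _).1 huv
    have := hadj p
    rwa [← mem_edgeSet, show s(p.1, t p) = s(u, v) from hp, mem_edgeSet] at this
  · rw [← Nat.card_fin (g v)]
    refine Nat.card_le_card_of_injective
      (fun j => (⟨t ⟨v, j⟩, (fromEdgeSet_adj _).2 ⟨⟨⟨v, j⟩, rfl⟩, (hadj ⟨v, j⟩).ne⟩⟩ :
        (fromEdgeSet (Set.range fun p : Σ v : V, Fin (g v) => s(p.1, t p))).neighborSet v)) ?_
    intro j k hjk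
    have : t ⟨v, j⟩ = t ⟨v, k⟩ := congrArg Subtype.val hjk
    have h : (⟨v, j⟩ : Σ v : V, Fin (g v)) = ⟨v, k⟩ := hli.injective (by simp only [this])
    simpa using h

end SimpleGraph


/-- Egawa–Ozeki: a sufficient condition for a spanning tree with degree
lower bounds `f` on `S` in a connected graph. -/
theorem spanning_tree_with_degree_lower_bounds
    {V : Type*} [Fintype V] (G : SimpleGraph V) (hG : G.Connected)
    (S : Finset V) (f : V → ℤ) (hf : ∀ v ∈ S, 2 ≤ f v)
    (hcond : ∀ X : Finset V, X ⊆ S → X.Nonempty →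
      (∑ x ∈ X, f x) < (Nat.card (closedNbhd G X) : ℤ)) :
    ∃ T : SimpleGraph V, T ≤ G ∧ T.IsTree ∧
      ∀ v ∈ S, f v ≤ (Nat.card (T.neighborSet v) : ℤ) := by
  classical
  obtain ⟨F, hFG, hF, hdeg⟩ := G.exists_isAcyclic_le_card_neighborSet
    (fun v => if v ∈ S then (f v).toNat else 0) (by
      intro X hX hne
      have hXS : X ⊆ S := fun x hx => by
        by_contra h
        exact hX x hx (if_neg h)
      have h := hcond X hXS hne
      rw [← Nat.cast_lt (α := ℤ), Nat.cast_sum]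
      refine lt_of_eq_of_lt (Finset.sum_congr rfl fun x hx => ?_) h
      have := hf x (hXS hx)
      rw [if_pos (hXS hx)]
      omega)
  obtain ⟨T, hFT, hTG, hT⟩ := hG.exists_isTree_le_of_le_of_isAcyclic hFG hF
  refine ⟨T, hTG, hT, fun v hv => ?_⟩
  have h₁ := hdeg v
  rw [if_pos hv] at h₁
  have h₂ : Nat.card (F.neighborSet v) ≤ Nat.card (T.neighborSet v) :=
    Nat.card_mono (Set.toFinite _) fun u hu => hFT hu
  omega
end

section
/- Let B = (S' ∪ V, E') be a finite bipartite graph with parts S' and V, and f : S' → ℤ with f(x') ≥ 2 for all x' ∈ S'. Then B has a forest subgraph F₀ with d_{F₀}(x') = f(x') + 1 for every x' ∈ S' if and only if for every nonempty X' ⊆ S' we have |Γ_B(X')| > Σ_{x'∈X'} f(x'). -/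
open Finset in
/-- The neighbourhood system `M` has strict `f`-surplus on nonempty sets. -/
def StrictHall {α β : Type*} [DecidableEq β] (f : α → ℤ) (M : α → Finset β) : Prop :=
  ∀ X : Finset α, X.Nonempty → ∑ a ∈ X, f a < #(X.biUnion M)

open Finset in
/-- Sets attaining equality in the strict Hall condition are closed under intersections. -/
theorem StrictHall.card_biUnion_inter_le {α β : Type*} [DecidableEq α] [DecidableEq β]
    {f : α → ℤ} {M : α → Finset β} (h : StrictHall f M) {X Y : Finset α}
    (hX : (#(X.biUnion M) : ℤ) ≤ ∑ a ∈ X, f a + 1)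
    (hY : (#(Y.biUnion M) : ℤ) ≤ ∑ a ∈ Y, f a + 1) (hXY : (X ∩ Y).Nonempty) :
    (#((X ∩ Y).biUnion M) : ℤ) ≤ ∑ a ∈ X ∩ Y, f a + 1 := by
  have hunion := h (X ∪ Y) (hXY.mono (inter_subset_left.trans subset_union_left))
  have hsum := sum_union_inter (s₁ := X) (s₂ := Y) (f := f)
  have hcard := card_union_add_card_inter (X.biUnion M) (Y.biUnion M)
  have hle : #((X ∩ Y).biUnion M) ≤ #(X.biUnion M ∩ Y.biUnion M) :=
    card_le_card (subset_inter (biUnion_subset_biUnion_of_subset_left _ inter_subset_left)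
      (biUnion_subset_biUnion_of_subset_left _ inter_subset_right))
  rw [union_biUnion] at hunion
  lia

open Finset in
theorem StrictHall.card_eq_of_minimal {α β : Type*} [DecidableEq α] [DecidableEq β]
    {f : α → ℤ} {M : α → Finset β} (h : Minimal (StrictHall f) M) {x : α} (hx : 0 ≤ f x) :
    (#(M x) : ℤ) = f x + 1 := by
  have hlow := h.prop {x} (singleton_nonempty x)
  simp only [sum_singleton, singleton_biUnion] at hlow
  by_contra hne
  have hcrit : ∀ v ∈ M x, ∃ X : Finset α, x ∈ X ∧
      (#(X.biUnion M) : ℤ) ≤ ∑ a ∈ X, f a + 1 ∧ ∀ a ∈ X, v ∈ M a → a = x := by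
    intro v hv
    set M' := Function.update M x ((M x).erase v) with hM'
    have hle : M' ≤ M := by
      intro a
      by_cases ha : a = x
      · subst ha; simp [hM', erase_subset]
      · simp [hM', ha]
    have hnot : ¬ StrictHall f M' := by
      intro hH
      have : v ∈ M' x := h.le_of_le hH hle x hv
      simp [hM'] at this
    simp only [StrictHall, not_forall, not_lt] at hnot
    obtain ⟨X, hX, hcard⟩ := hnot
    have hsub : X.biUnion M ⊆ insert v (X.biUnion M') := by
      intro b hb
      obtain ⟨a, ha, hba⟩ := mem_biUnion.1 hb
      by_cases hbv : b = v
      · simp [hbv]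
      · refine mem_insert_of_mem (mem_biUnion.2 ⟨a, ha, ?_⟩)
        by_cases hax : a = x
        · subst hax; simp [hM', hbv, hba]
        · simpa [hM', hax] using hba
    have hX' := h.prop X hX
    have hv' : v ∉ X.biUnion M' := by
      intro hmem
      rw [insert_eq_of_mem hmem] at hsub
      have := card_le_card hsub
      lia
    have hpriv : ∀ a ∈ X, v ∈ M a → a = x := by
      intro a ha hva
      by_contra hax
      exact hv' (mem_biUnion.2 ⟨a, ha, by simpa [hM', hax] using hva⟩)
    refine ⟨X, ?_, ?_, hpriv⟩
    · by_contra hx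
      have : X.biUnion M' = X.biUnion M := biUnion_congr rfl fun a ha => by
        have hax : a ≠ x := fun e => hx (e ▸ ha)
        simp [hM', hax]
      rw [this] at hcard
      lia
    · have := (card_le_card hsub).trans (card_insert_le _ _)
      lia
  choose! T hxT hT hpriv using hcrit
  have hinter : ∀ s : Finset β, s ⊆ M x → s.Nonempty → ∃ X : Finset α, x ∈ X ∧
      (#(X.biUnion M) : ℤ) ≤ ∑ a ∈ X, f a + 1 ∧ ∀ v ∈ s, ∀ a ∈ X, v ∈ M a → a = x := by
    intro s hs hne
    induction hne using Finset.Nonempty.cons_induction with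
    | singleton v =>
      have hv := hs (mem_singleton_self v)
      exact ⟨T v, hxT v hv, hT v hv, by simpa using hpriv v hv⟩
    | cons v s hvs hne ih =>
      have hv := hs (mem_cons_self v s)
      obtain ⟨X, hxX, hX, hXpriv⟩ := ih ((subset_cons hvs).trans hs)
      have hx : x ∈ T v ∩ X := mem_inter.2 ⟨hxT v hv, hxX⟩
      refine ⟨T v ∩ X, hx, h.prop.card_biUnion_inter_le (hT v hv) hX ⟨x, hx⟩, ?_⟩
      intro w hw a ha hwa
      rcases mem_cons.1 hw with rfl | hw
      · exact hpriv w hv a (mem_inter.1 ha).1 hwa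
      · exact hXpriv w hw a (mem_inter.1 ha).2 hwa
  obtain ⟨X, hxX, hX, hXpriv⟩ := hinter _ subset_rfl (card_pos.1 (by lia))
  have hdisj : Disjoint (M x) ((X.erase x).biUnion M) := by
    rw [disjoint_left]
    intro v hv hv'
    obtain ⟨a, ha, hva⟩ := mem_biUnion.1 hv'
    exact (mem_erase.1 ha).1 (hXpriv v hv a (mem_erase.1 ha).2 hva)
  have hcard : #(X.biUnion M) = #(M x) + #((X.erase x).biUnion M) := by
    rw [← card_union_of_disjoint hdisj, ← biUnion_insert, insert_erase hxX]
  have hsum := add_sum_erase X f hxX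
  have hrest : ∑ a ∈ X.erase x, f a ≤ #((X.erase x).biUnion M) := by
    rcases (X.erase x).eq_empty_or_nonempty with he | he
    · simp [he]
    · exact (h.prop _ he).le
  lia

theorem SimpleGraph.IsAcyclic.card_edgeSet_lt {V : Type*} [Finite V] [Nonempty V]
    {G : SimpleGraph V} (hG : G.IsAcyclic) : Nat.card G.edgeSet < Nat.card V := by
  obtain ⟨T, hGT, -, hT⟩ :=
    (SimpleGraph.connected_top (V := V)).exists_isTree_le_of_le_of_isAcyclic le_top hG
  have := (SimpleGraph.isTree_iff_connected_and_card.1 hT).2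
  have := Nat.card_mono (Set.toFinite T.edgeSet) (SimpleGraph.edgeSet_mono hGT)
  lia

theorem Sym2.mk_inl_inr_injective {α β : Type*} :
    Function.Injective fun p : (_ : α) × β => s((Sum.inl p.1 : α ⊕ β), Sum.inr p.2) := by
  rintro ⟨a, b⟩ ⟨a', b'⟩ h
  simpa using h

open Finset in
/-- In a forest on `α ⊕ β`, the stars around a nonempty set `X` of left vertices span
fewer edges than vertices. -/
theorem SimpleGraph.IsAcyclic.sum_card_lt {α β : Type*} [DecidableEq α] [DecidableEq β]
    {F : SimpleGraph (α ⊕ β)} (hF : F.IsAcyclic) {M : α → Finset β}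
    (hM : ∀ a, ∀ b ∈ M a, F.Adj (Sum.inl a) (Sum.inr b)) {X : Finset α} (hX : X.Nonempty) :
    ∑ a ∈ X, #(M a) < #X + #(X.biUnion M) := by
  set s : Finset (α ⊕ β) := X.disjSum (X.biUnion M) with hs
  obtain ⟨x, hx⟩ := hX
  have : Nonempty s := ⟨⟨Sum.inl x, by simp [hs, hx]⟩⟩
  have hlt := (hF.induce (s : Set (α ⊕ β))).card_edgeSet_lt
  have hs' : Nat.card s = #X + #(X.biUnion M) := by simp [hs, card_disjSum]
  have hsub : ((X.sigma M).image fun p => s((Sum.inl p.1 : α ⊕ β), Sum.inr p.2) : Set _) ⊆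
      Sym2.map Subtype.val '' (F.induce (s : Set (α ⊕ β))).edgeSet := by
    intro e he
    simp only [coe_image, Set.mem_image, mem_coe, mem_sigma] at he
    obtain ⟨⟨a, b⟩, ⟨ha, hb⟩, rfl⟩ := he
    have hbX : b ∈ X.biUnion M := mem_biUnion.2 ⟨a, ha, hb⟩
    exact ⟨s(⟨Sum.inl a, by simp [hs, ha]⟩, ⟨Sum.inr b, by simpa [hs] using hbX⟩),
      by simpa using hM a b hb, by simp⟩
  have h1 := (Set.ncard_le_ncard hsub (Set.toFinite _)).trans (Set.ncard_image_le (Set.toFinite _))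
  rw [Set.ncard_coe_finset, card_image_of_injective _ Sym2.mk_inl_inr_injective,
    card_sigma] at h1
  exact h1.trans_lt (hs' ▸ hlt)

/-- The bipartite graph with left neighbourhoods `M`. -/
def bipartiteGraphOf {α β : Type*} (M : α → Finset β) : SimpleGraph (α ⊕ β) :=
  SimpleGraph.fromRel fun x y => ∃ a, ∃ b ∈ M a, x = Sum.inl a ∧ y = Sum.inr b

theorem bipartiteGraphOf_adj_inl_inr {α β : Type*} {M : α → Finset β} {a : α} {b : β} :
    (bipartiteGraphOf M).Adj (Sum.inl a) (Sum.inr b) ↔ b ∈ M a := by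
  simp [bipartiteGraphOf]

theorem bipartiteGraphOf_adj {α β : Type*} {M : α → Finset β} {x y : α ⊕ β} :
    (bipartiteGraphOf M).Adj x y ↔ ∃ a, ∃ b ∈ M a, s(x, y) = s(Sum.inl a, Sum.inr b) := by
  rcases x with a | b <;> rcases y with a' | b' <;> simp [bipartiteGraphOf]

theorem card_neighborSet_bipartiteGraphOf {α β : Type*} (M : α → Finset β) (a : α) :
    Nat.card ((bipartiteGraphOf M).neighborSet (Sum.inl a)) = (M a).card := by
  have : (bipartiteGraphOf M).neighborSet (Sum.inl a) = Sum.inr '' (M a : Set β) := by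
    ext (x | y) <;> simp [bipartiteGraphOf]
  rw [this, Nat.card_image_of_injective Sum.inr_injective, Nat.card_eq_fintype_card]
  simp

open Finset in
theorem StrictHall.isAcyclic_bipartiteGraphOf {α β : Type*} [Finite α] [Finite β]
    [DecidableEq α] [DecidableEq β]
    {f : α → ℤ} {M : α → Finset β} (h : StrictHall f M) (hM : ∀ a, (#(M a) : ℤ) = f a + 1) :
    (bipartiteGraphOf M).IsAcyclic := by
  classical
  have := Fintype.ofFinite α
  have := Fintype.ofFinite β
  rw [SimpleGraph.isAcyclic_iff_forall_isBridge]
  intro e he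
  induction e with | _ x y
  obtain ⟨a, b, hb, hxy⟩ := bipartiteGraphOf_adj.1 he
  rw [hxy, SimpleGraph.isBridge_iff]
  intro hreach
  set G := (bipartiteGraphOf M).deleteEdges {s(Sum.inl a, Sum.inr b)} with hG
  set C := G.connectedComponentMk (Sum.inl a)
  have haC : Sum.inl a ∈ C.supp := rfl
  have hbC : Sum.inr b ∈ C.supp := SimpleGraph.ConnectedComponent.sound hreach.symm
  set X : Finset α := {a' | Sum.inl a' ∈ C.supp} with hX
  have haX : a ∈ X := by simpa [hX] using haC
  have hverts : X.disjSum (X.biUnion M) ⊆ C.supp.toFinset := by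
    intro z hz
    rw [Set.mem_toFinset]
    rcases z with a' | b'
    · simpa [hX] using hz
    · rw [inr_mem_disjSum, mem_biUnion] at hz
      obtain ⟨a', ha', hb'⟩ := hz
      by_cases heq : a' = a ∧ b' = b
      · rw [heq.2]; exact hbC
      · refine C.mem_supp_of_adj_mem_supp (by simpa [hX] using ha') ?_
        rw [hG, SimpleGraph.deleteEdges_adj]
        exact ⟨bipartiteGraphOf_adj_inl_inr.2 hb', by simpa using heq⟩
  have hedges : Sym2.map Subtype.val '' C.toSimpleGraph.edgeSet ⊆
      (((X.sigma M).erase ⟨a, b⟩).image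
        fun p => s((Sum.inl p.1 : α ⊕ β), Sum.inr p.2) : Finset _) := by
    rintro _ ⟨e, he, rfl⟩
    induction e with | _ u v
    have huv := SimpleGraph.deleteEdges_adj.1 (show G.Adj u v from he)
    obtain ⟨a', b', hb', heq⟩ := bipartiteGraphOf_adj.1 huv.1
    have ha' : a' ∈ X := by
      have : Sum.inl a' ∈ s(u.1, v.1) := heq ▸ Sym2.mem_mk_left _ _
      rcases Sym2.mem_iff.1 this with h | h
      · exact (mem_filter_univ a').2 (h ▸ u.2)
      · exact (mem_filter_univ a').2 (h ▸ v.2)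
    simp only [coe_image, Set.mem_image, mem_coe, mem_erase, mem_sigma]
    refine ⟨⟨a', b'⟩, ⟨?_, ha', hb'⟩, heq.symm⟩
    intro hab
    apply huv.2
    rw [heq]
    cases hab
    rfl
  have hconn := C.connected_toSimpleGraph.card_vert_le_card_edgeSet_add_one
  have h1 := Set.ncard_le_ncard hedges
  rw [Set.ncard_image_of_injective _ (Sym2.map.injective Subtype.val_injective),
    Set.ncard_coe_finset, card_image_of_injective _ Sym2.mk_inl_inr_injective,
    card_erase_of_mem (by simp [haX, hb]), card_sigma] at h1
  have h2 := card_le_card hverts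
  rw [card_disjSum, ← Set.ncard_eq_toFinset_card'] at h2
  have h3 := h X ⟨a, haX⟩
  have h4 : (∑ a ∈ X, #(M a) : ℤ) = ∑ a ∈ X, f a + #X := by
    simp [hM, sum_add_distrib]
  have h5 : 0 < ∑ a ∈ X, #(M a) := sum_pos' (by simp) ⟨a, haX, card_pos.2 ⟨b, hb⟩⟩
  change C.supp.ncard ≤ C.toSimpleGraph.edgeSet.ncard + 1 at hconn
  zify at h5
  have h6 : ((∑ a ∈ X, #(M a) : ℕ) : ℤ) = ∑ a ∈ X, (#(M a) : ℤ) := by push_cast; rfl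
  lia

/-- Lovász (1970): a bipartite graph `B` on parts `α` (playing the role of `S'`)
and `β` (playing the role of `V`) has a forest subgraph in which every vertex
`x' ∈ S'` has degree exactly `f(x') + 1` iff Hall-type condition
`|Γ_B(X')| > f(X')` holds for all nonempty `X' ⊆ S'`. -/
theorem lovasz_bipartite_forest
    {α β : Type*} [Fintype α] [Fintype β]
    (B : SimpleGraph (α ⊕ β))
    (hbip : ∀ x y, B.Adj x y → (x.isLeft ∧ y.isRight) ∨ (x.isRight ∧ y.isLeft))
    (f : α → ℤ) (hf : ∀ a, 2 ≤ f a) :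
    (∃ F : SimpleGraph (α ⊕ β), F ≤ B ∧ F.IsAcyclic ∧
        ∀ a : α, (Nat.card (F.neighborSet (Sum.inl a)) : ℤ) = f a + 1) ↔
      (∀ X' : Finset α, X'.Nonempty →
        (∑ a ∈ X', f a) <
          (Nat.card {b : β | ∃ a ∈ X', B.Adj (Sum.inl a) (Sum.inr b)} : ℤ)) := by
  classical
  set N : α → Finset β := fun a => {b | B.Adj (Sum.inl a) (Sum.inr b)} with hN
  have hΓ : ∀ X : Finset α, Nat.card {b : β | ∃ a ∈ X, B.Adj (Sum.inl a) (Sum.inr b)} =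
      (X.biUnion N).card := by
    intro X
    rw [Nat.card_coe_set_eq, ← Set.ncard_coe_finset]
    congr 1
    ext b
    simp [hN]
  simp only [hΓ]
  constructor
  · rintro ⟨F, hFB, hF, hdeg⟩ X hX
    set M : α → Finset β := fun a => {b | F.Adj (Sum.inl a) (Sum.inr b)} with hM
    have hcard : ∀ a, ((M a).card : ℤ) = f a + 1 := by
      intro a
      have : F.neighborSet (Sum.inl a) = Sum.inr '' (M a : Set β) := by
        ext (x | y)
        · have : ¬ F.Adj (Sum.inl a) (Sum.inl x) := fun h => by simpa using hbip _ _ (hFB h)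
          simpa using this
        · simp [hM]
      rw [← hdeg a, this, Nat.card_image_of_injective Sum.inr_injective, Nat.card_coe_set_eq,
        Set.ncard_coe_finset]
    have hlt := hF.sum_card_lt (M := M) (fun a b hb => by simpa [hM] using hb) hX
    have hmono : (X.biUnion M).card ≤ (X.biUnion N).card :=
      Finset.card_le_card <| Finset.biUnion_mono fun a _ b hb => by
        simp only [hM, hN, Finset.mem_filter_univ] at hb ⊢
        exact hFB hb
    zify at hlt
    simp only [hcard, Finset.sum_add_distrib, Finset.sum_const, nsmul_eq_mul, mul_one] at hlt
    lia
  · intro hH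
    obtain ⟨M, hMN, hM⟩ :=
      (Set.toFinite {M : α → Finset β | StrictHall f M}).exists_le_minimal (a := N) hH
    have hcard : ∀ a, ((M a).card : ℤ) = f a + 1 := fun a =>
      StrictHall.card_eq_of_minimal hM (zero_le_two.trans (hf a))
    refine ⟨bipartiteGraphOf M, ?_, StrictHall.isAcyclic_bipartiteGraphOf hM.prop hcard, ?_⟩
    · intro x y hxy
      obtain ⟨a, b, hb, heq⟩ := bipartiteGraphOf_adj.1 hxy
      have : B.Adj (Sum.inl a) (Sum.inr b) := by simpa [hN] using hMN a hb
      rwa [← SimpleGraph.mem_edgeSet, heq]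
    · intro a
      rw [card_neighborSet_bipartiteGraphOf, hcard]
end

section
/- Let G be a finite simple graph and d ≥ 2 an integer. If for every nonempty subset X of the vertices we have 2(d+1)·|X| > (d+2)·i(X), where i(X) is the number of edges of G induced by X, then there is a forest subgraph F of G such that d_G(v) − d_F(v) ≤ d for every vertex v. -/
/-- The number of edges of `G` induced by the vertex set `X`. -/
noncomputable def inducedEdges {V : Type*} (G : SimpleGraph V) (X : Finset V) : ℕ :=
  Nat.card (G.induce (X : Set V)).edgeSet

/-- The members of `E` whose set of endpoints lies in `X`. -/
def edgesWithin {V ε : Type*} [DecidableEq V] (ends : ε → Finset V) (E : Finset ε)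
    (X : Finset V) : Finset ε :=
  E.filter fun e => ends e ⊆ X

lemma mem_edgesWithin {V ε : Type*} [DecidableEq V] {ends : ε → Finset V} {E : Finset ε}
    {X : Finset V} {e : ε} : e ∈ edgesWithin ends E X ↔ e ∈ E ∧ ends e ⊆ X :=
  Finset.mem_filter

/-- A multigraph given by endpoint sets is a forest when every nonempty vertex set spans fewer
edges than it has vertices. -/
def IsSparseForest {V ε : Type*} [DecidableEq V] (ends : ε → Finset V) (F : Finset ε) : Prop :=
  ∀ Y : Finset V, Y.Nonempty → (edgesWithin ends F Y).card < Y.card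

/-- The sparsity condition with vertex capacities `c`. -/
def CapacitySparse {V ε : Type*} [DecidableEq V] (d : ℕ) (ends : ε → Finset V) (c : V → ℕ)
    (E : Finset ε) : Prop :=
  ∀ X : Finset V, X.Nonempty →
    (d + 2) * (edgesWithin ends E X).card < ∑ v ∈ X, 2 * (c v + 1)

section

variable {V ε : Type*} [DecidableEq V]

lemma edgesWithin_empty {ends : ε → Finset V} {E : Finset ε}
    (hne : ∀ e ∈ E, (ends e).Nonempty) : edgesWithin ends E ∅ = ∅ := by
  ext e
  simp only [mem_edgesWithin, Finset.subset_empty, Finset.notMem_empty, iff_false, not_and]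
  exact fun he => (hne e he).ne_empty

/-- If every edge has an endpoint of capacity zero, the sparsity condition forces a forest. -/
lemma CapacitySparse.isSparseForest {d : ℕ} {ends : ε → Finset V} {c : V → ℕ} {E : Finset ε}
    (hE : CapacitySparse d ends c E) (hc : ∀ v, c v ≤ d)
    (hcard : ∀ e ∈ E, (ends e).card ≤ 2) (hzero : ∀ e ∈ E, ∃ v ∈ ends e, c v = 0) :
    IsSparseForest ends E := by
  intro Y
  induction Y using Finset.strongInduction with
  | H Y ih =>
    intro hY
    by_contra! hle
    set A := Y.filter fun v => c v ≠ 0 with hA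
    set B := Y.filter fun v => ¬ c v ≠ 0 with hB
    have hAB : A.card + B.card = Y.card := Finset.card_filter_add_card_filter_not _
    have hdeg : ∀ v ∈ A, 2 ≤ ((edgesWithin ends E Y).filter fun e => v ∈ ends e).card := by
      intro v hv
      obtain ⟨hvY, hcv⟩ := Finset.mem_filter.1 hv
      have hpos : 0 < (edgesWithin ends E Y).card := hY.card_pos.trans_le hle
      obtain ⟨e, he⟩ := Finset.card_pos.1 hpos
      obtain ⟨heE, heY⟩ := mem_edgesWithin.1 he
      obtain ⟨w, hw, hcw⟩ := hzero e heE
      have hwv : w ≠ v := by rintro rfl; exact hcv hcw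
      have hlt := ih (Y.erase v) (Finset.erase_ssubset hvY)
        ⟨w, Finset.mem_erase.2 ⟨hwv, heY hw⟩⟩
      rw [Finset.card_erase_of_mem hvY] at hlt
      have hsplit := Finset.card_filter_add_card_filter_not (s := edgesWithin ends E Y)
        (fun e => v ∈ ends e)
      have hsub : ((edgesWithin ends E Y).filter fun e => ¬ v ∈ ends e) ⊆
          edgesWithin ends E (Y.erase v) := by
        intro e he
        simp only [Finset.mem_filter, mem_edgesWithin] at he ⊢
        exact ⟨he.1.1, Finset.subset_erase.2 ⟨he.1.2, he.2⟩⟩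
      have := Finset.card_le_card hsub
      omega
    have hdouble : 2 * A.card ≤ (edgesWithin ends E Y).card := by
      have h1 := Finset.card_nsmul_le_sum A _ 2 hdeg
      have h2 := Finset.sum_card_bipartiteAbove_eq_sum_card_bipartiteBelow
        (s := A) (t := edgesWithin ends E Y) (fun v e => v ∈ ends e)
      simp only [Finset.bipartiteAbove, Finset.bipartiteBelow] at h2
      have h3 : ∑ e ∈ edgesWithin ends E Y, (A.filter fun v => v ∈ ends e).card ≤
          (edgesWithin ends E Y).card • 1 := by
        refine Finset.sum_le_card_nsmul _ _ _ fun e he => ?_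
        obtain ⟨heE, -⟩ := mem_edgesWithin.1 he
        obtain ⟨w, hw, hcw⟩ := hzero e heE
        have hsub : (A.filter fun v => v ∈ ends e) ⊆ (ends e).erase w := by
          intro v hv
          simp only [hA, Finset.mem_filter] at hv
          refine Finset.mem_erase.2 ⟨?_, hv.2⟩
          rintro rfl
          exact hv.1.2 hcw
        have := Finset.card_le_card hsub
        rw [Finset.card_erase_of_mem hw] at this
        have := hcard e heE
        omega
      simp only [smul_eq_mul, mul_one] at h1 h3
      omega
    have hsum : ∑ v ∈ Y, 2 * (c v + 1) ≤ A.card * (2 * (d + 1)) + B.card * 2 := by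
      rw [← Finset.sum_filter_add_sum_filter_not Y fun v => c v ≠ 0]
      refine add_le_add (Finset.sum_le_card_nsmul _ _ _ fun v _ => ?_)
        (Finset.sum_le_card_nsmul _ _ _ fun v hv => ?_)
      · have := hc v
        omega
      · have := (Finset.mem_filter.1 hv).2
        omega
    have hlt := hE Y hY
    have hab : A.card < B.card := by nlinarith
    nlinarith

variable [DecidableEq ε]

/-- Assigning an edge between vertices of positive capacity to the complement of the forest
preserves sparsity, provided vertex sets that span some but not all edges have slack. -/
lemma CapacitySparse.erase {d : ℕ} {ends : ε → Finset V} {c : V → ℕ} {E : Finset ε}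
    (hE : CapacitySparse d ends c E) (hd : 2 ≤ d) {e : ε} (he : e ∈ E)
    (hcard : (ends e).card ≤ 2) (hpos : ∀ v ∈ ends e, c v ≠ 0)
    (hslack : ∀ X : Finset V, (edgesWithin ends E X).Nonempty → ¬ ends e ⊆ X →
      (d + 2) * (edgesWithin ends E X).card + 3 ≤ ∑ v ∈ X, 2 * (c v + 1)) :
    CapacitySparse d ends (fun v => if v ∈ ends e then c v - 1 else c v) (E.erase e) := by
  intro X hX
  have hsum : ∑ v ∈ X, 2 * (c v + 1) =
      ∑ v ∈ X, 2 * ((if v ∈ ends e then c v - 1 else c v) + 1) + 2 * (X ∩ ends e).card := by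
    rw [← Finset.filter_mem_eq_inter, Finset.card_filter, Finset.mul_sum,
      ← Finset.sum_add_distrib]
    refine Finset.sum_congr rfl fun v _ => ?_
    split_ifs with hv
    · have := hpos v hv
      omega
    · omega
  have hle : (edgesWithin ends (E.erase e) X).card ≤ (edgesWithin ends E X).card :=
    Finset.card_le_card (Finset.filter_subset_filter _ (Finset.erase_subset _ _))
  have hlt := hE X hX
  beta_reduce
  by_cases hsub : ends e ⊆ X
  · have hi : (edgesWithin ends (E.erase e) X).card + 1 = (edgesWithin ends E X).card := by
      rw [edgesWithin, Finset.filter_erase]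
      exact Finset.card_erase_add_one (mem_edgesWithin.2 ⟨he, hsub⟩)
    have := Finset.card_le_card (Finset.inter_subset_right (s₁ := X) (s₂ := ends e))
    rw [← hi] at hlt
    nlinarith
  · have hss : X ∩ ends e ⊂ ends e :=
      Finset.inter_subset_right.ssubset_of_ne fun h => hsub (Finset.inter_eq_right.1 h)
    have := Finset.card_lt_card hss
    rcases (edgesWithin ends E X).eq_empty_or_nonempty with h0 | hne
    · rw [h0, Finset.card_empty] at hle
      rw [Nat.le_zero.1 hle, mul_zero]
      exact Finset.sum_pos (fun v _ => by omega) hX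
    · have := hslack X hne hsub
      have := Nat.mul_le_mul_left (d + 2) hle
      omega

/-- The map contracting the vertex set `X` onto the vertex `x`. -/
def contractTo (X : Finset V) (x v : V) : V := if v ∈ X then x else v

lemma contractTo_of_mem {X : Finset V} {x v : V} (hv : v ∈ X) : contractTo X x v = x :=
  if_pos hv

lemma contractTo_of_notMem {X : Finset V} {x v : V} (hv : v ∉ X) : contractTo X x v = v :=
  if_neg hv

/-- Contracting a vertex set of almost minimal slack to a vertex of capacity zero preserves
sparsity. -/
lemma CapacitySparse.contract {d : ℕ} {ends : ε → Finset V} {c : V → ℕ} {E : Finset ε}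
    (hE : CapacitySparse d ends c E) {X : Finset V} {x : V} (hx : x ∈ X)
    (hmin : ∀ Y, X ⊆ Y →
      ∑ v ∈ X, 2 * (c v + 1) + (d + 2) * (edgesWithin ends E Y).card ≤
        ∑ v ∈ Y, 2 * (c v + 1) + (d + 2) * (edgesWithin ends E X).card + 1) :
    CapacitySparse d (fun e => (ends e).image (contractTo X x))
      (fun v => if v ∈ X then 0 else c v) (E \ edgesWithin ends E X) := by
  intro Y hY
  by_cases hXY : Disjoint Y X
  · have hsum : ∑ v ∈ Y, 2 * ((if v ∈ X then 0 else c v) + 1) = ∑ v ∈ Y, 2 * (c v + 1) :=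
      Finset.sum_congr rfl fun v hv => by rw [if_neg (Finset.disjoint_left.1 hXY hv)]
    rw [hsum]
    refine lt_of_le_of_lt (Nat.mul_le_mul_left _ (Finset.card_le_card fun e he => ?_)) (hE Y hY)
    rw [mem_edgesWithin, Finset.mem_sdiff] at he
    refine mem_edgesWithin.2 ⟨he.1.1, fun v hv => ?_⟩
    have hfv := he.2 (Finset.mem_image_of_mem _ hv)
    by_cases hvX : v ∈ X
    · rw [contractTo_of_mem hvX] at hfv
      exact absurd hx (Finset.disjoint_left.1 hXY hfv)
    · rwa [contractTo_of_notMem hvX] at hfv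
  · obtain ⟨y, hyY, hyX⟩ := Finset.not_disjoint_iff.1 hXY
    have hmin := hmin (Y ∪ X) Finset.subset_union_right
    have hcount : (edgesWithin (fun e => (ends e).image (contractTo X x))
        (E \ edgesWithin ends E X) Y).card + (edgesWithin ends E X).card ≤
        (edgesWithin ends E (Y ∪ X)).card := by
      rw [← Finset.card_union_of_disjoint]
      · refine Finset.card_le_card (Finset.union_subset (fun e he => ?_) fun e he => ?_)
        · rw [mem_edgesWithin, Finset.mem_sdiff] at he
          refine mem_edgesWithin.2 ⟨he.1.1, fun v hv => ?_⟩
          have hfv := he.2 (Finset.mem_image_of_mem _ hv)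
          by_cases hvX : v ∈ X
          · exact Finset.mem_union_right _ hvX
          · rw [contractTo_of_notMem hvX] at hfv
            exact Finset.mem_union_left _ hfv
        · rw [mem_edgesWithin] at he ⊢
          exact ⟨he.1, he.2.trans Finset.subset_union_right⟩
      · exact Finset.disjoint_of_subset_left (Finset.filter_subset _ _) Finset.sdiff_disjoint
    have hunion : ∑ v ∈ Y ∪ X, 2 * (c v + 1) =
        ∑ v ∈ Y \ X, 2 * (c v + 1) + ∑ v ∈ X, 2 * (c v + 1) := by
      rw [← Finset.sdiff_union_self_eq_union, Finset.sum_union Finset.sdiff_disjoint]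
    have hsum : ∑ v ∈ Y \ X, 2 * (c v + 1) + 2 ≤
        ∑ v ∈ Y, 2 * ((if v ∈ X then 0 else c v) + 1) := by
      have hins : insert y (Y \ X) ⊆ Y :=
        Finset.insert_subset hyY Finset.sdiff_subset
      refine le_trans (le_of_eq ?_) (Finset.sum_le_sum_of_subset hins)
      rw [Finset.sum_insert (fun h => (Finset.mem_sdiff.1 h).2 hyX), if_pos hyX, add_comm]
      refine congrArg₂ _ rfl (Finset.sum_congr rfl fun v hv => ?_)
      rw [if_neg (Finset.mem_sdiff.1 hv).2]
    have := Nat.mul_le_mul_left (d + 2) hcount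
    rw [mul_add] at this
    beta_reduce
    omega

/-- A forest inside `X` together with a forest of the contraction of `X` is a forest. -/
lemma IsSparseForest.union_of_contract {ends : ε → Finset V} {F₁ F₂ : Finset ε} {X : Finset V}
    {x : V} (h₁ : IsSparseForest ends F₁)
    (h₂ : IsSparseForest (fun e => (ends e).image (contractTo X x)) F₂)
    (hF₁ : ∀ e ∈ F₁, (ends e).Nonempty ∧ ends e ⊆ X) : IsSparseForest ends (F₁ ∪ F₂) := by
  intro Y hY
  have hsub : edgesWithin ends (F₁ ∪ F₂) Y ⊆ edgesWithin ends F₁ (Y ∩ X) ∪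
      edgesWithin (fun e => (ends e).image (contractTo X x)) F₂ (Y.image (contractTo X x)) := by
    intro e he
    obtain ⟨he, heY⟩ := mem_edgesWithin.1 he
    rcases Finset.mem_union.1 he with he | he
    · exact Finset.mem_union_left _
        (mem_edgesWithin.2 ⟨he, Finset.subset_inter heY (hF₁ e he).2⟩)
    · exact Finset.mem_union_right _ (mem_edgesWithin.2 ⟨he, Finset.image_subset_image heY⟩)
  have hle := (Finset.card_le_card hsub).trans (Finset.card_union_le _ _)
  have hlt := h₂ _ (hY.image (contractTo X x))
  rcases (Y ∩ X).eq_empty_or_nonempty with h0 | hne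
  · rw [h0, edgesWithin_empty fun e he => (hF₁ e he).1, Finset.card_empty] at hle
    have := Finset.card_image_le (s := Y) (f := contractTo X x)
    omega
  · have := h₁ _ hne
    have himage : Y.image (contractTo X x) ⊆ insert x (Y \ X) := by
      intro w hw
      obtain ⟨v, hv, rfl⟩ := Finset.mem_image.1 hw
      by_cases hvX : v ∈ X
      · rw [contractTo_of_mem hvX]
        exact Finset.mem_insert_self _ _
      · rw [contractTo_of_notMem hvX]
        exact Finset.mem_insert_of_mem (Finset.mem_sdiff.2 ⟨hv, hvX⟩)
    have := (Finset.card_le_card himage).trans (Finset.card_insert_le _ _)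
    have := Finset.card_sdiff_add_card_inter Y X
    omega

/-- A sparse multigraph with vertex capacities at most `d` has a forest whose complement respects
the capacities. -/
theorem CapacitySparse.exists_isSparseForest {d : ℕ} (hd : 2 ≤ d) (E : Finset ε)
    (ends : ε → Finset V) (c : V → ℕ) (hE : CapacitySparse d ends c E) (hc : ∀ v, c v ≤ d)
    (hends : ∀ e ∈ E, (ends e).Nonempty ∧ (ends e).card ≤ 2) :
    ∃ F ⊆ E, IsSparseForest ends F ∧
      ∀ v, ((E \ F).filter fun e => v ∈ ends e).card ≤ c v := by
  induction E using Finset.strongInduction generalizing ends c with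
  | H E ih =>
    by_cases hX : ∃ X : Finset V, (edgesWithin ends E X).Nonempty ∧
        edgesWithin ends E X ≠ E ∧ ∀ Y, X ⊆ Y →
          ∑ v ∈ X, 2 * (c v + 1) + (d + 2) * (edgesWithin ends E Y).card ≤
            ∑ v ∈ Y, 2 * (c v + 1) + (d + 2) * (edgesWithin ends E X).card + 1
    · obtain ⟨X, hne, hproper, hmin⟩ := hX
      obtain ⟨e₀, he₀⟩ := hne
      have he₀' := mem_edgesWithin.1 he₀
      obtain ⟨x, hx⟩ := (hends e₀ he₀'.1).1
      replace hx := he₀'.2 hx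
      have hsubE : edgesWithin ends E X ⊆ E := Finset.filter_subset _ _
      obtain ⟨F₁, hF₁, hfor₁, hcap₁⟩ := ih (edgesWithin ends E X)
        (hsubE.ssubset_of_ne hproper) ends c
        (fun Y hY => lt_of_le_of_lt (Nat.mul_le_mul_left _
          (Finset.card_le_card (Finset.filter_subset_filter _ hsubE))) (hE Y hY))
        hc (fun e he => hends e (hsubE he))
      obtain ⟨F₂, hF₂, hfor₂, hcap₂⟩ := ih (E \ edgesWithin ends E X)
        (Finset.sdiff_ssubset hsubE ⟨e₀, he₀⟩) _ _ (hE.contract hx hmin)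
        (fun v => by have := hc v; split_ifs <;> omega)
        (fun e he => ⟨(hends e (Finset.mem_sdiff.1 he).1).1.image _,
          Finset.card_image_le.trans (hends e (Finset.mem_sdiff.1 he).1).2⟩)
      refine ⟨F₁ ∪ F₂, Finset.union_subset (hF₁.trans hsubE)
        (hF₂.trans Finset.sdiff_subset), hfor₁.union_of_contract hfor₂ fun e he =>
          ⟨(hends e (hsubE (hF₁ he))).1, (mem_edgesWithin.1 (hF₁ he)).2⟩, fun v => ?_⟩
      by_cases hv : v ∈ X
      · refine le_trans (Finset.card_le_card fun e he => ?_) (hcap₁ v)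
        simp only [Finset.mem_filter, Finset.mem_sdiff, Finset.mem_union, not_or] at he ⊢
        refine ⟨⟨?_, he.1.2.1⟩, he.2⟩
        by_contra heX
        have hcx := hcap₂ x
        rw [if_pos hx, Nat.le_zero, Finset.card_eq_zero] at hcx
        have hmem : e ∈ (((E \ edgesWithin ends E X) \ F₂).filter
            fun e => x ∈ (ends e).image (contractTo X x)) := by
          simp only [Finset.mem_filter, Finset.mem_sdiff]
          exact ⟨⟨⟨he.1.1, heX⟩, he.1.2.2⟩,
            Finset.mem_image.2 ⟨v, he.2, contractTo_of_mem hv⟩⟩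
        rw [hcx] at hmem
        exact Finset.notMem_empty _ hmem
      · have hcv := hcap₂ v
        rw [if_neg hv] at hcv
        refine le_trans (Finset.card_le_card fun e he => ?_) hcv
        simp only [Finset.mem_filter, Finset.mem_sdiff, Finset.mem_union, not_or] at he ⊢
        exact ⟨⟨⟨he.1.1, fun heX => hv ((mem_edgesWithin.1 heX).2 he.2)⟩, he.1.2.2⟩,
          Finset.mem_image.2 ⟨v, he.2, contractTo_of_notMem hv⟩⟩
    · by_cases hpos : ∃ e ∈ E, ∀ v ∈ ends e, c v ≠ 0
      · obtain ⟨e, he, hpos⟩ := hpos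
        have hslack : ∀ X : Finset V, (edgesWithin ends E X).Nonempty → ¬ ends e ⊆ X →
            (d + 2) * (edgesWithin ends E X).card + 3 ≤ ∑ v ∈ X, 2 * (c v + 1) := by
          intro X hne hsub
          by_contra! hlt
          refine hX ⟨X, hne, fun h => hsub (mem_edgesWithin.1 (h ▸ he)).2, fun Y hXY => ?_⟩
          obtain ⟨e', he'⟩ := hne
          obtain ⟨he', heX⟩ := mem_edgesWithin.1 he'
          have := hE Y (((hends e' he').1.mono heX).mono hXY)
          omega
        obtain ⟨F, hF, hfor, hcap⟩ := ih (E.erase e) (Finset.erase_ssubset he) ends _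
          (hE.erase hd he (hends e he).2 hpos hslack)
          (fun v => by have := hc v; split_ifs <;> omega)
          (fun e' he' => hends e' (Finset.mem_of_mem_erase he'))
        refine ⟨F, hF.trans (Finset.erase_subset _ _), hfor, fun v => ?_⟩
        have heF : e ∉ F := fun h => Finset.notMem_erase e E (hF h)
        have hins : E \ F = insert e (E.erase e \ F) := by
          rw [← Finset.insert_sdiff_of_notMem _ heF, Finset.insert_erase he]
        have hcv := hcap v
        rw [hins, Finset.filter_insert]
        split_ifs at hcv ⊢ with hv
        · have := hpos v hv
          have := Finset.card_insert_le e ((E.erase e \ F).filter fun e => v ∈ ends e)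
          omega
        · exact hcv
      · push Not at hpos
        refine ⟨E, subset_rfl, hE.isSparseForest hc (fun e he => (hends e he).2) hpos,
          fun v => ?_⟩
        simp

end

/-- A graph in which every nonempty vertex set spans fewer edges than vertices is acyclic. -/
lemma isAcyclic_fromEdgeSet_of_isSparseForest {V : Type*} [DecidableEq V]
    {F : Finset (Sym2 V)} (hF : IsSparseForest Sym2.toFinset F) :
    (SimpleGraph.fromEdgeSet (F : Set (Sym2 V))).IsAcyclic := by
  intro v p hp
  have hnodup := hp.support_nodup
  have hcard : p.support.tail.toFinset.card = p.length := by
    rw [List.toFinset_card_of_nodup hnodup, List.length_tail, SimpleGraph.Walk.length_support,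
      Nat.add_sub_cancel]
  have hlen := hp.three_le_length
  have hlt := hF p.support.tail.toFinset (Finset.card_pos.1 (by omega))
  have hedges : p.edges.toFinset.card = p.length := by
    rw [List.toFinset_card_of_nodup hp.isTrail.edges_nodup, SimpleGraph.Walk.length_edges]
  have hsub : p.edges.toFinset ⊆ edgesWithin Sym2.toFinset F p.support.tail.toFinset := by
    intro e he
    rw [List.mem_toFinset] at he
    have heF := p.edges_subset_edgeSet he
    rw [SimpleGraph.edgeSet_fromEdgeSet] at heF
    refine mem_edgesWithin.2 ⟨heF.1, fun w hw => ?_⟩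
    have hw := SimpleGraph.Walk.mem_support_of_mem_edges he (Sym2.mem_toFinset.1 hw)
    rw [List.mem_toFinset]
    rcases SimpleGraph.Walk.mem_support_iff p |>.1 hw with rfl | hw
    · exact SimpleGraph.Walk.end_mem_tail_support hp.not_nil
    · exact hw
  have := Finset.card_le_card hsub
  omega

/-- The edges of `G` with both ends in `X` are counted by `inducedEdges`. -/
lemma card_edgesWithin_le_inducedEdges {V : Type*} [Fintype V] [DecidableEq V]
    (G : SimpleGraph V) [Fintype G.edgeSet] (X : Finset V) :
    (edgesWithin Sym2.toFinset G.edgeFinset X).card ≤ inducedEdges G X := by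
  rw [inducedEdges, Nat.card_coe_set_eq, ← Set.ncard_coe_finset,
    ← Set.ncard_image_of_injective _
      (Sym2.map.injective (Subtype.val_injective (p := (· ∈ (X : Set V)))))]
  refine Set.ncard_le_ncard (fun e he => ?_) (Set.toFinite _)
  obtain ⟨heG, heX⟩ := mem_edgesWithin.1 he
  induction e with
  | _ a b =>
    have ha : a ∈ X := heX (by simp)
    have hb : b ∈ X := heX (by simp)
    refine ⟨s(⟨a, ha⟩, ⟨b, hb⟩), ?_, rfl⟩
    simpa using heG

/-- WNDT-type theorem (Kim et al., strengthened form): if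
`2(d+1)|X| > (d+2) i(X)` for every nonempty `X`, then `G` has a forest
subgraph `F` with `d_G(v) - d_F(v) ≤ d` for every vertex `v`. -/
theorem wndt_strong
    {V : Type*} [Fintype V] (G : SimpleGraph V) (d : ℕ) (hd : 2 ≤ d)
    (hcond : ∀ X : Finset V, X.Nonempty →
      (d + 2) * inducedEdges G X < 2 * (d + 1) * X.card) :
    ∃ F : SimpleGraph V, F ≤ G ∧ F.IsAcyclic ∧
      ∀ v : V, Nat.card (G.neighborSet v) ≤ Nat.card (F.neighborSet v) + d := by
  classical
  obtain ⟨F, hFE, hF, hcap⟩ := CapacitySparse.exists_isSparseForest hd G.edgeFinset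
    Sym2.toFinset (fun _ => d)
    (fun X hX => by
      rw [Finset.sum_const, smul_eq_mul, mul_comm X.card]
      exact lt_of_le_of_lt (Nat.mul_le_mul_left _ (card_edgesWithin_le_inducedEdges G X))
        (hcond X hX))
    (fun _ => le_rfl)
    (fun e _ => by
      induction e with
      | _ a b => exact ⟨⟨a, by simp⟩, by rw [Sym2.toFinset_mk_eq]; exact Finset.card_le_two⟩)
  refine ⟨SimpleGraph.fromEdgeSet (F : Set (Sym2 V)), ?_,
    isAcyclic_fromEdgeSet_of_isSparseForest hF, fun v => ?_⟩
  · intro a b hab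
    exact SimpleGraph.mem_edgeFinset.1 (hFE ((SimpleGraph.fromEdgeSet_adj _).1 hab).1)
  · have hsub : G.neighborSet v ⊆
        (SimpleGraph.fromEdgeSet (F : Set (Sym2 V))).neighborSet v ∪
          {w | s(v, w) ∈ G.edgeFinset \ F} := by
      intro w hw
      by_cases hwF : s(v, w) ∈ F
      · exact Or.inl ((SimpleGraph.fromEdgeSet_adj _).2 ⟨hwF, hw.ne⟩)
      · exact Or.inr (Finset.mem_sdiff.2 ⟨SimpleGraph.mem_edgeFinset.2 hw, hwF⟩)
    have hle : Set.ncard {w | s(v, w) ∈ G.edgeFinset \ F} ≤ d := by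
      refine le_trans ?_ (hcap v)
      rw [← Set.ncard_coe_finset]
      refine Set.ncard_le_ncard_of_injOn (fun w => s(v, w)) (fun w hw => ?_)
        (fun a _ b _ hab => Sym2.congr_right.1 hab) (Set.toFinite _)
      exact Finset.mem_filter.2 ⟨hw, by simp⟩
    simp only [Nat.card_coe_set_eq]
    have := (Set.ncard_le_ncard hsub (Set.toFinite _)).trans (Set.ncard_union_le _ _)
    omega
end

section
/- Let G be a finite simple graph and d ≥ 2 an integer. If Arb(G) ≤ 1 + d/(d+2), then there is a forest subgraph F of G such that d_G(v) − d_F(v) ≤ d for every vertex v, where Arb(G) = max over subsets X with |X| ≥ 2 of i(X)/(|X|−1). -/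
/-- The edges of `E` with both ends in `A`, where the edge `e` joins `s e` and `t e`. -/
def spanned {V ε : Type*} [DecidableEq V] (s t : ε → V) (E : Finset ε) (A : Finset V) : Finset ε :=
  {e ∈ E | s e ∈ A ∧ t e ∈ A}

lemma mem_spanned {V ε : Type*} [DecidableEq V] {s t : ε → V} {E : Finset ε} {A : Finset V}
    {e : ε} : e ∈ spanned s t E A ↔ e ∈ E ∧ s e ∈ A ∧ t e ∈ A := by
  simp [spanned]

/-- The multigraph with edge set `E` is a forest, expressed by edge counting. -/
def IsForest {V ε : Type*} [DecidableEq V] (s t : ε → V) (E : Finset ε) : Prop :=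
  ∀ A : Finset V, A.Nonempty → (spanned s t E A).card + 1 ≤ A.card

/-- The sparsity condition for the multigraph `E` with vertex capacities `f`. -/
def IsSparse {V ε : Type*} [DecidableEq V] (s t : ε → V) (d : ℕ) (E : Finset ε) (f : V → ℕ) :
    Prop :=
  ∀ A : Finset V, A.Nonempty → (d + 2) * (spanned s t E A).card + 1 ≤ ∑ v ∈ A, 2 * (1 + f v)

/-- `E` splits into a forest and a multigraph in which each vertex `v` has degree at most `f v`. -/
def IsDecomposable {V ε : Type*} [DecidableEq V] [DecidableEq ε] (s t : ε → V) (E : Finset ε)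
    (f : V → ℕ) : Prop :=
  ∃ F ⊆ E, IsForest s t F ∧ ∀ v, {e ∈ E \ F | s e = v ∨ t e = v}.card ≤ f v

section

variable {V ε : Type*} [DecidableEq V] {s t : ε → V} {d : ℕ} {E : Finset ε} {f : V → ℕ}

lemma IsSparse.mono (h : IsSparse s t d E f) {E' : Finset ε} (hE : E' ⊆ E) :
    IsSparse s t d E' f := by
  intro A hA
  have h1 : (spanned s t E' A).card ≤ (spanned s t E A).card :=
    Finset.card_le_card fun e he => by
      rw [mem_spanned] at he ⊢
      exact ⟨hE he.1, he.2⟩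
  have := h A hA
  have := Nat.mul_le_mul_left (d + 2) h1
  omega

/-- If every edge joins a vertex of capacity zero to one of positive capacity, a sparse multigraph
is a forest. -/
lemma IsSparse.isForest (h : IsSparse s t d E f) (hf : ∀ v, f v ≤ d)
    (hE : ∀ e ∈ E, (f (s e) = 0 ↔ f (t e) ≠ 0)) : IsForest s t E := by
  classical
  intro A
  induction A using Finset.strongInduction with
  | H A ih =>
  intro hA
  by_contra! hlt
  set P : Finset V := {v ∈ A | f v ≠ 0} with hP
  set Z : Finset V := {v ∈ A | f v = 0} with hZ
  have hcard : Z.card + P.card = A.card := Finset.card_filter_add_card_filter_not _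
  have hsum : ∑ v ∈ A, 2 * (1 + f v) ≤ 2 * A.card + 2 * (d * P.card) := by
    rw [← Finset.mul_sum, Finset.sum_add_distrib]
    have h1 : ∑ v ∈ P, f v = ∑ v ∈ A, f v := Finset.sum_filter_ne_zero A
    have h2 : ∑ v ∈ P, f v ≤ P.card • d := Finset.sum_le_card_nsmul _ _ _ fun v _ => hf v
    simp only [Finset.sum_const, smul_eq_mul] at h2 ⊢
    rw [mul_comm d]
    omega
  let p : ε → V := fun e => if f (s e) = 0 then t e else s e
  have hp : ∀ e ∈ spanned s t E A, p e ∈ P := by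
    intro e he
    rw [mem_spanned] at he
    have := hE e he.1
    simp only [p, hP, Finset.mem_filter]
    grind
  have hdeg : ∀ v ∈ P, 2 ≤ {e ∈ spanned s t E A | p e = v}.card := by
    intro v hv
    by_contra! hlt2
    have hvA : v ∈ A := (Finset.mem_filter.1 hv).1
    have hfv : f v ≠ 0 := (Finset.mem_filter.1 hv).2
    have hsub : spanned s t E A ⊆
        spanned s t E (A.erase v) ∪ {e ∈ spanned s t E A | p e = v} := by
      intro e he
      have he' := mem_spanned.1 he
      have := hE e he'.1
      simp only [Finset.mem_union, Finset.mem_filter, he, true_and, mem_spanned,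
        Finset.mem_erase, p]
      grind
    have hle := (Finset.card_le_card hsub).trans (Finset.card_union_le _ _)
    have hc := Finset.card_erase_of_mem hvA
    rcases (A.erase v).eq_empty_or_nonempty with h0 | h0
    · have h1 : A.card = 1 := by
        have := Finset.card_pos.2 hA
        rw [h0, Finset.card_empty] at hc
        omega
      obtain ⟨e, he⟩ : (spanned s t E A).Nonempty := Finset.card_pos.1 (by omega)
      rw [mem_spanned] at he
      have h2 := Finset.card_le_one.1 h1.le _ he.2.1 _ he.2.2
      have := hE e he.1
      rw [h2] at this
      tauto
    · have := ih _ (Finset.erase_ssubset hvA) h0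
      omega
  have h2P : 2 * P.card ≤ (spanned s t E A).card := by
    rw [Finset.card_eq_sum_card_fiberwise hp, mul_comm]
    exact Finset.card_nsmul_le_sum _ _ _ hdeg
  have := h A hA
  have := Nat.mul_le_mul_left d h2P
  have : d * (2 * P.card) = 2 * (d * P.card) := by ring
  rw [add_mul] at *
  omega

variable [DecidableEq ε]

/-- Assigning an edge to the bounded degree part. -/
lemma IsDecomposable.of_erase {e₀ : ε} (hs : 1 ≤ f (s e₀)) (ht : 1 ≤ f (t e₀))
    (h : IsDecomposable s t (E.erase e₀)
      (fun v => f v - if v = s e₀ ∨ v = t e₀ then 1 else 0)) : IsDecomposable s t E f := by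
  obtain ⟨F, hFE, hF, hdeg⟩ := h
  refine ⟨F, hFE.trans (Finset.erase_subset _ _), hF, fun v => ?_⟩
  have hv := hdeg v
  by_cases hvv : v = s e₀ ∨ v = t e₀
  · have hsub : {e ∈ E \ F | s e = v ∨ t e = v} ⊆
        insert e₀ {e ∈ E.erase e₀ \ F | s e = v ∨ t e = v} := by
      intro e
      simp only [Finset.mem_filter, Finset.mem_insert, Finset.mem_sdiff, Finset.mem_erase]
      tauto
    have := (Finset.card_le_card hsub).trans (Finset.card_insert_le _ _)
    simp only [hvv, if_true] at hv
    have : 1 ≤ f v := by rcases hvv with rfl | rfl <;> assumption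
    omega
  · have hsub : {e ∈ E \ F | s e = v ∨ t e = v} ⊆
        {e ∈ E.erase e₀ \ F | s e = v ∨ t e = v} := by
      intro e
      simp only [Finset.mem_filter, Finset.mem_sdiff, Finset.mem_erase]
      grind
    have := Finset.card_le_card hsub
    simp only [hvv, if_false] at hv
    omega

/-- Deleting an edge and lowering the capacities of its ends keeps sparsity if there is no tight
set. -/
lemma IsSparse.erase (h : IsSparse s t d E f) (hd : 2 ≤ d) {e₀ : ε} (he₀ : e₀ ∈ E)
    (hs : 1 ≤ f (s e₀)) (ht : 1 ≤ f (t e₀))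
    (htight : ∀ X : Finset V, (spanned s t E X).Nonempty → spanned s t E X ≠ E →
      (d + 2) * (spanned s t E X).card + 3 ≤ ∑ v ∈ X, 2 * (1 + f v)) :
    IsSparse s t d (E.erase e₀) (fun v => f v - if v = s e₀ ∨ v = t e₀ then 1 else 0) := by
  intro A hA
  beta_reduce
  have hsum : ∑ v ∈ A, 2 * (1 + f v) =
      ∑ v ∈ A, 2 * (1 + (f v - if v = s e₀ ∨ v = t e₀ then 1 else 0)) +
        2 * {v ∈ A | v = s e₀ ∨ v = t e₀}.card := by
    rw [Finset.card_filter, Finset.mul_sum, ← Finset.sum_add_distrib]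
    refine Finset.sum_congr rfl fun v _ => ?_
    split_ifs with hv
    · have : 1 ≤ f v := by rcases hv with rfl | rfl <;> assumption
      omega
    · omega
  have hsub : {v ∈ A | v = s e₀ ∨ v = t e₀} ⊆ {s e₀, t e₀} := by
    intro v
    simp
  have hcard2 : {v ∈ A | v = s e₀ ∨ v = t e₀}.card ≤ 2 :=
    (Finset.card_le_card hsub).trans Finset.card_le_two
  have hle : (spanned s t (E.erase e₀) A).card ≤ (spanned s t E A).card :=
    Finset.card_le_card fun e he => by
      rw [mem_spanned] at he ⊢
      exact ⟨Finset.mem_of_mem_erase he.1, he.2⟩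
  have hmul := Nat.mul_le_mul_left (d + 2) hle
  have hsp := h A hA
  by_cases hsA : s e₀ ∈ A ∧ t e₀ ∈ A
  · have heq : spanned s t (E.erase e₀) A = (spanned s t E A).erase e₀ := by
      ext e
      simp only [mem_spanned, Finset.mem_erase]
      tauto
    have hmem : e₀ ∈ spanned s t E A := mem_spanned.2 ⟨he₀, hsA⟩
    have hc := Finset.card_erase_add_one hmem
    rw [← heq] at hc
    rw [← hc, mul_add] at hsp
    omega
  · by_cases h0 : {v ∈ A | v = s e₀ ∨ v = t e₀}.card = 0
    · omega
    have h1 : {v ∈ A | v = s e₀ ∨ v = t e₀}.card ≤ 1 := by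
      rw [Finset.card_le_one]
      intro a ha b hb
      rw [Finset.mem_filter] at ha hb
      grind
    rcases (spanned s t E A).eq_empty_or_nonempty with h2 | h2
    · rw [h2, Finset.card_empty] at hmul
      obtain ⟨v, hv⟩ : {v ∈ A | v = s e₀ ∨ v = t e₀}.Nonempty := by
        rwa [← Finset.card_pos, Nat.pos_iff_ne_zero]
      rw [Finset.mem_filter] at hv
      have hfv : 1 ≤ f v := by rcases hv.2 with rfl | rfl <;> assumption
      have := Finset.single_le_sum (f := fun v => 2 * (1 + f v)) (fun _ _ => Nat.zero_le _) hv.1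
      omega
    · have := htight A h2 fun heq => hsA (mem_spanned.1 (heq.symm ▸ he₀)).2
      omega

/-- Contracting a tight set to a vertex of capacity zero keeps sparsity. -/
lemma IsSparse.contract (h : IsSparse s t d E f) {X : Finset V} {x : V} (hx : x ∈ X)
    (hX : ∑ v ∈ X, 2 * (1 + f v) ≤ (d + 2) * (spanned s t E X).card + 2) :
    IsSparse (fun e => if s e ∈ X then x else s e) (fun e => if t e ∈ X then x else t e) d
      (E \ spanned s t E X) (Function.update f x 0) := by
  intro A hA
  by_cases hxA : x ∈ A
  · have hsp := h (A ∪ X) (hA.mono Finset.subset_union_left)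
    have hcard : (spanned (fun e => if s e ∈ X then x else s e)
        (fun e => if t e ∈ X then x else t e) (E \ spanned s t E X) A).card +
          (spanned s t E X).card ≤ (spanned s t E (A ∪ X)).card := by
      rw [← Finset.card_union_of_disjoint]
      · refine Finset.card_le_card fun e => ?_
        simp only [mem_spanned, Finset.mem_union, Finset.mem_sdiff]
        grind
      · rw [Finset.disjoint_left]
        intro e
        simp only [mem_spanned, Finset.mem_sdiff]
        tauto
    have hle : ∑ v ∈ A ∪ X, 2 * (1 + f v) ≤
        ∑ v ∈ A.erase x, 2 * (1 + f v) + ∑ v ∈ X, 2 * (1 + f v) := by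
      have : A ∪ X = A.erase x ∪ X := by
        ext v
        simp only [Finset.mem_union, Finset.mem_erase]
        grind
      rw [this, ← Finset.sum_union_inter]
      exact Nat.le_add_right _ _
    have hsum : ∑ v ∈ A, 2 * (1 + Function.update f x 0 v) =
        ∑ v ∈ A.erase x, 2 * (1 + f v) + 2 := by
      rw [← Finset.sum_erase_add _ _ hxA, Function.update_self]
      congr 1
      refine Finset.sum_congr rfl fun v hv => ?_
      rw [Function.update_of_ne (Finset.ne_of_mem_erase hv)]
    have := Nat.mul_le_mul_left (d + 2) hcard
    rw [mul_add] at this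
    omega
  · have hsum : ∑ v ∈ A, 2 * (1 + Function.update f x 0 v) = ∑ v ∈ A, 2 * (1 + f v) :=
      Finset.sum_congr rfl fun v hv => by
        rw [Function.update_of_ne (by rintro rfl; exact hxA hv)]
    have hcard : (spanned (fun e => if s e ∈ X then x else s e)
        (fun e => if t e ∈ X then x else t e) (E \ spanned s t E X) A).card ≤
          (spanned s t E A).card := by
      refine Finset.card_le_card fun e => ?_
      simp only [mem_spanned, Finset.mem_sdiff]
      grind
    have := h A hA
    have := Nat.mul_le_mul_left (d + 2) hcard
    omega

/-- Decompositions of an induced sub-multigraph and of its contraction can be combined. -/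
lemma IsDecomposable.of_contract {X : Finset V} {x : V} (hx : x ∈ X)
    (hX : IsDecomposable s t (spanned s t E X) f)
    (hc : IsDecomposable (fun e => if s e ∈ X then x else s e)
      (fun e => if t e ∈ X then x else t e) (E \ spanned s t E X) (Function.update f x 0)) :
    IsDecomposable s t E f := by
  obtain ⟨F₁, hF₁E, hF₁, hdeg₁⟩ := hX
  obtain ⟨F₂, hF₂E, hF₂, hdeg₂⟩ := hc
  have hF₁X : ∀ e ∈ F₁, e ∈ E ∧ s e ∈ X ∧ t e ∈ X := fun e he => mem_spanned.1 (hF₁E he)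
  have hF₂X : ∀ e ∈ F₂, e ∈ E ∧ ¬ (s e ∈ X ∧ t e ∈ X) := fun e he => by
    have := hF₂E he
    rw [Finset.mem_sdiff, mem_spanned] at this
    tauto
  refine ⟨F₁ ∪ F₂, ?_, ?_, ?_⟩
  · intro e he
    rcases Finset.mem_union.1 he with he | he
    · exact (hF₁X e he).1
    · exact (hF₂X e he).1
  · intro A hA
    rcases (A ∩ X).eq_empty_or_nonempty with h0 | h0
    · have hAX : ∀ v ∈ A, v ∉ X := fun v hv hvX =>
        Finset.notMem_empty v (h0 ▸ Finset.mem_inter.2 ⟨hv, hvX⟩)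
      refine le_trans (Nat.add_le_add_right (Finset.card_le_card fun e => ?_) 1) (hF₂ A hA)
      simp only [mem_spanned, Finset.mem_union]
      grind
    · have hsub : spanned s t (F₁ ∪ F₂) A ⊆ spanned s t F₁ (A ∩ X) ∪
          spanned (fun e => if s e ∈ X then x else s e) (fun e => if t e ∈ X then x else t e) F₂
            (insert x (A \ X)) := by
        intro e
        simp only [mem_spanned, Finset.mem_union, Finset.mem_inter, Finset.mem_insert,
          Finset.mem_sdiff]
        grind
      have h1 := (Finset.card_le_card hsub).trans (Finset.card_union_le _ _)
      have h2 := hF₁ _ h0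
      have h3 := hF₂ _ (Finset.insert_nonempty x (A \ X))
      have h4 := Finset.card_insert_le x (A \ X)
      have h5 := Finset.card_inter_add_card_sdiff A X
      omega
  · intro v
    by_cases hv : v ∈ X
    · have h0 := hdeg₂ x
      rw [Function.update_self, Nat.le_zero, Finset.card_eq_zero, Finset.filter_eq_empty_iff] at h0
      refine le_trans (Finset.card_le_card fun e => ?_) (hdeg₁ v)
      have := @h0 e
      simp only [Finset.mem_filter, mem_spanned, Finset.mem_union, Finset.mem_sdiff] at this ⊢
      grind
    · have h1 := hdeg₂ v
      rw [Function.update_of_ne (by rintro rfl; exact hv hx)] at h1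
      refine le_trans (Finset.card_le_card fun e => ?_) h1
      simp only [Finset.mem_filter, mem_spanned, Finset.mem_union, Finset.mem_sdiff]
      grind

/-- Sparse loopless multigraphs are decomposable. -/
theorem IsSparse.isDecomposable (hd : 2 ≤ d) (h : IsSparse s t d E f) (hf : ∀ v, f v ≤ d)
    (hne : ∀ e ∈ E, s e ≠ t e) : IsDecomposable s t E f := by
  induction hn : E.card using Nat.strong_induction_on generalizing s t E f with
  | _ n ih =>
  subst hn
  by_cases htight : ∀ X : Finset V, (spanned s t E X).Nonempty → spanned s t E X ≠ E →
      (d + 2) * (spanned s t E X).card + 3 ≤ ∑ v ∈ X, 2 * (1 + f v)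
  · by_cases hpos : ∃ e ∈ E, 1 ≤ f (s e) ∧ 1 ≤ f (t e)
    · obtain ⟨e, he, hs, ht⟩ := hpos
      refine .of_erase hs ht ?_
      exact ih _ (Finset.card_erase_lt_of_mem he) (h.erase hd he hs ht htight)
        (fun v => (Nat.sub_le _ _).trans (hf v)) (fun e he => hne e (Finset.mem_of_mem_erase he))
        rfl
    · refine ⟨E, subset_rfl, h.isForest hf fun e he => ?_, by simp⟩
      constructor
      · intro hs ht
        have hsp := h {s e, t e} (Finset.insert_nonempty _ _)
        rw [Finset.sum_pair (hne e he), hs, ht] at hsp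
        have h1 : 1 ≤ (spanned s t E {s e, t e}).card :=
          Finset.card_pos.2 ⟨e, mem_spanned.2 ⟨he, by simp, by simp⟩⟩
        have := Nat.mul_le_mul_left (d + 2) h1
        omega
      · intro ht
        by_contra hs
        exact hpos ⟨e, he, by omega, by omega⟩
  · push Not at htight
    obtain ⟨X, ⟨e, he⟩, hXE, hX⟩ := htight
    have hsub : spanned s t E X ⊆ E := Finset.filter_subset _ _
    have hx : s e ∈ X := (mem_spanned.1 he).2.1
    refine .of_contract hx ?_ ?_
    · exact ih _ (Finset.card_lt_card (hsub.ssubset_of_ne hXE)) (h.mono hsub) hf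
        (fun e he => hne e (hsub he)) rfl
    · refine ih _ (Finset.card_lt_card (Finset.sdiff_ssubset hsub ⟨e, he⟩))
        (h.contract hx (by omega)) (fun v => ?_) (fun e' he' => ?_) rfl
      · rcases eq_or_ne v (s e) with rfl | hv
        · simp
        · rw [Function.update_of_ne hv]
          exact hf v
      · rw [Finset.mem_sdiff, mem_spanned] at he'
        have := hne e' he'.1
        grind

end

/-- A graph each of whose nonempty vertex sets `A` spans fewer than `#A` edges is acyclic. -/
lemma isAcyclic_of_isForest {V : Type*} [DecidableEq V] {s t : Sym2 V → V}
    (hst : ∀ e, e = s(s e, t e)) {E : Finset (Sym2 V)} {F : SimpleGraph V}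
    (hFE : ∀ e ∈ F.edgeSet, e ∈ E) (hE : IsForest s t E) : F.IsAcyclic := by
  intro v c hc
  have hmem : ∀ w ∈ c.support, w ∈ c.support.tail := by
    intro w hw
    rcases (SimpleGraph.Walk.mem_support_iff c).1 hw with rfl | hw
    · exact SimpleGraph.Walk.end_mem_tail_support hc.not_nil
    · exact hw
  have hlt := hE c.support.tail.toFinset ⟨v, List.mem_toFinset.2 (hmem v c.start_mem_support)⟩
  rw [List.toFinset_card_of_nodup hc.support_nodup, List.length_tail,
    SimpleGraph.Walk.length_support, Nat.add_sub_cancel, ← SimpleGraph.Walk.length_edges,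
    ← List.toFinset_card_of_nodup hc.edges_nodup] at hlt
  have hsub : c.edges.toFinset ⊆ spanned s t E c.support.tail.toFinset := by
    intro e he
    rw [List.mem_toFinset] at he
    have he' := he
    rw [hst e] at he'
    rw [mem_spanned, List.mem_toFinset, List.mem_toFinset]
    exact ⟨hFE e (c.edges_subset_edgeSet he), hmem _ (c.fst_mem_support_of_mem_edges he'),
      hmem _ (c.snd_mem_support_of_mem_edges he')⟩
  have := Finset.card_le_card hsub
  omega

lemma card_spanned_le_inducedEdges {V : Type*} [Finite V] [DecidableEq V] (G : SimpleGraph V)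
    {s t : Sym2 V → V} (hst : ∀ e, e = s(s e, t e)) {E : Finset (Sym2 V)}
    (hE : ∀ e ∈ E, e ∈ G.edgeSet) (X : Finset V) :
    (spanned s t E X).card ≤ inducedEdges G X := by
  rw [inducedEdges, Nat.card_coe_set_eq,
    ← Set.ncard_image_of_injective _ (Sym2.map.injective Subtype.val_injective),
    ← Set.ncard_coe_finset]
  refine Set.ncard_le_ncard (fun e he => ?_) (Set.toFinite _)
  obtain ⟨heE, hs, ht⟩ := mem_spanned.1 he
  refine ⟨s(⟨s e, hs⟩, ⟨t e, ht⟩), ?_, (hst e).symm⟩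
  have := hE e heE
  rw [hst e] at this
  exact this

/-- WNDT Conjecture, case `k = 1` (Kim et al.): if
`Arb(G) ≤ 1 + d/(d+2)`, i.e. `i(X)/(|X|-1) ≤ 1 + d/(d+2)` for every vertex
subset `X` with `|X| > 1`, then `G` has a forest subgraph `F` with
`d_G(v) - d_F(v) ≤ d` for every vertex `v`. -/
theorem wndt_k_eq_one
    {V : Type*} [Fintype V] (G : SimpleGraph V) (d : ℕ) (hd : 2 ≤ d)
    (hArb : ∀ X : Finset V, 2 ≤ X.card →
      (inducedEdges G X : ℚ) / ((X.card : ℚ) - 1) ≤ 1 + (d : ℚ) / ((d : ℚ) + 2)) :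
    ∃ F : SimpleGraph V, F ≤ G ∧ F.IsAcyclic ∧
      ∀ v : V, Nat.card (G.neighborSet v) ≤ Nat.card (F.neighborSet v) + d := by
  classical
  have hex : ∀ e : Sym2 V, ∃ a b, e = s(a, b) := fun e => e.ind fun a b => ⟨a, b, rfl⟩
  choose s t hst using hex
  have hne : ∀ e ∈ G.edgeFinset, s e ≠ t e := by
    intro e he
    rw [SimpleGraph.mem_edgeFinset, hst e] at he
    exact G.ne_of_adj he
  have hsparse : IsSparse s t d G.edgeFinset (fun _ => d) := by
    intro A hA
    rw [Finset.sum_const, smul_eq_mul]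
    rcases Nat.lt_or_ge A.card 2 with h2 | h2
    · have h1 : A.card = 1 := by
        have := Finset.card_pos.2 hA
        omega
      have h0 : spanned s t G.edgeFinset A = ∅ := by
        refine Finset.eq_empty_of_forall_notMem fun e he => ?_
        rw [mem_spanned] at he
        exact hne e he.1 (Finset.card_le_one.1 h1.le _ he.2.1 _ he.2.2)
      rw [h0, h1, Finset.card_empty]
      omega
    · have hle := card_spanned_le_inducedEdges G hst
        (fun e he => SimpleGraph.mem_edgeFinset.1 he) A
      have h := hArb A h2
      have hpos : (0 : ℚ) < (A.card : ℚ) - 1 := by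
        have : (2 : ℚ) ≤ A.card := by exact_mod_cast h2
        linarith
      have hdpos : (0 : ℚ) < (d : ℚ) + 2 := by positivity
      have hfrac : 1 + (d : ℚ) / ((d : ℚ) + 2) = (2 * d + 2) / ((d : ℚ) + 2) := by
        field_simp
        ring
      rw [hfrac, div_le_div_iff₀ hpos hdpos] at h
      have hle' : ((spanned s t G.edgeFinset A).card : ℚ) ≤ inducedEdges G A := by
        exact_mod_cast hle
      have hmul := mul_le_mul_of_nonneg_right hle' hdpos.le
      have hd0 : (0 : ℚ) ≤ d := by positivity
      have : (((d + 2) * (spanned s t G.edgeFinset A).card + 1 : ℕ) : ℚ) ≤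
          ((A.card * (2 * (1 + d)) : ℕ) : ℚ) := by
        push_cast
        linarith
      exact_mod_cast this
  obtain ⟨F, hFE, hF, hdeg⟩ := hsparse.isDecomposable hd (fun _ => le_rfl) hne
  have hFG : ∀ e ∈ F, e ∈ G.edgeSet := fun e he => SimpleGraph.mem_edgeFinset.1 (hFE he)
  have hedge : (SimpleGraph.fromEdgeSet (F : Set (Sym2 V))).edgeSet = F := by
    rw [SimpleGraph.edgeSet_fromEdgeSet, sdiff_eq_left, Set.disjoint_left]
    exact fun e he hdiag => G.not_isDiag_of_mem_edgeSet (hFG e he) hdiag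
  refine ⟨SimpleGraph.fromEdgeSet F, ?_, ?_, fun v => ?_⟩
  · rw [← SimpleGraph.edgeSet_subset_edgeSet, hedge]
    exact hFG
  · refine isAcyclic_of_isForest hst (fun e he => ?_) hF
    rw [hedge] at he
    exact he
  · rw [Nat.card_eq_fintype_card, Nat.card_eq_fintype_card, SimpleGraph.card_neighborSet_eq_degree,
      SimpleGraph.card_neighborSet_eq_degree, ← SimpleGraph.card_incidenceFinset_eq_degree,
      ← SimpleGraph.card_incidenceFinset_eq_degree]
    refine le_trans ?_ (Nat.add_le_add_left (hdeg v) _)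
    refine le_trans (Finset.card_le_card fun e he => ?_) (Finset.card_union_le _ _)
    rw [SimpleGraph.mem_incidenceFinset] at he
    have hv : s e = v ∨ t e = v := by
      have := he.2
      rw [hst e, Sym2.mem_iff] at this
      tauto
    rw [Finset.mem_union, SimpleGraph.mem_incidenceFinset, SimpleGraph.incidenceSet, hedge,
      Finset.mem_filter, Finset.mem_sdiff, SimpleGraph.mem_edgeFinset]
    by_cases heF : e ∈ F
    · exact Or.inl ⟨heF, he.2⟩
    · exact Or.inr ⟨⟨he.1, heF⟩, hv⟩
end

section
/- Let G=(V,E) be a finite simple graph, S ⊆ V, f : S → ℤ≥2, and suppose F is a forest subgraph of G with d_F(v) ≥ f(v) for every v ∈ S. Then for every nonempty X ⊆ S: |Γ_G(X)| + 2|X| − c_G(X) > Σ_{x∈X} f(x), where Γ_G(X) is the open neighborhood of X in G and c_G(X) is the number of connected components of the induced subgraph G[X]. -/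
/-- The open neighborhood of a finite vertex set `X` in `G`. -/
def openNbhd {V : Type*} (G : SimpleGraph V) (X : Finset V) : Set V :=
  {v : V | v ∉ X ∧ ∃ x ∈ X, G.Adj x v}

/-- Number of connected components of the subgraph induced by `X`. -/
noncomputable def numComponents {V : Type*} (G : SimpleGraph V) (X : Finset V) : ℕ :=
  Nat.card (G.induce (X : Set V)).ConnectedComponent

/-- A finite forest has at most `|V|` edges and components together. -/
lemma SimpleGraph.IsAcyclic.ncard_edgeSet_add_card_connectedComponent_le {V : Type*} [Finite V]
    (H : SimpleGraph V) (hH : H.IsAcyclic) :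
    H.edgeSet.ncard + Nat.card H.ConnectedComponent ≤ Nat.card V := by
  induction hn : H.edgeSet.ncard generalizing H with
  | zero =>
    rw [zero_add]
    exact Nat.card_le_card_of_surjective H.connectedComponentMk Quot.mk_surjective
  | succ n ih =>
    obtain ⟨e, he⟩ : H.edgeSet.Nonempty := by
      rw [← Set.ncard_pos]
      omega
    induction e with
    | h u v =>
      set D := H.deleteEdges {s(u, v)}
      have hle : D ≤ H := H.deleteEdges_le _
      have hD := ih D (hH.anti hle) (by
        rw [SimpleGraph.edgeSet_deleteEdges, Set.ncard_sdiff_singleton_of_mem he]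
        omega)
      have hbridge : ¬ D.Reachable u v :=
        SimpleGraph.isBridge_iff.mp (SimpleGraph.isAcyclic_iff_forall_isBridge.mp hH he)
      have hmap : Function.Surjective
          (SimpleGraph.ConnectedComponent.map (SimpleGraph.Hom.ofLE hle)) := by
        intro c
        obtain ⟨w, rfl⟩ := Quot.mk_surjective c
        exact ⟨D.connectedComponentMk w, rfl⟩
      have hlt : Nat.card H.ConnectedComponent < Nat.card D.ConnectedComponent := by
        refine (Nat.card_le_card_of_surjective _ hmap).lt_of_ne fun heq => hbridge ?_
        have hinj := ((Nat.bijective_iff_surjective_and_card _).mpr ⟨hmap, heq.symm⟩).injective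
        refine SimpleGraph.ConnectedComponent.exact (hinj ?_)
        exact SimpleGraph.ConnectedComponent.sound (SimpleGraph.Adj.reachable he)
      omega

/-- The number of ordered adjacent pairs within a vertex set of a forest is at most twice
the size of the set minus twice the number of components it induces. -/
lemma SimpleGraph.IsAcyclic.sum_adj_add_two_mul_numComponents_le {V : Type*}
    {F : SimpleGraph V} [DecidableRel F.Adj] (hF : F.IsAcyclic) (T : Finset V) :
    (∑ v ∈ T, ∑ w ∈ T, if F.Adj v w then 1 else 0) + 2 * numComponents F T ≤ 2 * T.card := by
  classical
  have h := (hF.induce (T : Set V)).ncard_edgeSet_add_card_connectedComponent_le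
  have hsum := (F.induce (T : Set V)).sum_degrees_eq_twice_card_edges
  have hpairs : (∑ v ∈ T, ∑ w ∈ T, if F.Adj v w then 1 else 0) =
      ∑ v : (T : Set V), (F.induce (T : Set V)).degree v := by
    rw [← Finset.sum_coe_sort]
    refine Finset.sum_congr rfl fun v _ => ?_
    rw [← Finset.sum_coe_sort, ← SimpleGraph.card_neighborFinset_eq_degree,
      SimpleGraph.neighborFinset_eq_filter, Finset.card_filter]
    rfl
  rw [← Set.ncard_coe_finset, SimpleGraph.coe_edgeFinset] at hsum
  have hcard : Nat.card (T : Set V) = T.card := by simp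
  unfold numComponents
  omega

/-- Necessity direction of the Egawa–Ozeki characterization: if `G` has a
forest subgraph `F` with `d_F(v) ≥ f(v)` on `S`, then for every nonempty
`X ⊆ S`, `|Γ_G(X)| + 2|X| − c_G(X) > f(X)`. -/
theorem egawa_ozeki_necessity
    {V : Type*} [Fintype V] (G : SimpleGraph V) (S : Finset V) (f : V → ℤ)
    (hf : ∀ v ∈ S, 2 ≤ f v)
    (F : SimpleGraph V) (hFle : F ≤ G) (hFac : F.IsAcyclic)
    (hdeg : ∀ v ∈ S, f v ≤ (Nat.card (F.neighborSet v) : ℤ)) :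
    ∀ X : Finset V, X ⊆ S → X.Nonempty →
      (∑ x ∈ X, f x) <
        (Nat.card (openNbhd G X) : ℤ) + 2 * X.card - numComponents G X := by
  classical
  intro X hXS hX
  set Y : Finset V := (openNbhd G X).toFinset
  have hXY : Disjoint X Y := by
    rw [Finset.disjoint_left]
    intro v hv hvY
    exact (Set.mem_toFinset.mp hvY).1 hv
  have hcardY : Nat.card (openNbhd G X) = Y.card := by
    rw [Nat.card_eq_card_toFinset]
  let K : SimpleGraph V :=
    { Adj := fun u v => F.Adj u v ∧ (u ∈ X ∨ v ∈ X)
      symm := ⟨fun _ _ h => ⟨h.1.symm, h.2.symm⟩⟩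
      loopless := ⟨fun _ h => F.irrefl h.1⟩ }
  have hKF : K ≤ F := fun _ _ h => h.1
  let a : V → V → ℕ := fun v w => if F.Adj v w then 1 else 0
  have hdegree : ∀ x ∈ X, Nat.card (F.neighborSet x) = ∑ w ∈ X, a x w + ∑ w ∈ Y, a x w := by
    intro x hx
    rw [← Finset.sum_union hXY, ← Finset.card_filter, Nat.card_eq_card_toFinset]
    congr 1
    ext w
    simp only [Set.mem_toFinset, SimpleGraph.mem_neighborSet, Finset.mem_filter, Finset.mem_union]
    refine ⟨fun h => ⟨?_, h⟩, fun h => h.2⟩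
    by_cases hw : w ∈ X
    · exact .inl hw
    · exact .inr (Set.mem_toFinset.mpr ⟨hw, x, hx, hFle h⟩)
  have hK : (∑ v ∈ X ∪ Y, ∑ w ∈ X ∪ Y, if K.Adj v w then 1 else 0) =
      ∑ v ∈ X, ∑ w ∈ X, a v w + 2 * ∑ v ∈ X, ∑ w ∈ Y, a v w := by
    have hin : ∀ v ∈ X, (∑ w ∈ X ∪ Y, if K.Adj v w then 1 else 0) =
        ∑ w ∈ X, a v w + ∑ w ∈ Y, a v w := by
      intro v hv
      rw [← Finset.sum_union hXY]
      simp [K, a, hv]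
    have hout : ∀ v ∈ Y, (∑ w ∈ X ∪ Y, if K.Adj v w then 1 else 0) = ∑ w ∈ X, a w v := by
      intro v hv
      have hvX := Finset.disjoint_right.mp hXY hv
      rw [Finset.sum_union hXY, Finset.sum_eq_zero (s := Y), add_zero]
      · refine Finset.sum_congr rfl fun w hw => ?_
        simp [K, a, hw, F.adj_comm]
      · intro w hw
        simp [K, hvX, Finset.disjoint_right.mp hXY hw]
    rw [Finset.sum_union hXY, Finset.sum_congr rfl hin, Finset.sum_congr rfl hout,
      Finset.sum_add_distrib, Finset.sum_comm (s := Y)]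
    ring
  have hinside := hFac.sum_adj_add_two_mul_numComponents_le X
  have htouch := (hFac.anti hKF).sum_adj_add_two_mul_numComponents_le (X ∪ Y)
  have hcomp : numComponents G X ≤ numComponents F X :=
    SimpleGraph.ConnectedComponent.card_le_card_of_le (SimpleGraph.comap_monotone _ hFle)
  have hpos : 0 < numComponents K (X ∪ Y) := by
    obtain ⟨x, hx⟩ := hX
    have : Nonempty (K.induce ((X ∪ Y : Finset V) : Set V)).ConnectedComponent :=
      ⟨SimpleGraph.connectedComponentMk _ ⟨x, Finset.mem_union_left _ hx⟩⟩
    exact Nat.card_pos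
  have hsum : ∑ x ∈ X, f x ≤
      ((∑ v ∈ X, ∑ w ∈ X, a v w + ∑ v ∈ X, ∑ w ∈ Y, a v w : ℕ) : ℤ) := by
    rw [← Finset.sum_add_distrib, ← Finset.sum_congr rfl hdegree, Nat.cast_sum]
    exact Finset.sum_le_sum fun x hx => hdeg x (hXS hx)
  rw [hK, Finset.card_union_of_disjoint hXY] at htouch
  change ∑ v ∈ X, ∑ w ∈ X, a v w + _ ≤ _ at hinside
  rw [hcardY]
  omega
end

section
/- Let G=(V,E) be a finite simple graph, S ⊆ V, f : S → ℤ≥2, and suppose the induced subgraph G[S] is a cograph (contains no induced path on 4 vertices). Then G has a forest subgraph F with d_F(v) ≥ f(v) for every v ∈ S if and only if for every nonempty X ⊆ S: |Γ_G(X)| + 2|X| − c_G(X) > Σ_{x∈X} f(x). -/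
/-- A cograph: a graph with no induced path on four vertices. -/
def IsCograph {V : Type*} (G : SimpleGraph V) : Prop :=
  ∀ a b c d : V, a ≠ b → a ≠ c → a ≠ d → b ≠ c → b ≠ d → c ≠ d →
    ¬ (G.Adj a b ∧ G.Adj b c ∧ G.Adj c d ∧ ¬G.Adj a c ∧ ¬G.Adj a d ∧ ¬G.Adj b d)

namespace EgawaOzeki

open Finset
open scoped Classical

variable {V : Type*}

/-- The spanning subgraph of `G` whose edges are those with both ends in `X`. -/
def within (G : SimpleGraph V) (X : Finset V) : SimpleGraph V where
  Adj u v := G.Adj u v ∧ u ∈ X ∧ v ∈ X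
  symm := ⟨fun _ _ h => ⟨h.1.symm, h.2.2, h.2.1⟩⟩
  loopless := ⟨fun _ h => G.loopless.irrefl _ h.1⟩

/-- The number of components of `H` that meet `X`. -/
noncomputable def met (H : SimpleGraph V) (X : Finset V) : ℕ :=
  #(X.image H.connectedComponentMk)

/-- The components of `G[X]` containing a neighbor of `a`. -/
noncomputable def touched (G : SimpleGraph V) (X : Finset V) (a : V) :
    Finset (within G X).ConnectedComponent :=
  (X.filter (G.Adj a)).image (within G X).connectedComponentMk

lemma within_le (G : SimpleGraph V) (X : Finset V) : within G X ≤ G := fun _ _ h => h.1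

lemma within_mono (G : SimpleGraph V) {X Y : Finset V} (h : X ⊆ Y) :
    within G X ≤ within G Y := fun _ _ hh => ⟨hh.1, h hh.2.1, h hh.2.2⟩

lemma within_within (G : SimpleGraph V) {X Y : Finset V} (h : X ⊆ Y) :
    within (within G Y) X = within G X := by
  ext u v
  constructor
  · exact fun hh => ⟨hh.1.1, hh.2⟩
  · exact fun hh => ⟨⟨hh.1, h hh.2.1, h hh.2.2⟩, hh.2⟩

lemma reachable_induct {H : SimpleGraph V} {P : V → Prop}
    (hP : ∀ u v, P u → H.Adj u v → P v) {u v : V} (h : H.Reachable u v) (hu : P u) : P v := by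
  obtain ⟨w⟩ := h
  induction w with
  | nil => exact hu
  | cons hadj _ ih => exact ih (hP _ _ hu hadj)

lemma eq_of_reachable_of_isolated {H : SimpleGraph V} {u v : V} (hu : ∀ w, ¬ H.Adj u w)
    (h : H.Reachable u v) : v = u :=
  reachable_induct (P := fun v => v = u) (fun x y (hx : x = u) hxy => absurd (hx ▸ hxy) (hu y)) h rfl

lemma reachable_within_mem {G : SimpleGraph V} {X : Finset V} {u v : V}
    (h : (within G X).Reachable u v) (hu : u ∈ X) : v ∈ X :=
  reachable_induct (P := (· ∈ X)) (fun x y _ (hxy : (within G X).Adj x y) => hxy.2.2) h hu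

lemma reachable_within_of_insert {G : SimpleGraph V} {X : Finset V} {a u v : V}
    (hu : u ∈ X) (hna : (within G X).connectedComponentMk u ∉ touched G X a)
    (h : (within G (insert a X)).Reachable u v) : (within G X).Reachable u v := by
  refine reachable_induct (P := (within G X).Reachable u) ?_ h (SimpleGraph.Reachable.refl u)
  intro x y hx hxy
  have hxX := reachable_within_mem hx hu
  refine hx.trans (SimpleGraph.Adj.reachable ⟨hxy.1, hxX, ?_⟩)
  rcases Finset.mem_insert.mp hxy.2.2 with rfl | hy
  · refine absurd ?_ hna
    refine Finset.mem_image.mpr ⟨x, by simp [hxX, hxy.1.symm], ?_⟩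
    exact (SimpleGraph.ConnectedComponent.eq.mpr hx).symm
  · exact hy

lemma met_insert (G : SimpleGraph V) {X : Finset V} {a : V} (ha : a ∉ X) :
    met (within G (insert a X)) (insert a X) + #(touched G X a) = met (within G X) X + 1 := by
  set A := X.image (within G X).connectedComponentMk with hA
  have hsub : touched G X a ⊆ A := Finset.image_subset_image (Finset.filter_subset _ _)
  set φ : (within G X).ConnectedComponent → (within G (insert a X)).ConnectedComponent :=
    SimpleGraph.ConnectedComponent.map (SimpleGraph.Hom.ofLE (within_mono G (subset_insert a X)))
    with hφ
  have hφm : ∀ x, φ ((within G X).connectedComponentMk x) =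
      (within G (insert a X)).connectedComponentMk x := fun _ => rfl
  have himg : (insert a X).image (within G (insert a X)).connectedComponentMk =
      insert ((within G (insert a X)).connectedComponentMk a) ((A \ touched G X a).image φ) := by
    ext c
    simp only [Finset.mem_image, Finset.mem_insert, Finset.mem_sdiff]
    constructor
    · rintro ⟨x, rfl | hx, rfl⟩
      · exact Or.inl rfl
      · by_cases ht : (within G X).connectedComponentMk x ∈ touched G X a
        · left
          obtain ⟨y, hy, hyx⟩ := Finset.mem_image.mp ht
          rw [← hφm, ← hyx, hφm]
          simp only [Finset.mem_filter] at hy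
          exact SimpleGraph.ConnectedComponent.eq.mpr (SimpleGraph.Adj.reachable
            ⟨hy.2.symm, by simp [hy.1], by simp⟩)
        · exact Or.inr ⟨_, ⟨Finset.mem_image_of_mem _ hx, ht⟩, hφm x⟩
    · rintro (rfl | ⟨d, ⟨hd, -⟩, rfl⟩)
      · exact ⟨a, Or.inl rfl, rfl⟩
      · obtain ⟨x, hx, rfl⟩ := Finset.mem_image.mp hd
        exact ⟨x, Or.inr hx, rfl⟩
  have hinj : Set.InjOn φ (A \ touched G X a : Finset _) := by
    intro c hc d hd hcd
    simp only [Finset.coe_sdiff, Set.mem_sdiff, Finset.mem_coe] at hc hd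
    obtain ⟨x, hx, rfl⟩ := Finset.mem_image.mp hc.1
    obtain ⟨y, hy, rfl⟩ := Finset.mem_image.mp hd.1
    exact SimpleGraph.ConnectedComponent.eq.mpr
      (reachable_within_of_insert hx hc.2 (SimpleGraph.ConnectedComponent.eq.mp hcd))
  have hnot : (within G (insert a X)).connectedComponentMk a ∉ (A \ touched G X a).image φ := by
    intro h
    obtain ⟨c, hc, hca⟩ := Finset.mem_image.mp h
    rw [Finset.mem_sdiff] at hc
    obtain ⟨x, hx, rfl⟩ := Finset.mem_image.mp hc.1
    exact ha (reachable_within_mem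
      (reachable_within_of_insert hx hc.2 (SimpleGraph.ConnectedComponent.eq.mp hca)) hx)
  have hcard := Finset.card_sdiff_add_card_eq_card hsub
  rw [met, himg, Finset.card_insert_of_notMem hnot, Finset.card_image_of_injOn hinj, met, ← hA]
  omega

lemma card_touched_insert_le (G : SimpleGraph V) (X : Finset V) (a b : V) :
    #(touched G (insert b X) a) ≤ #(touched G X a) +
      if G.Adj a b ∧ Disjoint (touched G X a) (touched G X b) then 1 else 0 := by
  set φ : (within G X).ConnectedComponent → (within G (insert b X)).ConnectedComponent :=
    SimpleGraph.ConnectedComponent.map (SimpleGraph.Hom.ofLE (within_mono G (subset_insert b X)))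
    with hφ
  have hφm : ∀ x, φ ((within G X).connectedComponentMk x) =
      (within G (insert b X)).connectedComponentMk x := fun _ => rfl
  have hold : ∀ x ∈ X, G.Adj a x →
      (within G (insert b X)).connectedComponentMk x ∈ (touched G X a).image φ := fun x hx hax =>
    Finset.mem_image.mpr ⟨_, Finset.mem_image_of_mem _ (by simp [hx, hax]), hφm x⟩
  split_ifs with h
  · have hsub : touched G (insert b X) a ⊆
        insert ((within G (insert b X)).connectedComponentMk b) ((touched G X a).image φ) := by
      intro c hc
      obtain ⟨x, hx, rfl⟩ := Finset.mem_image.mp hc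
      rw [Finset.mem_filter, Finset.mem_insert] at hx
      rcases hx with ⟨rfl | hx, hax⟩
      · simp
      · exact Finset.mem_insert_of_mem (hold x hx hax)
    exact (Finset.card_le_card hsub).trans ((Finset.card_insert_le _ _).trans
      (Nat.succ_le_succ Finset.card_image_le))
  · have hsub : touched G (insert b X) a ⊆ (touched G X a).image φ := by
      intro c hc
      obtain ⟨x, hx, rfl⟩ := Finset.mem_image.mp hc
      rw [Finset.mem_filter, Finset.mem_insert] at hx
      rcases hx with ⟨rfl | hx, hax⟩
      · have hd : ¬ Disjoint (touched G X a) (touched G X x) := fun hd => h ⟨hax, hd⟩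
        obtain ⟨c, hca, hcx⟩ := Finset.not_disjoint_iff.mp hd
        refine Finset.mem_image.mpr ⟨c, hca, ?_⟩
        obtain ⟨y, hy, rfl⟩ := Finset.mem_image.mp hcx
        rw [Finset.mem_filter] at hy
        exact SimpleGraph.ConnectedComponent.eq.mpr (SimpleGraph.Adj.reachable
          ⟨hy.2.symm, by simp [hy.1], by simp⟩)
      · exact hold x hx hax
    exact (Finset.card_le_card hsub).trans Finset.card_image_le

lemma exists_common_neighbor_of_reachable {G : SimpleGraph V} (hG : IsCograph G) {a b : V}
    (h : G.Reachable a b) : a = b ∨ G.Adj a b ∨ ∃ u, G.Adj a u ∧ G.Adj u b := by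
  refine reachable_induct (P := fun b => a = b ∨ G.Adj a b ∨ ∃ u, G.Adj a u ∧ G.Adj u b)
    ?_ h (Or.inl rfl)
  rintro b c (rfl | hab | ⟨u, hau, hub⟩) hbc
  · exact Or.inr (Or.inl hbc)
  · exact Or.inr (Or.inr ⟨b, hab, hbc⟩)
  · by_contra! hcon
    obtain ⟨hac, hnac, hno⟩ := hcon
    have hnab : ¬ G.Adj a b := fun hab => hno b hab hbc
    have hab : a ≠ b := fun hab => hnac (hab ▸ hbc)
    have hnuc := hno u hau
    have huc : u ≠ c := fun huc => hnac (huc ▸ hau)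
    exact hG a u b c hau.ne hab hac hub.ne huc hbc.ne ⟨hau, hub, hbc, hnab, hnac, hnuc⟩

lemma submodular_of_local {p : Finset V → ℤ}
    (hp : ∀ X a b, a ≠ b → a ∉ X → b ∉ X →
      p (insert a (insert b X)) + p X ≤ p (insert a X) + p (insert b X)) (X Y : Finset V) :
    p (X ∪ Y) + p (X ∩ Y) ≤ p X + p Y := by
  have marginal : ∀ Z X a, a ∉ X ∪ Z →
      p (insert a (X ∪ Z)) + p X ≤ p (insert a X) + p (X ∪ Z) := by
    intro Z
    induction Z using Finset.induction with
    | empty => intro X a _; simp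
    | insert b Z hb ih =>
      intro X a ha
      rw [Finset.union_insert] at ha ⊢
      by_cases hbX : b ∈ X
      · have hb' : b ∈ X ∪ Z := by simp [hbX]
        rw [Finset.insert_eq_of_mem hb'] at ha ⊢
        exact ih X a ha
      · simp only [Finset.mem_insert, not_or] at ha
        have h1 := ih X a ha.2
        have h2 := hp (X ∪ Z) a b ha.1 ha.2 (by simp [hb, hbX])
        linarith
  have key : ∀ Z W Y, W ⊆ Y → Disjoint Z Y → p (Y ∪ Z) + p W ≤ p (W ∪ Z) + p Y := by
    intro Z
    induction Z using Finset.induction with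
    | empty => intro W Y _ _; simp [add_comm]
    | insert a Z ha ih =>
      intro W Y hWY hd
      rw [Finset.disjoint_insert_left] at hd
      have h1 := ih W Y hWY hd.2
      have h2 := marginal Y (W ∪ Z) a (by
        simp only [Finset.mem_union, not_or]
        exact ⟨⟨fun h => hd.1 (hWY h), ha⟩, hd.1⟩)
      have hu : W ∪ Z ∪ Y = Y ∪ Z := by
        rw [Finset.union_right_comm, Finset.union_eq_right.mpr hWY]
      rw [hu] at h2
      rw [Finset.union_insert, Finset.union_insert]
      linarith
  have h := key (X \ Y) (X ∩ Y) Y Finset.inter_subset_right Finset.sdiff_disjoint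
  have h1 : Y ∪ X \ Y = X ∪ Y := by rw [Finset.union_sdiff_self_eq_union, Finset.union_comm]
  have h2 : X ∩ Y ∪ X \ Y = X := by rw [Finset.union_comm, Finset.sdiff_union_inter]
  rw [h1, h2] at h
  exact h

section Finite

variable [Fintype V]

/-- The closed neighborhood of `X` in `G`. -/
noncomputable def closedNbhd (G : SimpleGraph V) (X : Finset V) : Finset V :=
  univ.filter fun v => v ∈ X ∨ ∃ x ∈ X, G.Adj x v

lemma mem_closedNbhd {G : SimpleGraph V} {X : Finset V} {v : V} :
    v ∈ closedNbhd G X ↔ v ∈ X ∨ ∃ x ∈ X, G.Adj x v := by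
  simp [closedNbhd]

lemma closedNbhd_insert (G : SimpleGraph V) (X : Finset V) (a : V) :
    closedNbhd G (insert a X) = closedNbhd G X ∪ closedNbhd G {a} := by
  ext v
  simp only [mem_closedNbhd, Finset.mem_union, Finset.mem_insert, Finset.mem_singleton,
    exists_eq_or_imp, exists_eq_left]
  grind

/-- The potential whose submodularity characterizes the tree part of the problem. -/
noncomputable def treeRank (G : SimpleGraph V) (X : Finset V) : ℤ :=
  #(closedNbhd G X) + #X - met (within G X) X - met G X

lemma treeRank_insert (G : SimpleGraph V) {X : Finset V} {a : V} (ha : a ∉ X) :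
    treeRank G (insert a X) = treeRank G X + #(closedNbhd G {a} \ closedNbhd G X) +
      #(touched G X a) -
      if G.connectedComponentMk a ∈ X.image G.connectedComponentMk then 0 else 1 := by
  have h1 := met_insert G ha
  have h2 : #(closedNbhd G (insert a X)) =
      #(closedNbhd G X) + #(closedNbhd G {a} \ closedNbhd G X) := by
    rw [closedNbhd_insert, ← Finset.card_sdiff_add_card_eq_card Finset.subset_union_left,
      Finset.union_sdiff_left, add_comm]
  have h3 : #(insert a X) = #X + 1 := Finset.card_insert_of_notMem ha
  have h4 : (met G (insert a X) : ℤ) = met G X +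
      if G.connectedComponentMk a ∈ X.image G.connectedComponentMk then 0 else 1 := by
    rw [met, met, Finset.image_insert, Finset.card_insert_eq_ite]
    split_ifs <;> simp
  rw [treeRank, treeRank, h4, h2, h3]
  push_cast
  have h1' : (met (within G (insert a X)) (insert a X) : ℤ) + #(touched G X a) =
    met (within G X) X + 1 := by exact_mod_cast h1
  linarith

lemma notMem_closedNbhd_or_of_disjoint_touched {G : SimpleGraph V} (hG : IsCograph G) {X : Finset V} {a b : V}
    (hab : G.Adj a b) (hd : Disjoint (touched G X a) (touched G X b)) :
    a ∉ closedNbhd G X ∨ b ∉ closedNbhd G X ∨ a ∈ X ∨ b ∈ X := by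
  by_contra! h
  obtain ⟨ha, hb, haX, hbX⟩ := h
  rw [mem_closedNbhd] at ha hb
  obtain ⟨x, hx, hxa⟩ := ha.resolve_left haX
  obtain ⟨y, hy, hyb⟩ := hb.resolve_left hbX
  have mem : ∀ {z c : V}, z ∈ X → G.Adj z c →
      (within G X).connectedComponentMk z ∈ touched G X c := fun hz hzc =>
    Finset.mem_image_of_mem _ (by simp [hz, hzc.symm])
  have no : ∀ z ∈ X, G.Adj z a → ¬ G.Adj z b := fun z hz hza hzb =>
    Finset.disjoint_left.mp hd (mem hz hza) (mem hz hzb)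
  have hxb := no x hx hxa
  have hya : ¬ G.Adj y a := fun h => no y hy h hyb
  have hxy : x ≠ y := fun h => hxb (h ▸ hyb)
  have hnxy : ¬ G.Adj x y := by
    intro h
    have he : (within G X).connectedComponentMk x = (within G X).connectedComponentMk y :=
      SimpleGraph.ConnectedComponent.eq.mpr (SimpleGraph.Adj.reachable ⟨h, hx, hy⟩)
    exact Finset.disjoint_left.mp hd (mem hx hxa) (he ▸ mem hy hyb)
  exact hG x a b y hxa.ne (fun h => hbX (h ▸ hx)) hxy hab.ne (fun h => haX (h ▸ hy)) hyb.ne'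
    ⟨hxa, hab, hyb.symm, hxb, hnxy, fun h => hya h.symm⟩

lemma treeRank_local {G : SimpleGraph V} (hG : IsCograph G) (X : Finset V) (a b : V)
    (hab : a ≠ b) (ha : a ∉ X) (hb : b ∉ X) :
    treeRank G (insert a (insert b X)) + treeRank G X ≤
      treeRank G (insert a X) + treeRank G (insert b X) := by
  rw [treeRank_insert G (X := insert b X) (a := a) (by simp [hab, ha]), treeRank_insert G ha]
  have ht := card_touched_insert_le G X a b
  set A := closedNbhd G {a} \ closedNbhd G X with hA
  have hsd : closedNbhd G {a} \ closedNbhd G (insert b X) = A \ closedNbhd G {b} := by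
    rw [closedNbhd_insert, hA, sdiff_sdiff_left, Finset.sup_eq_union]
  have hcard := Finset.card_sdiff_add_card_inter A (closedNbhd G {b})
  rw [hsd]
  have haa : a ∈ closedNbhd G {a} := by simp [mem_closedNbhd]
  have hbb : b ∈ closedNbhd G {b} := by simp [mem_closedNbhd]
  have hadj : G.Adj a b → a ∈ closedNbhd G {b} ∧ b ∈ closedNbhd G {a} := fun h => by
    simp [mem_closedNbhd, h, h.symm]
  set m := #(A ∩ closedNbhd G {b}) with hm
  by_cases hX : G.connectedComponentMk a ∈ X.image G.connectedComponentMk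
  · have hX' : G.connectedComponentMk a ∈ (insert b X).image G.connectedComponentMk :=
      Finset.image_subset_image (Finset.subset_insert _ _) hX
    rw [if_pos hX, if_pos hX']
    have hε : (if G.Adj a b ∧ Disjoint (touched G X a) (touched G X b) then 1 else 0) ≤ m := by
      split_ifs with h
      · rw [Nat.succ_le_iff, hm, Finset.card_pos]
        obtain ⟨h1, h2⟩ := hadj h.1
        rcases notMem_closedNbhd_or_of_disjoint_touched hG h.1 h.2 with h3 | h3 | h3 | h3
        · exact ⟨a, by simp [hA, haa, h1, h3]⟩
        · exact ⟨b, by simp [hA, hbb, h2, h3]⟩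
        · exact absurd h3 ha
        · exact absurd h3 hb
      · exact Nat.zero_le _
    omega
  · rw [if_neg hX]
    by_cases hba : G.connectedComponentMk a = G.connectedComponentMk b
    · have hX' : G.connectedComponentMk a ∈ (insert b X).image G.connectedComponentMk := by
        rw [hba]; exact Finset.mem_image_of_mem _ (Finset.mem_insert_self _ _)
      rw [if_pos hX']
      have hAeq : A = closedNbhd G {a} := by
        rw [hA, Finset.sdiff_eq_self_iff_disjoint, Finset.disjoint_left]
        intro v hva hvX
        have h1 : G.connectedComponentMk v = G.connectedComponentMk a := by
          rcases mem_closedNbhd.mp hva with h | ⟨x, hx, hxv⟩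
          · rw [Finset.mem_singleton.mp h]
          · rw [Finset.mem_singleton.mp hx] at hxv
            exact SimpleGraph.ConnectedComponent.eq.mpr hxv.symm.reachable
        rcases mem_closedNbhd.mp hvX with h | ⟨x, hx, hxv⟩
        · exact hX (h1 ▸ Finset.mem_image_of_mem _ h)
        · refine hX (Finset.mem_image.mpr ⟨x, hx, ?_⟩)
          rw [← h1]
          exact SimpleGraph.ConnectedComponent.eq.mpr hxv.reachable
      have hε : (if G.Adj a b ∧ Disjoint (touched G X a) (touched G X b) then 1 else 0) + 1
          ≤ m := by
        rw [hm, hAeq]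
        by_cases h : G.Adj a b
        · obtain ⟨h1, h2⟩ := hadj h
          have hsub : {a, b} ⊆ closedNbhd G {a} ∩ closedNbhd G {b} := by
            intro v hv
            simp only [Finset.mem_insert, Finset.mem_singleton] at hv
            rcases hv with rfl | rfl <;> simp [*]
          have := Finset.card_le_card hsub
          rw [Finset.card_pair hab] at this
          split_ifs <;> omega
        · rw [if_neg (fun hh => h hh.1), zero_add, Nat.succ_le_iff, Finset.card_pos]
          obtain ⟨u, hau, hub⟩ := ((exists_common_neighbor_of_reachable hG
            (SimpleGraph.ConnectedComponent.eq.mp hba)).resolve_left hab).resolve_left h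
          exact ⟨u, by simp [mem_closedNbhd, hau, hub.symm]⟩
      omega
    · have hX' : G.connectedComponentMk a ∉ (insert b X).image G.connectedComponentMk := by
        rw [Finset.image_insert, Finset.mem_insert, not_or]
        exact ⟨hba, hX⟩
      rw [if_neg hX']
      have hnadj : ¬ G.Adj a b := fun h =>
        hba (SimpleGraph.ConnectedComponent.eq.mpr h.reachable)
      rw [if_neg (fun hh => hnadj hh.1)] at ht
      omega

lemma treeRank_submodular {G : SimpleGraph V} (hG : IsCograph G) (X Y : Finset V) :
    treeRank G (X ∪ Y) + treeRank G (X ∩ Y) ≤ treeRank G X + treeRank G Y :=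
  submodular_of_local (treeRank_local hG) X Y

end Finite

/-- The graph whose edges join the entries of the pairs in `J`. -/
def ofPairs (J : Finset (V × V)) : SimpleGraph V :=
  SimpleGraph.fromRel fun a b => (a, b) ∈ J

lemma ofPairs_insert (e : V × V) (J : Finset (V × V)) :
    ofPairs (insert e J) = SimpleGraph.edge e.1 e.2 ⊔ ofPairs J := by
  ext u v
  simp only [ofPairs, SimpleGraph.fromRel_adj, Finset.mem_insert, SimpleGraph.sup_adj,
    SimpleGraph.edge_adj, Prod.ext_iff]
  tauto

/-- The classes under `κ` of the elements of `Z` and of their partners in `D`. -/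
noncomputable def classes {W : Type*} (κ : V → W) (D : Finset (V × V)) (Z : Finset V) :
    Finset W :=
  Z.image κ ∪ (D.filter fun d => d.1 ∈ Z).image fun d => κ d.2

lemma mem_classes {W : Type*} {κ : V → W} {D : Finset (V × V)} {Z : Finset V} {w : W} :
    w ∈ classes κ D Z ↔ (∃ z ∈ Z, κ z = w) ∨ ∃ d ∈ D, d.1 ∈ Z ∧ κ d.2 = w := by
  simp [classes, and_assoc]

lemma classes_insert_of_mem {W : Type*} (κ : V → W) {e : V × V} (D : Finset (V × V))
    {Z : Finset V} (h : e.1 ∈ Z) :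
    classes κ (insert e D) Z = insert (κ e.2) (classes κ D Z) := by
  rw [classes, Finset.filter_insert, if_pos h, Finset.image_insert, Finset.union_insert, classes]

lemma classes_insert_of_notMem {W : Type*} (κ : V → W) {e : V × V} (D : Finset (V × V))
    {Z : Finset V} (h : e.1 ∉ Z) :
    classes κ (insert e D) Z = classes κ D Z := by
  rw [classes, Finset.filter_insert, if_neg h, classes]

lemma classes_comp {W W' : Type*} (κ : V → W) (r : W → W') (D : Finset (V × V)) (Z : Finset V) :
    classes (fun v => r (κ v)) D Z = (classes κ D Z).image r := by
  rw [classes, classes, Finset.image_union, Finset.image_image, Finset.image_image]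
  rfl

lemma classes_union {W : Type*} (κ : V → W) (D : Finset (V × V)) (X Y : Finset V) :
    classes κ D (X ∪ Y) = classes κ D X ∪ classes κ D Y := by
  ext w
  simp only [mem_classes, Finset.mem_union]
  grind

lemma classes_mono {W : Type*} (κ : V → W) (D : Finset (V × V)) {X Y : Finset V} (h : X ⊆ Y) :
    classes κ D X ⊆ classes κ D Y := by
  intro w
  simp only [mem_classes]
  grind

/-- Submodular selection of pairs: every pair of `D` is either discarded or selected, in which
case its two classes are merged. -/
lemma exists_selection {W : Type*} {p : Finset V → ℤ}
    (hp : ∀ X Y, p (X ∪ Y) + p (X ∩ Y) ≤ p X + p Y) (hp0 : 0 ≤ p ∅) {S : Finset V}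
    (D : Finset (V × V)) : ∀ (κ : V → W) (f : V → ℤ),
    (∀ Z ⊆ S, Z.Nonempty → ∑ z ∈ Z, f z + 1 ≤ #(classes κ D Z) + p Z) →
    ∃ J ⊆ D, (∀ Z ⊆ S, Z.Nonempty →
        ∑ z ∈ Z, (f z - #(J.filter fun d => d.1 = z)) + 1 ≤ #(Z.image κ) + p Z) ∧
      ∀ T : SimpleGraph V, T.IsAcyclic → (∀ u v, T.Adj u v → κ u = κ v) →
        (T ⊔ ofPairs J).IsAcyclic := by
  induction D using Finset.induction with
  | empty =>
    intro κ f h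
    refine ⟨∅, Finset.Subset.refl _, ?_, ?_⟩
    · intro Z hZ hne
      have := h Z hZ hne
      simpa [classes] using this
    · intro T hT _
      have : ofPairs (∅ : Finset (V × V)) = ⊥ := by
        ext u v; simp [ofPairs]
      rwa [this, sup_bot_eq]
  | insert e D he ih =>
    intro κ f h
    by_cases hdel : ∀ Z ⊆ S, Z.Nonempty → ∑ z ∈ Z, f z + 1 ≤ #(classes κ D Z) + p Z
    · obtain ⟨J, hJ, h1, h2⟩ := ih κ f hdel
      exact ⟨J, hJ.trans (Finset.subset_insert _ _), h1, h2⟩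
    push Not at hdel
    obtain ⟨X, hXS, hXne, hX⟩ := hdel
    have hX1 := h X hXS hXne
    have heX : e.1 ∈ X := by
      by_contra hn
      rw [classes_insert_of_notMem κ D hn] at hX1
      linarith
    have he2 : κ e.2 ∉ classes κ D X := by
      intro hn
      rw [classes_insert_of_mem κ D heX, Finset.insert_eq_of_mem hn] at hX1
      linarith
    have he1 : κ e.1 ∈ classes κ D X := mem_classes.mpr (Or.inl ⟨e.1, heX, rfl⟩)
    have hne : κ e.1 ≠ κ e.2 := fun hh => he2 (hh ▸ he1)
    set r : W → W := fun w => if w = κ e.2 then κ e.1 else w with hr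
    by_cases hcon : ∀ Z ⊆ S, Z.Nonempty →
        ∑ z ∈ Z, (f z - if z = e.1 then 1 else 0) + 1 ≤ #(classes (fun v => r (κ v)) D Z) + p Z
    · obtain ⟨J, hJ, h1, h2⟩ := ih (fun v => r (κ v)) _ hcon
      have heJ : e ∉ J := fun hh => he (hJ hh)
      refine ⟨insert e J, Finset.insert_subset_insert _ hJ, ?_, ?_⟩
      · intro Z hZ hZne
        have h3 := h1 Z hZ hZne
        have h4 : #(Z.image fun v => r (κ v)) ≤ #(Z.image κ) := by
          have : (Z.image fun v => r (κ v)) = (Z.image κ).image r := by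
            rw [Finset.image_image]; rfl
          rw [this]
          exact Finset.card_image_le
        have h5 : ∀ z, f z - (#((insert e J).filter fun d => d.1 = z) : ℤ) =
            (f z - if z = e.1 then 1 else 0) - #(J.filter fun d => d.1 = z) := by
          intro z
          rw [Finset.filter_insert]
          by_cases hz : e.1 = z
          · rw [if_pos hz, if_pos hz.symm, Finset.card_insert_of_notMem (by simp [heJ])]
            push_cast
            ring
          · rw [if_neg hz, if_neg (fun hh => hz hh.symm)]
            ring
        rw [Finset.sum_congr rfl fun z _ => h5 z]
        have h4' : (#(Z.image fun v => r (κ v)) : ℤ) ≤ #(Z.image κ) := by exact_mod_cast h4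
        linarith
      · intro T hT hTκ
        rw [ofPairs_insert, ← sup_assoc]
        apply h2
        · refine hT.sup_edge_of_not_reachable fun hreach => hne ?_
          exact reachable_induct (P := fun v => κ e.1 = κ v)
            (fun u v (hu : κ e.1 = κ u) huv => hu.trans (hTκ u v huv)) hreach rfl
        · intro u v huv
          rw [SimpleGraph.sup_adj, SimpleGraph.edge_adj] at huv
          rcases huv with huv | ⟨⟨rfl, rfl⟩ | ⟨rfl, rfl⟩, -⟩
          · simp only [hTκ u v huv]
          · simp [hr]
          · simp [hr]
    exfalso
    push Not at hcon
    obtain ⟨Y, hYS, hYne, hY⟩ := hcon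
    have hY1 := h Y hYS hYne
    rw [classes_comp] at hY
    rw [Finset.sum_sub_distrib, Finset.sum_ite_eq'] at hY
    set A := classes κ D X with hA
    set B := classes κ D Y with hB
    have hcard : #(insert (κ e.2) B) ≤ #(B.image r) + 1 := by
      have hsub : (insert (κ e.2) B).erase (κ e.2) ⊆ B.image r := by
        intro w hw
        rw [Finset.mem_erase, Finset.mem_insert] at hw
        exact Finset.mem_image.mpr ⟨w, hw.2.resolve_left hw.1, by simp [hr, hw.1]⟩
      have h1 := Finset.card_le_card hsub
      have h2 := Finset.card_erase_add_one (Finset.mem_insert_self (κ e.2) B)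
      omega
    by_cases heY : e.1 ∈ Y
    · rw [if_pos heY] at hY
      rw [classes_insert_of_mem κ D heY] at hY1
      have hcard' : (#(insert (κ e.2) B) : ℤ) ≤ #(B.image r) + 1 := by exact_mod_cast hcard
      linarith
    rw [if_neg heY, sub_zero] at hY
    rw [classes_insert_of_notMem κ D heY] at hY1
    have hlt : #(B.image r) < #B := by
      have : (#(B.image r) : ℤ) < #B := by linarith
      exact_mod_cast this
    have hmem : κ e.1 ∈ B ∧ κ e.2 ∈ B := by
      by_contra hn
      refine hlt.ne (Finset.card_image_of_injOn ?_)
      intro x hx y hy hxy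
      simp only [hr] at hxy
      simp only [Finset.mem_coe] at hx hy
      grind
    have hBc : #B ≤ #(B.image r) + 1 :=
      (Finset.card_le_card (Finset.subset_insert _ _)).trans hcard
    have hBc' : (#B : ℤ) ≤ #(B.image r) + 1 := by exact_mod_cast hBc
    have hU := h (X ∪ Y) (Finset.union_subset hXS hYS) (hXne.mono Finset.subset_union_left)
    have hclU : classes κ (insert e D) (X ∪ Y) = A ∪ B := by
      rw [classes_insert_of_mem κ D (Finset.mem_union_left _ heX), classes_union,
        Finset.insert_eq_of_mem (Finset.mem_union_right _ hmem.2)]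
    rw [hclU] at hU
    have hsub := hp X Y
    have hsum := Finset.sum_union_inter (s₁ := X) (s₂ := Y) (f := f)
    have hcUI : (#(A ∪ B) : ℤ) + #(A ∩ B) = #A + #B := by
      exact_mod_cast Finset.card_union_add_card_inter A B
    rcases (X ∩ Y).eq_empty_or_nonempty with hI | hI
    · rw [hI] at hsub hsum
      rw [Finset.sum_empty] at hsum
      have hpos : 0 < #(A ∩ B) :=
        Finset.card_pos.mpr ⟨κ e.1, Finset.mem_inter.mpr ⟨he1, hmem.1⟩⟩
      have hpos' : (1 : ℤ) ≤ #(A ∩ B) := by exact_mod_cast hpos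
      linarith
    · have hI1 := h (X ∩ Y) (Finset.inter_subset_left.trans hXS) hI
      rw [classes_insert_of_notMem κ D fun hh => heY (Finset.mem_inter.mp hh).2] at hI1
      have hle : #(classes κ D (X ∩ Y)) ≤ #(A ∩ B) := Finset.card_le_card
        (Finset.subset_inter (classes_mono κ D Finset.inter_subset_left)
          (classes_mono κ D Finset.inter_subset_right))
      have hle' : (#(classes κ D (X ∩ Y)) : ℤ) ≤ #(A ∩ B) := by exact_mod_cast hle
      linarith

lemma isCograph_within {G : SimpleGraph V} (hG : IsCograph G) (X : Finset V) :
    IsCograph (within G X) := by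
  rintro a b c d hab hac had hbc hbd hcd ⟨h1, h2, h3, h4, h5, h6⟩
  exact hG a b c d hab hac had hbc hbd hcd ⟨h1.1, h2.1, h3.1,
    fun h => h4 ⟨h, h1.2.1, h2.2.2⟩, fun h => h5 ⟨h, h1.2.1, h3.2.2⟩,
    fun h => h6 ⟨h, h1.2.2, h3.2.2⟩⟩

lemma isCograph_within_of_induce {G : SimpleGraph V} {S : Finset V}
    (hG : IsCograph (G.induce (S : Set V))) : IsCograph (within G S) := by
  rintro a b c d hab hac had hbc hbd hcd ⟨h1, h2, h3, h4, h5, h6⟩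
  have ha := h1.2.1
  have hb := h1.2.2
  have hc := h2.2.2
  have hd := h3.2.2
  refine hG ⟨a, ha⟩ ⟨b, hb⟩ ⟨c, hc⟩ ⟨d, hd⟩ ?_ ?_ ?_ ?_ ?_ ?_ ⟨h1.1, h2.1, h3.1,
    fun h => h4 ⟨h, ha, hc⟩, fun h => h5 ⟨h, ha, hd⟩, fun h => h6 ⟨h, hb, hd⟩⟩ <;>
  simpa [Subtype.ext_iff]

lemma numComponents_eq_met (G : SimpleGraph V) (X : Finset V) :
    numComponents G X = met (within G X) X := by
  let φ : G.induce (X : Set V) →g within G X :=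
    ⟨Subtype.val, fun {a b} h => ⟨h, a.2, b.2⟩⟩
  have hinj : Function.Injective (SimpleGraph.ConnectedComponent.map φ) := by
    intro c d
    induction c using SimpleGraph.ConnectedComponent.ind with | h u =>
    induction d using SimpleGraph.ConnectedComponent.ind with | h v =>
    intro huv
    rw [SimpleGraph.ConnectedComponent.map_mk, SimpleGraph.ConnectedComponent.map_mk] at huv
    rw [SimpleGraph.ConnectedComponent.eq] at huv ⊢
    obtain ⟨_, h⟩ := reachable_induct
      (P := fun w => ∃ hw : w ∈ X, (G.induce (X : Set V)).Reachable u ⟨w, hw⟩)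
      (fun x y ⟨hx, hux⟩ (hxy : (within G X).Adj x y) => ⟨hxy.2.2,
        hux.trans (SimpleGraph.Adj.reachable (G := G.induce (X : Set V)) (u := ⟨x, hx⟩)
          (v := ⟨y, hxy.2.2⟩) hxy.1)⟩)
      huv ⟨u.2, SimpleGraph.Reachable.refl u⟩
    exact h
  rw [numComponents, met, ← Set.ncard_coe_finset, ← Nat.card_range_of_injective hinj,
    Nat.card_coe_set_eq]
  congr 1
  ext c
  simp only [Set.mem_range, Finset.coe_image, Set.mem_image, Finset.mem_coe]
  constructor
  · rintro ⟨d, rfl⟩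
    induction d using SimpleGraph.ConnectedComponent.ind with | h u =>
    exact ⟨u, u.2, rfl⟩
  · rintro ⟨x, hx, rfl⟩
    exact ⟨(G.induce (X : Set V)).connectedComponentMk ⟨x, hx⟩, rfl⟩

section Main

variable [Fintype V]

lemma card_closedNbhd_add_le (G : SimpleGraph V) {S Z : Finset V} (hZ : Z ⊆ S) :
    #(closedNbhd G Z) + #(Z.image (within G S).connectedComponentMk) ≤
      #(closedNbhd (within G S) Z) +
        #(classes (within G S).connectedComponentMk ((S ×ˢ Sᶜ).filter fun d => G.Adj d.1 d.2) Z) := by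
  set κ := (within G S).connectedComponentMk with hκ
  set N := closedNbhd G Z \ closedNbhd (within G S) Z with hN
  have hNS : ∀ v ∈ N, v ∉ S ∧ ∃ z ∈ Z, G.Adj z v := by
    intro v hv
    rw [hN, Finset.mem_sdiff, mem_closedNbhd, mem_closedNbhd] at hv
    push Not at hv
    obtain ⟨z, hz, hzv⟩ := hv.1.resolve_left hv.2.1
    exact ⟨fun hvS => hv.2.2 z hz ⟨hzv, hZ hz, hvS⟩, z, hz, hzv⟩
  have hiso : ∀ v ∈ N, ∀ u, κ v = κ u → u = v := fun v hv u huv =>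
    eq_of_reachable_of_isolated (fun w (hw : (within G S).Adj v w) => (hNS v hv).1 hw.2.1)
      (SimpleGraph.ConnectedComponent.eq.mp huv)
  have hinj : #(N.image κ) = #N :=
    Finset.card_image_of_injOn fun u hu v _ huv => (hiso u hu v huv).symm
  have hdisj : Disjoint (N.image κ) (Z.image κ) := by
    rw [Finset.disjoint_left]
    intro c hc hc'
    obtain ⟨v, hv, rfl⟩ := Finset.mem_image.mp hc
    obtain ⟨z, hz, hzv⟩ := Finset.mem_image.mp hc'
    exact (hNS v hv).1 (hiso v hv z hzv.symm ▸ hZ hz)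
  have hsub : N.image κ ∪ Z.image κ ⊆
      classes κ ((S ×ˢ Sᶜ).filter fun d => G.Adj d.1 d.2) Z := by
    intro c hc
    rw [mem_classes]
    rcases Finset.mem_union.mp hc with hc | hc
    · obtain ⟨v, hv, rfl⟩ := Finset.mem_image.mp hc
      obtain ⟨hvS, z, hz, hzv⟩ := hNS v hv
      exact Or.inr ⟨(z, v), by simp [hZ hz, hvS, hzv], hz, rfl⟩
    · exact Or.inl (Finset.mem_image.mp hc)
  have h1 := Finset.card_le_card hsub
  rw [Finset.card_union_of_disjoint hdisj, hinj] at h1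
  have h2 : #(closedNbhd G Z) ≤ #N + #(closedNbhd (within G S) Z) :=
    Finset.card_le_card_sdiff_add_card
  omega

/-- A demand of at most one at a non-isolated vertex can be met by adding an edge to a forest
that meets all other demands. -/
lemma exists_forest_of_erase {H : SimpleGraph V} {S : Finset V} {f : V → ℤ} {s w : V}
    (hw : H.Adj s w) (hs : f s ≤ 1) {T : SimpleGraph V} (hTH : T ≤ H) (hT : T.IsAcyclic)
    (hdeg : ∀ v ∈ S.erase s, f v ≤ (Nat.card (T.neighborSet v) : ℤ)) :
    ∃ T' ≤ H, T'.IsAcyclic ∧ ∀ v ∈ S, f v ≤ (Nat.card (T'.neighborSet v) : ℤ) := by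
  by_cases hiso : ∀ u, ¬ T.Adj s u
  · refine ⟨T ⊔ SimpleGraph.edge s w, sup_le hTH ((SimpleGraph.edge_le_iff _).mpr (Or.inr hw)),
      hT.sup_edge_of_not_reachable fun h => hw.ne' (eq_of_reachable_of_isolated hiso h), ?_⟩
    intro v hv
    by_cases hvs : v = s
    · subst hvs
      refine hs.trans ?_
      have : Nonempty ((T ⊔ SimpleGraph.edge v w).neighborSet v) :=
        ⟨⟨w, Or.inr (by simp [SimpleGraph.edge_adj, hw.ne])⟩⟩
      exact_mod_cast Nat.card_pos
    · refine (hdeg v (Finset.mem_erase.mpr ⟨hvs, hv⟩)).trans ?_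
      exact_mod_cast Nat.card_mono (Set.toFinite _) fun u hu => Or.inl hu
  · push Not at hiso
    obtain ⟨u, hu⟩ := hiso
    refine ⟨T, hTH, hT, fun v hv => ?_⟩
    by_cases hvs : v = s
    · subst hvs
      refine hs.trans ?_
      have : Nonempty (T.neighborSet v) := ⟨⟨u, hu⟩⟩
      exact_mod_cast Nat.card_pos
    · exact hdeg v (Finset.mem_erase.mpr ⟨hvs, hv⟩)

lemma card_neighborSet_sup_ofPairs {T : SimpleGraph V} {S : Finset V} {J : Finset (V × V)}
    (hT : ∀ u v, T.Adj u v → v ∈ S) (hJ : ∀ d ∈ J, d.1 ∈ S ∧ d.2 ∉ S) (v : V) :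
    Nat.card (T.neighborSet v) + #(J.filter fun d => d.1 = v) ≤
      Nat.card ((T ⊔ ofPairs J).neighborSet v) := by
  rw [Nat.card_eq_card_toFinset, Nat.card_eq_card_toFinset]
  have himg : #((J.filter fun d => d.1 = v).image Prod.snd) = #(J.filter fun d => d.1 = v) := by
    refine Finset.card_image_of_injOn fun d hd e he hde => ?_
    simp only [Finset.coe_filter, Set.mem_ofPred_eq] at hd he
    exact Prod.ext (hd.2.trans he.2.symm) hde
  rw [← himg, ← Finset.card_union_of_disjoint]
  · refine Finset.card_le_card fun u hu => ?_
    rw [Finset.mem_union] at hu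
    rw [Set.mem_toFinset, SimpleGraph.mem_neighborSet, SimpleGraph.sup_adj]
    rcases hu with hu | hu
    · exact Or.inl (Set.mem_toFinset.mp hu)
    · obtain ⟨d, hd, rfl⟩ := Finset.mem_image.mp hu
      obtain ⟨hdJ, rfl⟩ := Finset.mem_filter.mp hd
      refine Or.inr ((SimpleGraph.fromRel_adj _ _ _).mpr ⟨?_, Or.inl hdJ⟩)
      exact fun h => (hJ d hdJ).2 (h ▸ (hJ d hdJ).1)
  · rw [Finset.disjoint_left]
    intro u hu hu'
    obtain ⟨d, hd, rfl⟩ := Finset.mem_image.mp hu'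
    exact (hJ d (Finset.mem_filter.mp hd).1).2 (hT _ _ (Set.mem_toFinset.mp hu))

lemma exists_forest (S : Finset V) : ∀ (G : SimpleGraph V) (f : V → ℤ),
    IsCograph (within G S) →
    (∀ Z ⊆ S, Z.Nonempty →
      ∑ z ∈ Z, f z + met (within G Z) Z + 1 ≤ (#(closedNbhd G Z) : ℤ) + #Z) →
    ∃ F ≤ G, F.IsAcyclic ∧ ∀ v ∈ S, f v ≤ (Nat.card (F.neighborSet v) : ℤ) := by
  induction S using Finset.strongInduction with
  | H S ih =>
  intro G f hG h
  rcases S.eq_empty_or_nonempty with rfl | hS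
  · exact ⟨⊥, bot_le, SimpleGraph.isAcyclic_bot, by simp⟩
  set H := within G S with hH
  have hHZ : ∀ Z ⊆ S, within H Z = within G Z := fun Z hZ => within_within G hZ
  obtain ⟨J, hJ, hJf, hJT⟩ := exists_selection (W := H.ConnectedComponent)
    (treeRank_submodular hG) (by simp [treeRank, met]) (S := S)
    ((S ×ˢ Sᶜ).filter fun d => G.Adj d.1 d.2) H.connectedComponentMk f (by
      intro Z hZ hne
      have h1 := h Z hZ hne
      have h2 := card_closedNbhd_add_le G hZ
      rw [← hH] at h2
      zify at h2
      rw [treeRank, hHZ Z hZ, met]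
      rw [met] at h1
      rw [met]
      linarith)
  have hJS : ∀ d ∈ J, d.1 ∈ S ∧ d.2 ∉ S := fun d hd => by
    have := hJ hd
    simp only [Finset.mem_filter, Finset.mem_product, Finset.mem_compl] at this
    exact this.1
  set g : V → ℤ := fun z => f z - #(J.filter fun d => d.1 = z) with hg
  have hgZ : ∀ Z ⊆ S, Z.Nonempty →
      ∑ z ∈ Z, g z + met (within H Z) Z + 1 ≤ (#(closedNbhd H Z) : ℤ) + #Z := by
    intro Z hZ hne
    have h1 := hJf Z hZ hne
    rw [treeRank, met, met] at h1
    rw [met]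
    linarith
  have met_pos : ∀ Z : Finset V, Z.Nonempty → (1 : ℤ) ≤ met (within H Z) Z := fun Z hne => by
    have : 0 < met (within H Z) Z := Finset.card_pos.mpr (hne.image _)
    exact_mod_cast this
  obtain ⟨s, hs, hgs⟩ : ∃ s ∈ S, g s ≤ 1 := by
    by_contra! hcon
    have h1 := hgZ S (Finset.Subset.refl S) hS
    have h2 := met_pos S hS
    have h3 : closedNbhd H S = S := by
      ext v
      rw [mem_closedNbhd]
      exact ⟨fun hv => hv.elim id fun ⟨_, _, hx⟩ => hx.2.2, Or.inl⟩
    have h4 : ∑ _z ∈ S, (2 : ℤ) ≤ ∑ z ∈ S, g z :=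
      Finset.sum_le_sum fun z hz => by linarith [hcon z hz]
    rw [h3] at h1
    rw [Finset.sum_const, nsmul_eq_mul] at h4
    linarith
  obtain ⟨w, hw⟩ | hisol : (∃ w, H.Adj s w) ∨ g s ≤ 0 := by
    by_contra! hcon
    have h1 := hgZ {s} (by simpa using hs) (Finset.singleton_nonempty s)
    have h2 := met_pos {s} (Finset.singleton_nonempty s)
    have h3 : closedNbhd H {s} = {s} := by
      ext v
      simp [mem_closedNbhd, hcon.1]
    rw [h3] at h1
    simp only [Finset.sum_singleton, Finset.card_singleton, Nat.cast_one] at h1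
    linarith [hcon.2]
  all_goals
    obtain ⟨T, hTH, hT, hTd⟩ := ih (S.erase s) (Finset.erase_ssubset hs) H g
      (isCograph_within hG _) fun Z hZ => hgZ Z (hZ.trans (Finset.erase_subset _ _))
    obtain ⟨T', hTH', hT', hTd'⟩ : ∃ T' ≤ H, T'.IsAcyclic ∧
        ∀ v ∈ S, g v ≤ (Nat.card (T'.neighborSet v) : ℤ) := by
      first
      | exact exists_forest_of_erase hw hgs hTH hT hTd
      | refine ⟨T, hTH, hT, fun v hv => ?_⟩
        by_cases hvs : v = s
        · subst hvs
          exact hisol.trans (Nat.cast_nonneg _)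
        · exact hTd v (Finset.mem_erase.mpr ⟨hvs, hv⟩)
    refine ⟨T' ⊔ ofPairs J, sup_le (hTH'.trans (within_le G S)) ?_, hJT T' hT' ?_, ?_⟩
    · intro u v huv
      rw [ofPairs, SimpleGraph.fromRel_adj] at huv
      rcases huv.2 with hd | hd
      · exact (Finset.mem_filter.mp (hJ hd)).2
      · exact (Finset.mem_filter.mp (hJ hd)).2.symm
    · exact fun u v huv => SimpleGraph.ConnectedComponent.eq.mpr (hTH' huv).reachable
    · intro v hv
      have h1 := card_neighborSet_sup_ofPairs (fun u v huv => (hTH' huv).2.2) hJS v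
      have h2 := hTd' v hv
      simp only [hg] at h2
      zify at h1
      linarith

lemma card_edgeFinset_add_card_connectedComponent_le (n : ℕ) : ∀ H : SimpleGraph V,
    H.IsAcyclic → #H.edgeFinset = n → n + Nat.card H.ConnectedComponent ≤ Fintype.card V := by
  induction n with
  | zero =>
    intro H _ _
    rw [zero_add, ← Nat.card_eq_fintype_card]
    exact Nat.card_le_card_of_surjective H.connectedComponentMk
      fun c => c.ind fun v => ⟨v, rfl⟩
  | succ n ih =>
    intro H hH hn
    obtain ⟨e, he⟩ : H.edgeFinset.Nonempty := Finset.card_pos.mp (by omega)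
    induction e with
    | h u v =>
    have huv : H.Adj u v := by simpa using he
    set H' := H.deleteEdges {s(u, v)} with hH'
    have hle : H' ≤ H := SimpleGraph.deleteEdges_le _
    have hcard : #H'.edgeFinset = n := by
      have : H'.edgeFinset = H.edgeFinset.erase s(u, v) := by
        ext e
        simp [hH', SimpleGraph.edgeSet_deleteEdges, and_comm]
      rw [this, Finset.card_erase_of_mem he, hn]
      rfl
    have h1 := ih H' (hH.anti hle) (by convert hcard)
    have hnr : ¬ H'.Reachable u v := by
      have := SimpleGraph.isAcyclic_iff_forall_adj_isBridge.mp hH huv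
      exact SimpleGraph.isBridge_iff.mp this
    have hlt : Nat.card H.ConnectedComponent < Nat.card H'.ConnectedComponent := by
      refine lt_of_le_of_ne (SimpleGraph.ConnectedComponent.card_le_card_of_le hle) fun heq => ?_
      have hsurj := SimpleGraph.ConnectedComponent.surjective_map_ofLE hle
      have hbij := (Nat.bijective_iff_surjective_and_card _).mpr ⟨hsurj, heq.symm⟩
      refine hnr (SimpleGraph.ConnectedComponent.eq.mp (hbij.1 ?_))
      exact SimpleGraph.ConnectedComponent.eq.mpr huv.reachable
    omega

lemma met_add_card_compl_le (G : SimpleGraph V) (X : Finset V) :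
    met (within G X) X + #Xᶜ ≤ Nat.card (within G X).ConnectedComponent := by
  set κ := (within G X).connectedComponentMk with hκ
  have hiso : ∀ v ∈ Xᶜ, ∀ u, κ v = κ u → u = v := fun v hv u huv =>
    eq_of_reachable_of_isolated (fun w (hw : (within G X).Adj v w) => Finset.mem_compl.mp hv hw.2.1)
      (SimpleGraph.ConnectedComponent.eq.mp huv)
  have hinj : #(Xᶜ.image κ) = #Xᶜ :=
    Finset.card_image_of_injOn fun u hu v _ huv => (hiso u hu v huv).symm
  have hdisj : Disjoint (X.image κ) (Xᶜ.image κ) := by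
    rw [Finset.disjoint_left]
    intro c hc hc'
    obtain ⟨v, hv, rfl⟩ := Finset.mem_image.mp hc'
    obtain ⟨z, hz, hzv⟩ := Finset.mem_image.mp hc
    exact Finset.mem_compl.mp hv (hiso v hv z hzv.symm ▸ hz)
  rw [met, ← hinj, ← Finset.card_union_of_disjoint hdisj, Nat.card_eq_fintype_card]
  exact Finset.card_le_univ _

lemma sum_degree_add_met_lt {G F : SimpleGraph V} (hFG : F ≤ G) (hF : F.IsAcyclic)
    {X : Finset V} (hX : X.Nonempty) :
    ∑ x ∈ X, Nat.card (F.neighborSet x) + met (within G X) X + 1 ≤ #(closedNbhd G X) + #X := by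
  set I := F.edgeFinset.filter fun e => ∃ x ∈ X, x ∈ e with hI
  set E := (within F X).edgeFinset with hE
  obtain ⟨x₀, hx₀⟩ := hX
  have hsum : ∑ x ∈ X, Nat.card (F.neighborSet x) ≤ #I + #E := by
    have h1 : ∀ x ∈ X, Nat.card (F.neighborSet x) = #(I.filter fun e => x ∈ e) := by
      intro x hx
      rw [Nat.card_eq_fintype_card, SimpleGraph.card_neighborSet_eq_degree,
        ← SimpleGraph.card_incidenceFinset_eq_degree]
      congr 1
      ext e
      simp only [hI, SimpleGraph.mem_incidenceFinset, SimpleGraph.incidenceSet, Finset.mem_filter,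
        Set.mem_ofPred_eq, SimpleGraph.mem_edgeFinset]
      exact ⟨fun h => ⟨⟨h.1, x, hx, h.2⟩, h.2⟩, fun h => ⟨h.1.1, h.2⟩⟩
    rw [Finset.sum_congr rfl h1]
    have h2 := Finset.sum_card_bipartiteAbove_eq_sum_card_bipartiteBelow
      (s := X) (t := I) (fun x (e : Sym2 V) => x ∈ e)
    simp only [Finset.bipartiteAbove, Finset.bipartiteBelow] at h2
    rw [h2]
    have hEI : E ⊆ I := by
      intro e
      induction e with
      | h u v =>
      intro he
      have he' : (within F X).Adj u v := by simpa [hE] using he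
      simp only [hI, Finset.mem_filter, SimpleGraph.mem_edgeFinset, SimpleGraph.mem_edgeSet]
      exact ⟨he'.1, u, he'.2.1, by simp⟩
    have h3 : ∀ e ∈ I, #(X.filter fun x => x ∈ e) ≤ 1 + if e ∈ E then 1 else 0 := by
      intro e
      induction e with
      | h u v =>
      intro he
      have huv : F.Adj u v := by
        simpa using (Finset.mem_filter.mp he).1
      have hEuv : s(u, v) ∈ E ↔ u ∈ X ∧ v ∈ X := by
        simp only [hE, SimpleGraph.mem_edgeFinset, SimpleGraph.mem_edgeSet]
        exact ⟨fun h => h.2, fun h => ⟨huv, h⟩⟩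
      simp only [hEuv, Sym2.mem_iff]
      split_ifs with hc
      · refine (Finset.card_le_card (t := {u, v}) fun x hx => ?_).trans Finset.card_le_two
        simpa using (Finset.mem_filter.mp hx).2
      · refine Finset.card_le_one.mpr fun x hx y hy => ?_
        rw [Finset.mem_filter] at hx hy
        grind
    refine (Finset.sum_le_sum h3).trans ?_
    rw [Finset.sum_add_distrib, ← Finset.card_eq_sum_ones, Finset.sum_ite_mem,
      Finset.inter_eq_right.mpr hEI, ← Finset.card_eq_sum_ones]
  have hE' : #E + met (within G X) X ≤ #X := by
    have h1 := card_edgeFinset_add_card_connectedComponent_le _ (within F X)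
      (hF.anti (within_le F X)) rfl
    have hle : within F X ≤ within G X := fun _ _ h => ⟨hFG h.1, h.2⟩
    have h2 := SimpleGraph.ConnectedComponent.card_le_card_of_le hle
    have h3 := met_add_card_compl_le G X
    have h4 := Finset.card_add_card_compl X
    rw [← hE] at h1
    omega
  have hI' : #I + 1 ≤ #(closedNbhd G X) := by
    set K := SimpleGraph.fromEdgeSet (I : Set (Sym2 V)) with hK
    have hKadj : ∀ {u v}, K.Adj u v → F.Adj u v ∧ (u ∈ X ∨ v ∈ X) := by
      intro u v huv
      rw [hK, SimpleGraph.fromEdgeSet_adj] at huv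
      simp only [hI, Finset.coe_filter, Set.mem_ofPred_eq, SimpleGraph.mem_edgeFinset,
        SimpleGraph.mem_edgeSet, Sym2.mem_iff] at huv
      grind
    have hKE : K.edgeFinset = I := by
      ext e
      simp only [hK, SimpleGraph.mem_edgeFinset, SimpleGraph.edgeSet_fromEdgeSet, Set.mem_sdiff,
        Finset.mem_coe, and_iff_left_iff_imp]
      exact fun he => SimpleGraph.not_isDiag_of_mem_edgeFinset (Finset.mem_filter.mp he).1
    have h1 := card_edgeFinset_add_card_connectedComponent_le #I K
      (hF.anti fun _ _ h => (hKadj h).1) (by convert congrArg Finset.card hKE)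
    have hiso : ∀ v ∉ closedNbhd G X, ∀ u, K.Reachable v u → u = v := by
      intro v hv u
      refine eq_of_reachable_of_isolated fun w hw => hv (mem_closedNbhd.mpr ?_)
      rcases (hKadj hw).2 with h | h
      · exact Or.inl h
      · exact Or.inr ⟨w, h, (hFG (hKadj hw).1).symm⟩
    have hx₀N : x₀ ∈ closedNbhd G X := mem_closedNbhd.mpr (Or.inl hx₀)
    have h2 : #((insert x₀ (closedNbhd G X)ᶜ).image K.connectedComponentMk) =
        #(closedNbhd G X)ᶜ + 1 := by
      rw [Finset.card_image_of_injOn, Finset.card_insert_of_notMem (by simp [hx₀N])]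
      intro u hu v hv huv
      have huv' := SimpleGraph.ConnectedComponent.eq.mp huv
      simp only [Finset.coe_insert, Finset.coe_compl, Set.mem_insert_iff, Set.mem_compl_iff,
        Finset.mem_coe] at hu hv
      rcases hu with rfl | hu
      · rcases hv with rfl | hv
        · rfl
        · exact hiso v hv _ huv'.symm
      · exact (hiso u hu v huv').symm
    have h3 : #((insert x₀ (closedNbhd G X)ᶜ).image K.connectedComponentMk) ≤
        Nat.card K.ConnectedComponent := by
      rw [Nat.card_eq_fintype_card]
      exact Finset.card_le_univ _
    have h4 := Finset.card_add_card_compl (closedNbhd G X)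
    omega
  omega

lemma card_openNbhd_add_card (G : SimpleGraph V) (X : Finset V) :
    Nat.card (openNbhd G X) + #X = #(closedNbhd G X) := by
  have h : (openNbhd G X) = ((closedNbhd G X \ X : Finset V) : Set V) := by
    ext v
    simp only [openNbhd, Set.mem_ofPred_eq, Finset.coe_sdiff, Set.mem_sdiff, Finset.mem_coe,
      mem_closedNbhd]
    tauto
  rw [Nat.card_coe_set_eq, h, Set.ncard_coe_finset]
  exact Finset.card_sdiff_add_card_eq_card fun v hv => mem_closedNbhd.mpr (Or.inl hv)

end Main

end EgawaOzeki

/-- Egawa–Ozeki characterization: if `G[S]` is a cograph, then `G` has a forest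
subgraph with degree lower bounds `f` on `S` iff for every nonempty `X ⊆ S`,
`|Γ_G(X)| + 2|X| − c_G(X) > f(X)`. -/
theorem egawa_ozeki_characterization
    {V : Type*} [Fintype V] (G : SimpleGraph V) (S : Finset V) (f : V → ℤ)
    (hf : ∀ v ∈ S, 2 ≤ f v)
    (hcog : IsCograph (G.induce (S : Set V))) :
    (∃ F : SimpleGraph V, F ≤ G ∧ F.IsAcyclic ∧
        ∀ v ∈ S, f v ≤ (Nat.card (F.neighborSet v) : ℤ)) ↔
      (∀ X : Finset V, X ⊆ S → X.Nonempty →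
        (∑ x ∈ X, f x) <
          (Nat.card (openNbhd G X) : ℤ) + 2 * X.card - numComponents G X) := by

  have key : ∀ X : Finset V,
      (Nat.card (openNbhd G X) : ℤ) + 2 * X.card - numComponents G X =
        (EgawaOzeki.closedNbhd G X).card + X.card -
          EgawaOzeki.met (EgawaOzeki.within G X) X := by
    intro X
    rw [EgawaOzeki.numComponents_eq_met, ← EgawaOzeki.card_openNbhd_add_card]
    push_cast
    ring
  simp only [key]
  constructor
  · rintro ⟨F, hFG, hF, hdeg⟩ X hXS hX
    have h1 := EgawaOzeki.sum_degree_add_met_lt hFG hF hX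
    have h2 := Finset.sum_le_sum fun x hx => hdeg x (hXS hx)
    zify at h1
    linarith
  · intro h
    refine EgawaOzeki.exists_forest S G f (EgawaOzeki.isCograph_within_of_induce hcog) ?_
    intro Z hZ hne
    linarith [h Z hZ hne]
end

section
/- Let G be a finite simple graph with vertex set V, S ⊆ V such that G[S] is a cograph, and define b₀(X) = |Γ_G(X)| − c_{G[S]}(X) for X ⊆ S. Then for all A, B ⊆ S: b₀(A∪B) + b₀(A∩B) + |U(A,B)| ≤ b₀(A) + b₀(B), where U(A,B) is the set of vertices outside A∪B adjacent to both A∖B and B∖A but not to A∩B. In particular b₀ is submodular on subsets of S. -/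
/-- `b₀(X) = |Γ_G(X)| − c(G[X])`. -/
noncomputable def bZero {V : Type*} (G : SimpleGraph V) (X : Finset V) : ℤ :=
  (Nat.card (openNbhd G X) : ℤ) - numComponents G X

/-- `U(A,B)`: vertices outside `A ∪ B` adjacent to both `A \ B` and `B \ A`
but not to `A ∩ B`. -/
def Uset {V : Type*} [DecidableEq V] (G : SimpleGraph V) (A B : Finset V) : Set V :=
  {w : V | w ∉ A ∪ B ∧ (∃ a ∈ A \ B, G.Adj a w) ∧ (∃ b ∈ B \ A, G.Adj b w) ∧
    ¬ ∃ c ∈ A ∩ B, G.Adj c w}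

/-- `v` is a vertex of the connected component `c` of the subgraph of `G` induced by `X`. -/
def MemComp {V : Type*} (G : SimpleGraph V) (X : Finset V)
    (c : (G.induce (X : Set V)).ConnectedComponent) (v : V) : Prop :=
  ∃ h : v ∈ (X : Set V), (G.induce (X : Set V)).connectedComponentMk ⟨v, h⟩ = c

/-- The vertices of `A` with a neighbor in `B \ A`, but with no neighbor in `A ∩ B`. -/
def IsCross {V : Type*} (G : SimpleGraph V) (A B : Finset V) (v : V) : Prop :=
  v ∈ A ∧ v ∉ B ∧ (∃ w ∈ B, w ∉ A ∧ G.Adj v w) ∧ ∀ w ∈ A, w ∈ B → ¬ G.Adj v w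

namespace MemComp

variable {V : Type*} {G : SimpleGraph V} {X Y : Finset V}
  {c c' : (G.induce (X : Set V)).ConnectedComponent} {v w : V}

theorem exists_vertex (c : (G.induce (X : Set V)).ConnectedComponent) :
    ∃ v, MemComp G X c v := by
  induction c using SimpleGraph.ConnectedComponent.ind with
  | h v => exact ⟨v.1, v.2, rfl⟩

theorem mem (h : MemComp G X c v) : v ∈ X := h.1

theorem exists_comp (G : SimpleGraph V) (h : v ∈ X) : ∃ c, MemComp G X c v :=
  ⟨_, h, rfl⟩

theorem unique (h : MemComp G X c v) (h' : MemComp G X c' v) : c = c' := by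
  obtain ⟨_, rfl⟩ := h
  obtain ⟨_, rfl⟩ := h'
  rfl

theorem adj (h : MemComp G X c v) (hvw : G.Adj v w) (hw : w ∈ X) : MemComp G X c w := by
  obtain ⟨hv, rfl⟩ := h
  refine ⟨hw, ?_⟩
  rw [SimpleGraph.ConnectedComponent.eq]
  exact SimpleGraph.Adj.reachable (show G.Adj w v from hvw.symm)

theorem propagate (hv : MemComp G X c v) (hw : MemComp G X c w) {P : V → Prop} (base : P v)
    (step : ∀ x y, MemComp G X c x → MemComp G X c y → P x → G.Adj x y → P y) : P w := by
  obtain ⟨hv, rfl⟩ := hv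
  obtain ⟨hw, h⟩ := hw
  rw [SimpleGraph.ConnectedComponent.eq] at h
  obtain ⟨p⟩ := h.symm
  have key : ∀ (a b : (X : Set V)), (G.induce (X : Set V)).Walk a b → P a.1 →
      MemComp G X ((G.induce (X : Set V)).connectedComponentMk ⟨v, hv⟩) a.1 → P b.1 := by
    intro a b p
    induction p with
    | nil => intro h _; exact h
    | @cons x y z hxy q ih =>
      intro hx hm
      have hm' := hm.adj (show G.Adj x.1 y.1 from hxy) y.2
      exact ih (step _ _ hm hm' hx hxy) hm'
  exact key _ _ p base ⟨hv, rfl⟩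

theorem mono (hXY : X ⊆ Y) {d : (G.induce (Y : Set V)).ConnectedComponent}
    (hv : MemComp G X c v) (hw : MemComp G X c w) (hd : MemComp G Y d v) : MemComp G Y d w :=
  hv.propagate hw (P := MemComp G Y d) hd fun _ _ _ hy hx hxy => hx.adj hxy (hXY hy.mem)

/-- Two vertices in one component of an induced cograph are at distance at most two. -/
theorem dist_le_two {S : Finset V} (hcog : IsCograph (G.induce (S : Set V))) (hX : X ⊆ S)
    (hv : MemComp G X c v) (hw : MemComp G X c w) :
    v = w ∨ G.Adj v w ∨ ∃ z ∈ X, G.Adj v z ∧ G.Adj z w := by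
  refine hv.propagate hw (P := fun w => v = w ∨ G.Adj v w ∨ ∃ z ∈ X, G.Adj v z ∧ G.Adj z w)
    (Or.inl rfl) ?_
  rintro x y hx hy (rfl | h | ⟨z, hz, hvz, hzx⟩) hxy
  · exact Or.inr (Or.inl hxy)
  · exact Or.inr (Or.inr ⟨x, hx.mem, h, hxy⟩)
  · by_contra! hcon
    obtain ⟨hne, hvy, hall⟩ := hcon
    refine hcog ⟨v, hX hv.mem⟩ ⟨z, hX hz⟩ ⟨x, hX hx.mem⟩ ⟨y, hX hy.mem⟩ ?_ ?_ ?_ ?_ ?_ ?_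
      ⟨hvz, hzx, hxy, ?_, hvy, ?_⟩
    · simpa using hvz.ne
    · simp only [ne_eq, Subtype.mk.injEq]
      rintro rfl
      exact hvy hxy
    · simpa using hne
    · simpa using hzx.ne
    · simp only [ne_eq, Subtype.mk.injEq]
      rintro rfl
      exact hvy hvz
    · simpa using hxy.ne
    · exact fun h => hall x hx.mem h hxy
    · exact fun h => hall z hz hvz h

variable [DecidableEq V] {A B : Finset V}

/-- In an induced cograph, two vertices of `A ∩ B` in one component of `A ∪ B` lie in one
component of `A` or in one component of `B`. -/
theorem left_or_right {S : Finset V} (hcog : IsCograph (G.induce (S : Set V)))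
    (hA : A ⊆ S) (hB : B ⊆ S) {k : (G.induce ((A ∪ B : Finset V) : Set V)).ConnectedComponent}
    (hv : MemComp G (A ∪ B) k v) (hw : MemComp G (A ∪ B) k w)
    (hvA : v ∈ A) (hvB : v ∈ B) (hwA : w ∈ A) (hwB : w ∈ B) :
    (∃ a, MemComp G A a v ∧ MemComp G A a w) ∨ ∃ b, MemComp G B b v ∧ MemComp G B b w := by
  obtain ⟨a, ha⟩ := exists_comp G hvA
  obtain ⟨b, hb⟩ := exists_comp G hvB
  rcases hv.dist_le_two hcog (Finset.union_subset hA hB) hw with rfl | h | ⟨z, hz, h1, h2⟩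
  · exact Or.inl ⟨a, ha, ha⟩
  · exact Or.inl ⟨a, ha, ha.adj h hwA⟩
  · rcases Finset.mem_union.1 hz with hz | hz
    · exact Or.inl ⟨a, ha, (ha.adj h1 hz).adj h2 hwA⟩
    · exact Or.inr ⟨b, hb, (hb.adj h1 hz).adj h2 hwB⟩

/-- In an induced cograph, the part of `A ∩ B` in a component of `A ∪ B` lies in one component
of `A` or in one component of `B`. -/
theorem all_left_or_all_right {S : Finset V} (hcog : IsCograph (G.induce (S : Set V)))
    (hA : A ⊆ S) (hB : B ⊆ S) (k : (G.induce ((A ∪ B : Finset V) : Set V)).ConnectedComponent) :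
    (∀ x y, x ∈ A ∩ B → y ∈ A ∩ B → MemComp G (A ∪ B) k x → MemComp G (A ∪ B) k y →
      ∃ a, MemComp G A a x ∧ MemComp G A a y) ∨
    (∀ x y, x ∈ A ∩ B → y ∈ A ∩ B → MemComp G (A ∪ B) k x → MemComp G (A ∪ B) k y →
      ∃ b, MemComp G B b x ∧ MemComp G B b y) := by
  have key : ∀ x y, x ∈ A ∩ B → y ∈ A ∩ B → MemComp G (A ∪ B) k x → MemComp G (A ∪ B) k y →
      (∃ a, MemComp G A a x ∧ MemComp G A a y) ∨ ∃ b, MemComp G B b x ∧ MemComp G B b y := by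
    intro x y hx hy kx ky
    rw [Finset.mem_inter] at hx hy
    exact left_or_right hcog hA hB kx ky hx.1 hx.2 hy.1 hy.2
  have trans : ∀ {Z : Finset V} {x y z : V}, (∃ a, MemComp G Z a x ∧ MemComp G Z a y) →
      (∃ a, MemComp G Z a y ∧ MemComp G Z a z) → ∃ a, MemComp G Z a x ∧ MemComp G Z a z := by
    rintro Z x y z ⟨a, h1, h2⟩ ⟨a', h3, h4⟩
    obtain rfl := h2.unique h3
    exact ⟨a, h1, h4⟩
  have symm : ∀ {Z : Finset V} {x y : V}, (∃ a, MemComp G Z a x ∧ MemComp G Z a y) →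
      ∃ a, MemComp G Z a y ∧ MemComp G Z a x := fun ⟨a, h1, h2⟩ => ⟨a, h2, h1⟩
  by_contra! hcon
  obtain ⟨⟨x, y, hx, hy, kx, ky, hxy⟩, p, q, hp, hq, kp, kq, hpq⟩ := hcon
  have nA : ¬ ∃ a, MemComp G A a x ∧ MemComp G A a y := fun ⟨a, h, h'⟩ => hxy a h h'
  have nB : ¬ ∃ a, MemComp G B a p ∧ MemComp G B a q := fun ⟨a, h, h'⟩ => hpq a h h'
  have bxy := (key x y hx hy kx ky).resolve_left nA
  have toX : ∀ r, r ∈ A ∩ B → MemComp G (A ∪ B) k r →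
      ∃ b, MemComp G B b r ∧ MemComp G B b x := by
    intro r hr kr
    rcases key r x hr hx kr kx with h | h
    · rcases key r y hr hy kr ky with h' | h'
      · exact absurd (trans (symm h) h') nA
      · exact trans h' (symm bxy)
    · exact h
  exact nB (trans (toX p hp kp) (symm (toX q hq kq)))

/-- A component of `A` meets `B`, or contains a crossing vertex, or is a component of `A ∪ B`. -/
theorem trichotomy (a : (G.induce (A : Set V)).ConnectedComponent) (B : Finset V) :
    (∃ v, MemComp G A a v ∧ v ∈ B) ∨ (∃ v, MemComp G A a v ∧ IsCross G A B v) ∨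
      ∃ v k, MemComp G A a v ∧ MemComp G (A ∪ B) k v ∧
        ∀ w, MemComp G (A ∪ B) k w → w ∈ A ∧ w ∉ B := by
  by_cases h1 : ∃ v, MemComp G A a v ∧ v ∈ B
  · exact Or.inl h1
  by_cases h2 : ∃ v w, MemComp G A a v ∧ w ∈ B ∧ G.Adj v w
  · obtain ⟨v, w, hv, hw, hvw⟩ := h2
    exact Or.inr (Or.inl ⟨v, hv, hv.mem, fun h => h1 ⟨v, hv, h⟩,
      ⟨w, hw, fun h => h1 ⟨w, hv.adj hvw h, hw⟩, hvw⟩,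
      fun z hzA hzB hvz => h1 ⟨z, hv.adj hvz hzA, hzB⟩⟩)
  · obtain ⟨v, hv⟩ := exists_vertex a
    obtain ⟨k, hk⟩ := exists_comp G (Finset.mem_union_left B hv.mem)
    refine Or.inr (Or.inr ⟨v, k, hv, hk, fun w hw => ?_⟩)
    have : MemComp G A a w := by
      refine hk.propagate hw (P := MemComp G A a) hv fun x y _ hy hx hxy => ?_
      rcases Finset.mem_union.1 hy.mem with h | h
      · exact hx.adj hxy h
      · exact absurd ⟨x, y, hx, h, hxy⟩ h2
    exact ⟨this.mem, fun h => h1 ⟨w, this, h⟩⟩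

/-- A component of `A ∪ B` contained in `A` is a component of `A`. -/
theorem eq_of_forall_mem {k : (G.induce ((A ∪ B : Finset V) : Set V)).ConnectedComponent}
    {a a' : (G.induce (A : Set V)).ConnectedComponent}
    (hk : ∀ w, MemComp G (A ∪ B) k w → w ∈ A) (hv : MemComp G A a v) (hw : MemComp G A a' w)
    (kv : MemComp G (A ∪ B) k v) (kw : MemComp G (A ∪ B) k w) : a = a' :=
  unique (kv.propagate kw (P := MemComp G A a) hv fun _ y _ hy hx hxy => hx.adj hxy (hk y hy)) hw

end MemComp

/-- The number of components is submodular up to crossing vertices on an induced cograph. -/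
theorem numComponents_add_le {V : Type*} [Fintype V] [DecidableEq V] (G : SimpleGraph V)
    {S A B : Finset V} (hcog : IsCograph (G.induce (S : Set V))) (hA : A ⊆ S) (hB : B ⊆ S) :
    numComponents G A + numComponents G B ≤ numComponents G (A ∪ B) + (numComponents G (A ∩ B) +
      Nat.card {v : V // IsCross G A B v ∨ IsCross G B A v}) := by
  classical
  let Q : (G.induce ((A ∪ B : Finset V) : Set V)).ConnectedComponent → Prop := fun k =>
    ∀ x y, x ∈ A ∩ B → y ∈ A ∩ B → MemComp G (A ∪ B) k x → MemComp G (A ∪ B) k y →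
      ∃ a, MemComp G A a x ∧ MemComp G A a y
  have hQ : ∀ k, ¬ Q k → ∀ x y, x ∈ A ∩ B → y ∈ A ∩ B → MemComp G (A ∪ B) k x →
      MemComp G (A ∪ B) k y → ∃ b, MemComp G B b x ∧ MemComp G B b y := fun k hk =>
    (MemComp.all_left_or_all_right hcog hA hB k).resolve_left hk
  have hIU : A ∩ B ⊆ A ∪ B := Finset.inter_subset_left.trans Finset.subset_union_left
  let R : (G.induce (A : Set V)).ConnectedComponent ⊕ (G.induce (B : Set V)).ConnectedComponent →
      (G.induce ((A ∪ B : Finset V) : Set V)).ConnectedComponent ⊕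
        ((G.induce ((A ∩ B : Finset V) : Set V)).ConnectedComponent ⊕
          {v : V // IsCross G A B v ∨ IsCross G B A v}) → Prop := fun x y =>
    match x, y with
    | .inl a, .inl k => ∃ v, MemComp G A a v ∧ MemComp G (A ∪ B) k v ∧
        (v ∈ A ∩ B ∧ Q k ∨ ∀ w, MemComp G (A ∪ B) k w → w ∈ A ∧ w ∉ B)
    | .inl a, .inr (.inl c) => ∃ v k, MemComp G A a v ∧ MemComp G (A ∩ B) c v ∧
        MemComp G (A ∪ B) k v ∧ ¬ Q k
    | .inl a, .inr (.inr t) => MemComp G A a t.1 ∧ t.1 ∉ B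
    | .inr b, .inl k => ∃ v, MemComp G B b v ∧ MemComp G (A ∪ B) k v ∧
        (v ∈ A ∩ B ∧ ¬ Q k ∨ ∀ w, MemComp G (A ∪ B) k w → w ∈ B ∧ w ∉ A)
    | .inr b, .inr (.inl c) => ∃ v k, MemComp G B b v ∧ MemComp G (A ∩ B) c v ∧
        MemComp G (A ∪ B) k v ∧ Q k
    | .inr b, .inr (.inr t) => MemComp G B b t.1 ∧ t.1 ∉ A
  have total : ∀ x, ∃ y, R x y := by
    rintro (a | b)
    · rcases MemComp.trichotomy a B with ⟨v, hv, hvB⟩ | ⟨v, hv, ht⟩ | ⟨v, k, hv, hk, h⟩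
      · have hvI := Finset.mem_inter.2 ⟨hv.mem, hvB⟩
        obtain ⟨k, hk⟩ := MemComp.exists_comp G (hIU hvI)
        obtain ⟨c, hc⟩ := MemComp.exists_comp G hvI
        by_cases q : Q k
        · exact ⟨.inl k, v, hv, hk, Or.inl ⟨hvI, q⟩⟩
        · exact ⟨.inr (.inl c), v, k, hv, hc, hk, q⟩
      · exact ⟨.inr (.inr ⟨v, Or.inl ht⟩), hv, ht.2.1⟩
      · exact ⟨.inl k, v, hv, hk, Or.inr h⟩
    · have tri := MemComp.trichotomy b A
      rw [Finset.union_comm B A] at tri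
      rcases tri with ⟨v, hv, hvA⟩ | ⟨v, hv, ht⟩ | ⟨v, k, hv, hk, h⟩
      · have hvI := Finset.mem_inter.2 ⟨hvA, hv.mem⟩
        obtain ⟨k, hk⟩ := MemComp.exists_comp G (hIU hvI)
        obtain ⟨c, hc⟩ := MemComp.exists_comp G hvI
        by_cases q : Q k
        · exact ⟨.inr (.inl c), v, k, hv, hc, hk, q⟩
        · exact ⟨.inl k, v, hv, hk, Or.inl ⟨hvI, q⟩⟩
      · exact ⟨.inr (.inr ⟨v, Or.inr ht⟩), hv, ht.2.1⟩
      · exact ⟨.inl k, v, hv, hk, Or.inr h⟩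
  have mixed : ∀ a b y, R (.inl a) y → ¬ R (.inr b) y := by
    rintro a b (k | c | t)
    · rintro ⟨v, hv, kv, h⟩ ⟨w, hw, kw, h'⟩
      rcases h with ⟨hI, q⟩ | h <;> rcases h' with ⟨hI', q'⟩ | h'
      · exact q' q
      · exact (h' v kv).2 hv.mem
      · exact (h w kw).2 hw.mem
      · exact (h v kv).2 (h' v kv).1
    · rintro ⟨v, k, -, cv, kv, q⟩ ⟨w, k', -, cw, kw, q'⟩
      obtain rfl := (MemComp.mono hIU cv cw kv).unique kw
      exact q q'
    · rintro ⟨h, -⟩ ⟨-, h'⟩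
      exact h' h.mem
  have inj : ∀ x x' y, R x y → R x' y → x = x' := by
    rintro (a | b) (a' | b') y h h'
    · congr 1
      rcases y with k | c | t
      · obtain ⟨v, hv, kv, h⟩ := h
        obtain ⟨w, hw, kw, h'⟩ := h'
        rcases h with ⟨hI, q⟩ | h
        · rcases h' with ⟨hI', -⟩ | h'
          · obtain ⟨d, dv, dw⟩ := q v w hI hI' kv kw
            exact (hv.unique dv).trans (dw.unique hw)
          · exact absurd (Finset.mem_inter.1 hI).2 (h' v kv).2
        · exact MemComp.eq_of_forall_mem (fun w hw => (h w hw).1) hv hw kv kw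
      · obtain ⟨v, k, hv, cv, -⟩ := h
        obtain ⟨w, k', hw, cw, -⟩ := h'
        exact (MemComp.mono Finset.inter_subset_left cv cw hv).unique hw
      · exact h.1.unique h'.1
    · exact absurd h' (mixed _ _ _ h)
    · exact absurd h (mixed _ _ _ h')
    · congr 1
      rcases y with k | c | t
      · obtain ⟨v, hv, kv, h⟩ := h
        obtain ⟨w, hw, kw, h'⟩ := h'
        rcases h with ⟨hI, q⟩ | h
        · rcases h' with ⟨hI', -⟩ | h'
          · obtain ⟨d, dv, dw⟩ := hQ k q v w hI hI' kv kw
            exact (hv.unique dv).trans (dw.unique hw)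
          · exact absurd (Finset.mem_inter.1 hI).1 (h' v kv).2
        · exact (kv.propagate kw (P := MemComp G B b) hv
            fun _ y _ hy hx hxy => hx.adj hxy (h y hy).1).unique hw
      · obtain ⟨v, k, hv, cv, -⟩ := h
        obtain ⟨w, k', hw, cw, -⟩ := h'
        exact (MemComp.mono Finset.inter_subset_right cv cw hv).unique hw
      · exact h.1.unique h'.1
  choose f hf using total
  have hle := Nat.card_le_card_of_injective f fun x x' h => inj x x' _ (hf x) (h ▸ hf x')
  rwa [Nat.card_sum, Nat.card_sum, Nat.card_sum] at hle

theorem card_openNbhd_add {V : Type*} [Fintype V] [DecidableEq V] (G : SimpleGraph V)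
    (A B : Finset V) :
    Nat.card (openNbhd G A) + Nat.card (openNbhd G B) =
      Nat.card (openNbhd G (A ∪ B)) + Nat.card (openNbhd G (A ∩ B)) + Nat.card (Uset G A B) +
        Nat.card {v : V // IsCross G A B v ∨ IsCross G B A v} := by
  classical
  have count : ∀ s : Set V, Nat.card s = ∑ v, if v ∈ s then 1 else 0 := by
    intro s
    rw [Nat.card_eq_fintype_card, ← Set.toFinset_card, ← Finset.card_filter]
    congr 1
    ext v
    simp
  have hc := count {v : V | IsCross G A B v ∨ IsCross G B A v}
  rw [Set.coe_ofPred] at hc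
  rw [hc, count, count, count, count, count]
  simp only [← Finset.sum_add_distrib]
  refine Finset.sum_congr rfl fun v _ => ?_
  have split : ∀ P : V → Prop, ((∃ x ∈ A, P x) ↔ (∃ x ∈ A \ B, P x) ∨ ∃ x ∈ A ∩ B, P x) ∧
      ((∃ x ∈ B, P x) ↔ (∃ x ∈ B \ A, P x) ∨ ∃ x ∈ A ∩ B, P x) := by
    intro P
    simp only [Finset.mem_sdiff, Finset.mem_inter]
    grind
  have hA := (split fun x => G.Adj x v).1
  have hB := (split fun x => G.Adj x v).2
  have hU : (∃ x ∈ A ∪ B, G.Adj x v) ↔ (∃ x ∈ A, G.Adj x v) ∨ ∃ x ∈ B, G.Adj x v := by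
    simp only [Finset.mem_union]
    grind
  have cross : ∀ A B : Finset V, IsCross G A B v ↔
      v ∈ A ∧ v ∉ B ∧ (∃ x ∈ B \ A, G.Adj x v) ∧ ¬ ∃ x ∈ A ∩ B, G.Adj x v := by
    intro A B
    simp only [IsCross, Finset.mem_sdiff, Finset.mem_inter, G.adj_comm v]
    grind
  have h1 := cross A B
  have h2 := cross B A
  rw [Finset.inter_comm B A] at h2
  simp only [openNbhd, Uset, Set.mem_ofPred_eq, h1, h2, hU, hA, hB]
  have mem_union : v ∈ A ∪ B ↔ v ∈ A ∨ v ∈ B := Finset.mem_union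
  have mem_inter : v ∈ A ∩ B ↔ v ∈ A ∧ v ∈ B := Finset.mem_inter
  by_cases hp : ∃ x ∈ A \ B, G.Adj x v <;> by_cases hq : ∃ x ∈ B \ A, G.Adj x v <;>
    by_cases hr : ∃ x ∈ A ∩ B, G.Adj x v <;> by_cases a : v ∈ A <;> by_cases b : v ∈ B <;>
    simp only [hp, hq, hr, a, b, mem_union, mem_inter] <;> simp

/-- Strong submodularity of `b₀` on subsets of `S` when `G[S]` is a cograph. -/
theorem bZero_submodular
    {V : Type*} [Fintype V] [DecidableEq V] (G : SimpleGraph V) (S : Finset V)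
    (hcog : IsCograph (G.induce (S : Set V))) :
    ∀ A B : Finset V, A ⊆ S → B ⊆ S →
      bZero G (A ∪ B) + bZero G (A ∩ B) + (Nat.card (Uset G A B) : ℤ) ≤
        bZero G A + bZero G B := by
  intro A B hA hB
  have h1 := numComponents_add_le G hcog hA hB
  have h2 := card_openNbhd_add G A B
  unfold bZero
  omega
end
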